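/- Assume that 3 does not divide n or that m/s does not divide q^2 - q + 1. Then the automorphism group Aut(F/K) of the function field F of the curve Y_{n,s} is finite of order q^3·(q^2-1)·(m/s); moreover there exist a normal subgroup S of Aut(F/K) of order q^3 and a cyclic subgroup C of Aut(F/K) of order (q^2-1)·(m/s) such that S ∩ C is trivial and S·C = Aut(F/K) (i.e. Aut(F/K) is an internal semidirect product S ⋊ C). -/

import Mathlib

open MvPolynomial

/-- The defining ideal of the curve `Y_{n,s}` : it is generated by
`Z^(m/s) - (Y^(q^2) - Y)` and `Y^(q+1) - (X^q + X)` in `K[X,Y,Z]`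
(variables `X 0 = X`, `X 1 = Y`, `X 2 = Z`, and `t` stands for `m/s`). -/
noncomputable def YIdeal (K : Type) [Field K] (q t : ℕ) : Ideal (MvPolynomial (Fin 3) K) :=
  Ideal.span {X 2 ^ t - (X 1 ^ (q ^ 2) - X 1), X 1 ^ (q + 1) - (X 0 ^ q + X 0)}

/-- The coordinate ring `K[X,Y,Z]/I` of the curve `Y_{n,s}`. -/
noncomputable abbrev YRing (K : Type) [Field K] (q t : ℕ) :=
  MvPolynomial (Fin 3) K ⧸ YIdeal K q t

/-- The function field `F = Frac(K[X,Y,Z]/I)` of the curve `Y_{n,s}`. -/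
noncomputable abbrev YField (K : Type) [Field K] (q t : ℕ) :=
  FractionRing (YRing K q t)


set_option linter.unusedVariables false
set_option linter.unusedSectionVars false

/-- A normalized discrete valuation of `F` over `K`, with the convention `v 0 = 0`. -/
structure Plc (K F : Type) [Field K] [Field F] [Algebra K F] where
  v : F → ℤ
  v_zero : v 0 = 0
  v_mul : ∀ a b, a ≠ 0 → b ≠ 0 → v (a * b) = v a + v b
  v_add : ∀ a b, a ≠ 0 → b ≠ 0 → a + b ≠ 0 → min (v a) (v b) ≤ v (a + b)
  v_const : ∀ c : K, v (algebraMap K F c) = 0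
  v_surj : ∃ u, u ≠ 0 ∧ v u = 1

namespace Plc

variable {K F : Type} [Field K] [Field F] [Algebra K F] (P : Plc K F)

theorem ext' {P Q : Plc K F} (h : ∀ u, u ≠ 0 → P.v u = Q.v u) : P = Q := by
  have : P.v = Q.v := by
    funext u
    by_cases hu : u = 0
    · rw [hu, P.v_zero, Q.v_zero]
    · exact h u hu
  cases P; cases Q; simp_all

theorem v_one : P.v 1 = 0 := by simpa using P.v_const 1

theorem v_inv (u : F) : P.v u⁻¹ = - P.v u := by
  by_cases hu : u = 0
  · simp [hu, P.v_zero]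
  · have := P.v_mul u u⁻¹ hu (inv_ne_zero hu)
    rw [mul_inv_cancel₀ hu, P.v_one] at this
    omega

theorem v_div (a b : F) (ha : a ≠ 0) (hb : b ≠ 0) : P.v (a / b) = P.v a - P.v b := by
  rw [div_eq_mul_inv, P.v_mul _ _ ha (inv_ne_zero hb), P.v_inv]; ring

theorem v_pow (u : F) (n : ℕ) : P.v (u ^ n) = n * P.v u := by
  by_cases hu : u = 0
  · subst hu
    cases n with
    | zero => simp [P.v_one]
    | succ n => simp [P.v_zero]
  · induction n with
    | zero => simp [P.v_one]
    | succ n ih =>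
      rw [pow_succ, P.v_mul _ _ (pow_ne_zero _ hu) hu, ih]; push_cast; ring

theorem v_neg (u : F) : P.v (-u) = P.v u := by
  by_cases hu : u = 0
  · simp [hu]
  · have h := P.v_mul (algebraMap K F (-1)) u (by simp) hu
    rw [P.v_const] at h
    simpa using h

theorem v_const_mul (c : K) (hc : c ≠ 0) (u : F) : P.v (algebraMap K F c * u) = P.v u := by
  by_cases hu : u = 0
  · simp [hu]
  · rw [P.v_mul _ _ (by simpa using hc) hu, P.v_const]; ring

theorem v_prod {ι : Type*} (s : Finset ι) (f : ι → F) (h : ∀ i ∈ s, f i ≠ 0) :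
    P.v (∏ i ∈ s, f i) = ∑ i ∈ s, P.v (f i) := by
  classical
  induction s using Finset.induction_on with
  | empty => simp [P.v_one]
  | insert a s ha ih =>
    rw [Finset.prod_insert ha, Finset.sum_insert ha, P.v_mul, ih]
    · intro i hi; exact h i (Finset.mem_insert_of_mem hi)
    · exact h a (Finset.mem_insert_self _ _)
    · exact Finset.prod_ne_zero_iff.mpr fun i hi => h i (Finset.mem_insert_of_mem hi)

/-- `u` has valuation at least `n` (true for `u = 0`). -/
def ge (n : ℤ) (u : F) : Prop := u = 0 ∨ n ≤ P.v u

variable {P}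

theorem ge_zero (n : ℤ) : P.ge n 0 := Or.inl rfl

theorem ge_self (u : F) : P.ge (P.v u) u := Or.inr le_rfl

theorem ge.v_le {n : ℤ} {u : F} (h : P.ge n u) (hu : u ≠ 0) : n ≤ P.v u :=
  h.resolve_left hu

theorem ge.mono {n m : ℤ} {u : F} (h : P.ge n u) (hm : m ≤ n) : P.ge m u := by
  rcases h with h | h
  · exact Or.inl h
  · exact Or.inr (hm.trans h)

theorem ge.add {n : ℤ} {a b : F} (ha : P.ge n a) (hb : P.ge n b) : P.ge n (a + b) := by
  by_cases h0 : a = 0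
  · simpa [h0] using hb
  by_cases h1 : b = 0
  · simpa [h1] using ha
  by_cases h2 : a + b = 0
  · exact Or.inl h2
  · exact Or.inr ((le_min (ha.v_le h0) (hb.v_le h1)).trans (P.v_add a b h0 h1 h2))

theorem ge.neg {n : ℤ} {a : F} (ha : P.ge n a) : P.ge n (-a) := by
  rcases ha with h | h
  · exact Or.inl (by simp [h])
  · exact Or.inr (by rwa [P.v_neg])

theorem ge.sub {n : ℤ} {a b : F} (ha : P.ge n a) (hb : P.ge n b) : P.ge n (a - b) := by
  rw [sub_eq_add_neg]; exact ha.add hb.neg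

theorem ge.mul {n m : ℤ} {a b : F} (ha : P.ge n a) (hb : P.ge m b) : P.ge (n + m) (a * b) := by
  by_cases h0 : a = 0
  · exact Or.inl (by simp [h0])
  by_cases h1 : b = 0
  · exact Or.inl (by simp [h1])
  refine Or.inr ?_
  rw [P.v_mul _ _ h0 h1]
  have := ha.v_le h0
  have := hb.v_le h1
  omega

theorem ge.pow {a : F} (ha : P.ge 0 a) (k : ℕ) : P.ge 0 (a ^ k) := by
  rcases ha with h | h
  · cases k with
    | zero => right; simp [P.v_one]
    | succ k => left; simp [h]
  · right; rw [P.v_pow]; positivity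

theorem ge_const (c : K) : P.ge 0 (algebraMap K F c) := Or.inr (by rw [P.v_const])

theorem ge.const_mul {n : ℤ} {a : F} (c : K) (ha : P.ge n a) :
    P.ge n (algebraMap K F c * a) := by
  have := (ge_const (P := P) c).mul ha
  simpa using this

theorem ge_sum {ι : Type*} (s : Finset ι) (f : ι → F) (n : ℤ) (h : ∀ i ∈ s, P.ge n (f i)) :
    P.ge n (∑ i ∈ s, f i) := by
  classical
  induction s using Finset.induction_on with
  | empty => simpa using ge_zero n
  | insert a s ha ih =>
    rw [Finset.sum_insert ha]
    exact (h a (Finset.mem_insert_self _ _)).add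
      (ih fun i hi => h i (Finset.mem_insert_of_mem hi))

theorem add_of_lt {a b : F} (ha : a ≠ 0) (hb : P.ge (P.v a + 1) b) :
    a + b ≠ 0 ∧ P.v (a + b) = P.v a := by
  by_cases h1 : b = 0
  · simp [h1, ha]
  have hb' := hb.v_le h1
  have h2 : a + b ≠ 0 := by
    intro h
    have : b = -a := by linear_combination h
    rw [this, P.v_neg] at hb'
    omega
  refine ⟨h2, le_antisymm ?_ ?_⟩
  · by_contra hlt
    push Not at hlt
    have h3 := P.v_add (a + b) (-b) h2 (neg_ne_zero.mpr h1) (by simpa using ha)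
    rw [P.v_neg, add_neg_cancel_right] at h3
    rcases min_le_iff.mp h3 with h | h <;> omega
  · have := P.v_add a b ha h1 h2
    rcases min_le_iff.mp this with h | h <;> omega

/-- Transport of a place by an automorphism. -/
def tr (a : F ≃ₐ[K] F) (P : Plc K F) : Plc K F where
  v u := P.v (a.symm u)
  v_zero := by simp [P.v_zero]
  v_mul x y hx hy := by
    rw [map_mul]; exact P.v_mul _ _ (by simpa using hx) (by simpa using hy)
  v_add x y hx hy hxy := by
    rw [map_add]
    exact P.v_add _ _ (by simpa using hx) (by simpa using hy)
      (fun h => hxy ((map_eq_zero_iff a.symm a.symm.injective).mp (by rw [map_add]; exact h)))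
  v_const c := by rw [AlgEquiv.commutes]; exact P.v_const c
  v_surj := by
    obtain ⟨u, hu, h⟩ := P.v_surj
    exact ⟨a u, by simpa using hu, by simpa using h⟩

instance : MulAction (F ≃ₐ[K] F) (Plc K F) where
  smul := tr
  one_smul P := ext' fun u _ => rfl
  mul_smul a b P := ext' fun u _ => rfl

theorem smul_v (a : F ≃ₐ[K] F) (P : Plc K F) (u : F) : (a • P).v u = P.v (a.symm u) := rfl

theorem smul_v_apply (a : F ≃ₐ[K] F) (P : Plc K F) (u : F) : (a • P).v (a u) = P.v u := by
  rw [smul_v]; simp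

theorem inv_smul_v (a : F ≃ₐ[K] F) (P : Plc K F) (u : F) : (a⁻¹ • P).v u = P.v (a u) := rfl

end Plc


set_option linter.unusedVariables false
set_option linter.unusedSectionVars false

/-- The curve: generators, relations and universal property, with the numerical hypotheses. -/
structure Crv (p q t : ℕ) (K R : Type) [Field K] [CommRing R] [Algebra K R] where
  x : R
  y : R
  z : R
  hz : z ^ t = y ^ (q ^ 2) - y
  hx : y ^ (q + 1) = x ^ q + x
  gen : Algebra.adjoin K {x, y, z} = ⊤
  lift : ∀ (B : Type) [CommRing B] [Algebra K B] (X Y Z : B), Z ^ t = Y ^ (q ^ 2) - Y →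
    Y ^ (q + 1) = X ^ q + X → ∃ φ : R →ₐ[K] B, φ x = X ∧ φ y = Y ∧ φ z = Z
  hp : p.Prime
  hq : ∃ a, 0 < a ∧ q = p ^ a
  ht : 2 ≤ t
  htp : Nat.Coprime t p
  hnd : ¬ t ∣ q ^ 2 - q + 1

namespace Crv

variable {p q t : ℕ} {K R F : Type} [Field K] [IsAlgClosed K] [CharP K p] [CommRing R]
  [Algebra K R] [IsDomain R] [Field F] [Algebra K F] [Algebra R F] [IsScalarTower K R F]
  [IsFractionRing R F]

theorem q2 (C : Crv p q t K R) : 2 ≤ q := by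
  obtain ⟨a, ha, rfl⟩ := C.hq
  calc 2 ≤ p := C.hp.two_le
    _ = p ^ 1 := (pow_one p).symm
    _ ≤ p ^ a := Nat.pow_le_pow_right C.hp.pos ha

theorem tq (C : Crv p q t K R) : Nat.Coprime t q := by
  obtain ⟨a, ha, rfl⟩ := C.hq
  exact C.htp.pow_right a

theorem qK (C : Crv p q t K R) : (q : K) = 0 := by
  obtain ⟨a, ha, rfl⟩ := C.hq
  rw [Nat.cast_pow, CharP.cast_eq_zero, zero_pow ha.ne']

theorem tK (C : Crv p q t K R) : (t : K) ≠ 0 := by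
  intro h
  rw [CharP.cast_eq_zero_iff K p] at h
  have := Nat.Coprime.eq_one_of_dvd C.htp.symm h
  exact C.hp.one_lt.ne' this

theorem lt_q2 (C : Crv p q t K R) : q + 1 < q ^ 2 := by
  have := C.q2
  nlinarith

/-- monomials -/
def mon (C : Crv p q t K R) (κ : ℕ × ℕ × ℕ) : R := C.z ^ κ.1 * C.y ^ κ.2.1 * C.x ^ κ.2.2

variable (q t) in
/-- weights -/
def wt (κ : ℕ × ℕ × ℕ) : ℕ := q ^ 3 * κ.1 + t * (q * κ.2.1 + (q + 1) * κ.2.2)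

variable (q) in
/-- reduced exponents -/
def red : Set (ℕ × ℕ × ℕ) := {κ | κ.2.1 < q ^ 2 ∧ κ.2.2 < q}

theorem wt_inj (C : Crv p q t K R) {κ κ' : ℕ × ℕ × ℕ} (h : κ ∈ red q) (h' : κ' ∈ red q)
    (hw : wt q t κ = wt q t κ') : κ = κ' := by
  obtain ⟨k, i, j⟩ := κ
  obtain ⟨k', i', j'⟩ := κ'
  obtain ⟨hi, hj⟩ := h
  obtain ⟨hi', hj'⟩ := h'
  simp only [wt] at *
  have h0 : 0 < q := by have := C.q2; omega
  have e1 : j = j' := by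
    have : (t * j) ≡ (t * j') [MOD q] := by
      have : (q ^ 3 * k + t * (q * i + (q + 1) * j)) ≡
        (q ^ 3 * k' + t * (q * i' + (q + 1) * j')) [MOD q] := by rw [hw]
      have a1 : ∀ k i j, q ^ 3 * k + t * (q * i + (q + 1) * j) =
        t * j + q * (q ^ 2 * k + t * i + t * j) := by intros; ring
      rw [a1, a1] at this
      simpa [Nat.ModEq, Nat.add_mul_mod_self_left] using this
    have := Nat.ModEq.cancel_left_of_coprime (by simpa [Nat.Coprime, Nat.gcd_comm] using C.tq) this
    rwa [Nat.ModEq, Nat.mod_eq_of_lt hj, Nat.mod_eq_of_lt hj'] at this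
  subst e1
  have e2 : i = i' := by
    have h2 : q ^ 2 * k + t * i = q ^ 2 * k' + t * i' := by
      have : q * (q ^ 2 * k + t * i) = q * (q ^ 2 * k' + t * i') := by
        have e : q ^ 3 * k + t * (q * i + (q + 1) * j) =
          q * (q ^ 2 * k + t * i) + t * (q + 1) * j := by ring
        have e' : q ^ 3 * k' + t * (q * i' + (q + 1) * j) =
          q * (q ^ 2 * k' + t * i') + t * (q + 1) * j := by ring
        omega
      exact Nat.eq_of_mul_eq_mul_left h0 this
    have : (t * i) ≡ (t * i') [MOD q ^ 2] := by
      have : q ^ 2 * k + t * i ≡ q ^ 2 * k' + t * i' [MOD q ^ 2] := by rw [h2]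
      simpa [Nat.ModEq, Nat.mul_add_mod] using this
    have := Nat.ModEq.cancel_left_of_coprime (by
      simpa [Nat.Coprime, Nat.gcd_comm] using (C.tq.pow_right 2)) this
    rwa [Nat.ModEq, Nat.mod_eq_of_lt hi, Nat.mod_eq_of_lt hi'] at this
  subst e2
  have : q ^ 3 * k = q ^ 3 * k' := by omega
  have := Nat.eq_of_mul_eq_mul_left (by positivity) this
  rw [this]

theorem span_top (C : Crv p q t K R) : Submodule.span K (C.mon '' red q) = ⊤ := by
  set N := Submodule.span K (C.mon '' red q) with hN
  have hq2 := C.q2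
  have hlt := C.lt_q2
  have mem : ∀ κ ∈ red q, C.mon κ ∈ N := fun κ h => Submodule.subset_span ⟨κ, h, rfl⟩
  have cl : ∀ a : R, (∀ κ ∈ red q, C.mon κ * a ∈ N) → ∀ h ∈ N, h * a ∈ N := by
    intro a ha h hh
    induction hh using Submodule.span_induction with
    | mem u hu => obtain ⟨κ, hκ, rfl⟩ := hu; exact ha κ hκ
    | zero => simp
    | add u v _ _ hu hv => rw [add_mul]; exact N.add_mem hu hv
    | smul c u _ hu => rw [smul_mul_assoc]; exact N.smul_mem c hu
  have hy2 : C.y ^ (q ^ 2) = C.z ^ t + C.y := by rw [C.hz]; ring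
  have hxq : C.x ^ q = C.y ^ (q + 1) - C.x := by rw [C.hx]; ring
  have clz : ∀ h ∈ N, h * C.z ∈ N := cl _ (by
    rintro ⟨k, i, j⟩ hκ
    have := mem (k + 1, i, j) hκ
    convert this using 1
    simp only [mon]; ring)
  have cly : ∀ h ∈ N, h * C.y ∈ N := cl _ (by
    rintro ⟨k, i, j⟩ ⟨hi, hj⟩
    simp only at hi hj
    by_cases h1 : i + 1 < q ^ 2
    · have := mem (k, i + 1, j) ⟨h1, hj⟩
      convert this using 1
      simp only [mon]; ring
    · have hi' : i + 1 = q ^ 2 := by omega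
      have e1 := mem (k + t, 0, j) ⟨by simp; omega, hj⟩
      have e2 := mem (k, 1, j) ⟨by simp; omega, hj⟩
      convert N.add_mem e1 e2 using 1
      simp only [mon]
      calc _ = C.z ^ k * C.y ^ (i + 1) * C.x ^ j := by ring
        _ = _ := by rw [hi', hy2]; ring)
  have clyn : ∀ n, ∀ h ∈ N, h * C.y ^ n ∈ N := by
    intro n
    induction n with
    | zero => intro h hh; simpa using hh
    | succ n ih => intro h hh; rw [pow_succ, ← mul_assoc]; exact cly _ (ih h hh)
  have clx : ∀ h ∈ N, h * C.x ∈ N := cl _ (by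
    rintro ⟨k, i, j⟩ ⟨hi, hj⟩
    simp only at hi hj
    by_cases h1 : j + 1 < q
    · have := mem (k, i, j + 1) ⟨hi, h1⟩
      convert this using 1
      simp only [mon]; ring
    · have hj' : j + 1 = q := by omega
      have e1 := clyn (q + 1) _ (mem (k, i, 0) ⟨hi, by simp; omega⟩)
      have e2 := mem (k, i, 1) ⟨hi, by simp; omega⟩
      convert N.sub_mem e1 e2 using 1
      simp only [mon]
      calc _ = C.z ^ k * C.y ^ i * C.x ^ (j + 1) := by ring
        _ = _ := by rw [hj', hxq]; ring)
  have h1 : (1 : R) ∈ N := by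
    have := mem (0, 0, 0) ⟨by simp; omega, by simp; omega⟩
    simpa [mon] using this
  have key : ∀ u ∈ Algebra.adjoin K {C.x, C.y, C.z}, ∀ h ∈ N, h * u ∈ N := by
    intro u hu
    induction hu using Algebra.adjoin_induction with
    | mem u hu =>
      rcases hu with rfl | rfl | rfl
      exacts [clx, cly, clz]
    | algebraMap c =>
      intro h hh
      rw [mul_comm, ← Algebra.smul_def]
      exact N.smul_mem c hh
    | add u v _ _ hu hv => intro h hh; rw [mul_add]; exact N.add_mem (hu h hh) (hv h hh)
    | mul u v _ _ hu hv => intro h hh; rw [← mul_assoc]; exact hv _ (hu h hh)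
  rw [eq_top_iff]
  intro u _
  have := key u (by rw [C.gen]; trivial) 1 h1
  simpa using this

theorem lead (C : Crv p q t K R) (h : R) (hh : h ≠ 0) : ∃ κ ∈ red q, ∃ c : K, c ≠ 0 ∧
    ∃ h' ∈ Submodule.span K (C.mon '' {κ' | κ' ∈ red q ∧ wt q t κ' < wt q t κ}),
      h = algebraMap K R c * C.mon κ + h' := by
  classical
  have h1 : h ∈ Submodule.span K (C.mon '' red q) := by rw [C.span_top]; trivial
  rw [Finsupp.mem_span_image_iff_linearCombination] at h1
  obtain ⟨l, hl, rfl⟩ := h1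
  have hne : l.support.Nonempty := by
    rw [Finsupp.support_nonempty_iff]
    rintro rfl
    simp at hh
  obtain ⟨κ, hκ, hmax⟩ := Finset.exists_max_image l.support (wt q t) hne
  have hred : ∀ κ ∈ l.support, κ ∈ red q := fun κ h => hl h
  refine ⟨κ, hred κ hκ, l κ, by simpa using hκ,
    Finsupp.linearCombination K C.mon (l.erase κ), ?_, ?_⟩
  · rw [Finsupp.mem_span_image_iff_linearCombination]
    refine ⟨l.erase κ, ?_, rfl⟩
    intro κ' hκ'
    have h2 : κ' ∈ l.support.erase κ := by rw [← Finsupp.support_erase]; exact hκ'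
    obtain ⟨hn, hs⟩ := Finset.mem_erase.mp h2
    refine ⟨hred κ' hs, lt_of_le_of_ne (hmax κ' hs) fun e => hn ?_⟩
    exact C.wt_inj (hred κ' hs) (hred κ hκ) e
  · conv_lhs => rw [← Finsupp.single_add_erase κ l]
    rw [map_add, Finsupp.linearCombination_single, Algebra.smul_def]

end Crv


set_option linter.unusedVariables false
set_option linter.unusedSectionVars false

namespace Crv

variable {p q t : ℕ} {K R F : Type} [Field K] [IsAlgClosed K] [CharP K p] [CommRing R]
  [Algebra K R] [IsDomain R] [Field F] [Algebra K F] [Algebra R F] [IsScalarTower K R F]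
  [IsFractionRing R F]

theorem exists_y (C : Crv p q t K R) (z0 : K) : ∃ y0 : K, z0 ^ t = y0 ^ (q ^ 2) - y0 := by
  have h2 := C.q2
  have h4 : 1 < q ^ 2 := by nlinarith
  have hd : (Polynomial.X ^ (q ^ 2) - Polynomial.X - Polynomial.C (z0 ^ t) :
      Polynomial K).natDegree = q ^ 2 := by
    rw [Polynomial.natDegree_sub_C, Polynomial.natDegree_sub_eq_left_of_natDegree_lt] <;> simp [h4]
  obtain ⟨y0, hy⟩ := IsAlgClosed.exists_root
    (Polynomial.X ^ (q ^ 2) - Polynomial.X - Polynomial.C (z0 ^ t) : Polynomial K)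
    (fun h => by
      have := Polynomial.natDegree_eq_zero_iff_degree_le_zero.mpr h.le
      omega)
  refine ⟨y0, ?_⟩
  simp [Polynomial.IsRoot] at hy
  linear_combination -hy

theorem exists_x (C : Crv p q t K R) (y0 : K) : ∃ x0 : K, y0 ^ (q + 1) = x0 ^ q + x0 := by
  have h2 := C.q2
  have hd : (Polynomial.X ^ q + Polynomial.X - Polynomial.C (y0 ^ (q + 1)) :
      Polynomial K).natDegree = q := by
    rw [Polynomial.natDegree_sub_C, Polynomial.natDegree_add_eq_left_of_natDegree_lt] <;> simp
    omega
  obtain ⟨y0, hy⟩ := IsAlgClosed.exists_root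
    (Polynomial.X ^ q + Polynomial.X - Polynomial.C (y0 ^ (q + 1)) : Polynomial K)
    (fun h => by
      have := Polynomial.natDegree_eq_zero_iff_degree_le_zero.mpr h.le
      omega)
  refine ⟨y0, ?_⟩
  simp [Polynomial.IsRoot] at hy
  linear_combination -hy

theorem exists_pt (C : Crv p q t K R) (z0 : K) : ∃ φ : R →ₐ[K] K, φ C.z = z0 := by
  obtain ⟨y0, hy⟩ := C.exists_y z0
  obtain ⟨x0, hx⟩ := C.exists_x y0
  obtain ⟨φ, -, -, h⟩ := C.lift K x0 y0 z0 hy hx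
  exact ⟨φ, h⟩

theorem transc (C : Crv p q t K R) (P : Polynomial K) (h : Polynomial.aeval C.z P = 0) : P = 0 := by
  have : Infinite K := IsAlgClosed.instInfinite
  apply Polynomial.funext
  intro r
  obtain ⟨φ, hφ⟩ := C.exists_pt r
  have := congrArg φ h
  rw [← Polynomial.aeval_algHom_apply, hφ, map_zero] at this
  simpa [Polynomial.aeval_def] using this

theorem ext_hom (C : Crv p q t K R) {B : Type} [Semiring B] [Algebra K B] (f g : R →ₐ[K] B)
    (hx : f C.x = g C.x) (hy : f C.y = g C.y) (hz : f C.z = g C.z) : f = g := by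
  apply AlgHom.ext_of_adjoin_eq_top C.gen
  rintro u (rfl | rfl | rfl) <;> assumption

theorem ιinj : Function.Injective (algebraMap R F) := IsFractionRing.injective R F

theorem ι_ne {h : R} (hh : h ≠ 0) : algebraMap R F h ≠ 0 := by
  simpa using hh

theorem ιK (c : K) : algebraMap R F (algebraMap K R c) = algebraMap K F c :=
  (IsScalarTower.algebraMap_apply K R F c).symm

theorem z_ne (C : Crv p q t K R) : C.z ≠ 0 := fun h => by
  have := C.transc Polynomial.X (by simpa using h)
  simp at this

theorem y_ne (C : Crv p q t K R) : C.y ≠ 0 := fun h => by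
  have h1 := C.hz
  have h2 := C.q2
  have : q ^ 2 ≠ 0 := by positivity
  rw [h, zero_pow this, sub_zero] at h1
  exact C.z_ne (pow_eq_zero_iff (by have := C.ht; omega) |>.mp h1)

theorem x_ne (C : Crv p q t K R) : C.x ≠ 0 := fun h => by
  have h1 := C.hx
  have h2 := C.q2
  rw [h, zero_pow (by omega), add_zero] at h1
  exact C.y_ne (pow_eq_zero_iff (by omega) |>.mp h1)

theorem mem_const_of_isAlgebraic (u : F) (h : IsIntegral K u) : ∃ c : K, algebraMap K F c = u := by
  have h1 := IsAlgClosed.degree_eq_one_of_irreducible K (minpoly.irreducible h)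
  obtain ⟨c, hc⟩ := minpoly.mem_range_of_degree_eq_one K u h1
  exact ⟨c, hc⟩

theorem exists_W (C : Crv p q t K R) : ∃ W : ValuationSubring F,
    (∀ c : K, algebraMap K F c ∈ W) ∧ algebraMap R F C.z ∉ W := by
  set A : Subring F := (algebraMap K F).range with hA
  have hz : algebraMap R F C.z ∉ A := by
    rintro ⟨c, hc⟩
    rw [← ιK (R := R)] at hc
    have h0 := ιinj hc
    have := C.transc (Polynomial.X - Polynomial.C c) (by simp [h0])
    exact Polynomial.X_sub_C_ne_zero c this
  have : IsIntegrallyClosedIn A F := by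
    rw [isIntegrallyClosedIn_iff]
    refine ⟨Subtype.val_injective, ?_⟩
    intro u hu
    have : IsIntegral K u := by
      obtain ⟨P, hP, h0⟩ := hu
      have : Function.Surjective (algebraMap K F).rangeRestrict :=
        (algebraMap K F).rangeRestrict_surjective
      obtain ⟨Q, hQ, hd, hm⟩ := Polynomial.lifts_and_degree_eq_and_monic
        ((Polynomial.mem_lifts P).mpr (by
          have := Polynomial.map_surjective _ this P
          exact this)) hP
      refine ⟨Q, hm, ?_⟩
      rw [← h0, ← hQ, Polynomial.eval₂_map]
      rfl
    obtain ⟨c, hc⟩ := mem_const_of_isAlgebraic u this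
    exact ⟨⟨u, c, hc⟩, rfl⟩
  obtain ⟨W, h1, h2⟩ := Subring.exists_le_valuationSubring_of_isIntegrallyClosedIn hz
  exact ⟨W, fun c => h1 ⟨c, rfl⟩, h2⟩

end Crv


set_option linter.unusedVariables false
set_option linter.unusedSectionVars false

namespace Crv

variable {p q t : ℕ} {K R F : Type} [Field K] [IsAlgClosed K] [CharP K p] [CommRing R]
  [Algebra K R] [IsDomain R] [Field F] [Algebra K F] [Algebra R F] [IsScalarTower K R F]
  [IsFractionRing R F]

theorem exists_vinf (C : Crv p q t K R) : ∃ P : Plc K F, P.v (algebraMap R F C.z) = -(q : ℤ) ^ 3 := by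
  classical
  obtain ⟨W, hK, hz⟩ := C.exists_W (F := F)
  set w := W.valuation with hw
  have hq2 := C.q2
  have ht := C.ht
  have hq3 : q ^ 3 ≠ 0 := by positivity
  set g := w (algebraMap R F C.z) with hg
  have g1 : 1 < g := by
    rw [← not_le]; intro h; exact hz ((W.valuation_le_one_iff _).mp h)
  have g0 : g ≠ 0 := (zero_lt_one.trans g1).ne'
  have wK : ∀ c : K, c ≠ 0 → w (algebraMap K F c) = 1 := by
    intro c hc
    have h1 : w (algebraMap K F c) ≤ 1 := (W.valuation_le_one_iff _).mpr (hK c)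
    have h2 : w (algebraMap K F c⁻¹) ≤ 1 := (W.valuation_le_one_iff _).mpr (hK c⁻¹)
    rw [map_inv₀, map_inv₀] at h2
    apply le_antisymm h1
    have : w (algebraMap K F c) ≠ 0 := by simpa using hc
    exact (inv_le_one₀ (zero_lt_iff.mpr this)).mp h2
  have wy : w (algebraMap R F C.y) ^ (q ^ 2) = g ^ t := by
    have e := congrArg (fun u => w (algebraMap R F u)) C.hz
    simp only [map_sub, map_pow] at e
    have y1 : 1 < w (algebraMap R F C.y) := by
      by_contra h
      push Not at h
      have : g ^ t ≤ 1 := by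
        rw [hg, e]
        refine (w.map_sub _ _).trans (max_le ?_ h)
        rw [map_pow]; exact pow_le_one₀ zero_le h
      exact absurd this (not_le.mpr (one_lt_pow₀ g1 (by omega)))
    rw [hg, e, Valuation.map_sub_eq_of_lt_left]
    · rw [map_pow]
    · rw [map_pow]; exact lt_self_pow₀ y1 (by nlinarith)
  have wx : w (algebraMap R F C.x) ^ q = w (algebraMap R F C.y) ^ (q + 1) := by
    have e := congrArg (fun u => w (algebraMap R F u)) C.hx
    simp only [map_add, map_pow] at e
    have y1 : 1 < w (algebraMap R F C.y) := by
      by_contra h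
      push Not at h
      have h3 := pow_le_one₀ (n := q ^ 2) zero_le h
      rw [wy] at h3
      exact absurd h3 (not_le.mpr (one_lt_pow₀ g1 (by omega)))
    have x1 : 1 < w (algebraMap R F C.x) := by
      by_contra h
      push Not at h
      have : w (algebraMap R F C.y) ^ (q + 1) ≤ 1 := by
        rw [e]
        refine (w.map_add _ _).trans (max_le ?_ h)
        rw [map_pow]; exact pow_le_one₀ zero_le h
      exact absurd this (not_le.mpr (one_lt_pow₀ y1 (by omega)))
    rw [e, Valuation.map_add_eq_of_lt_left]
    · rw [map_pow]
    · rw [map_pow]; exact lt_self_pow₀ x1 (by omega)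
  have wy3 : w (algebraMap R F C.y) ^ (q ^ 3) = g ^ (t * q) := by
    rw [pow_mul g, ← wy, ← pow_mul]; congr 1
  have wx3 : w (algebraMap R F C.x) ^ (q ^ 3) = g ^ (t * (q + 1)) := by
    rw [pow_mul g, ← wy]
    calc _ = (w (algebraMap R F C.x) ^ q) ^ (q ^ 2) := by rw [← pow_mul]; congr 1; ring
      _ = _ := by rw [wx, ← pow_mul, ← pow_mul, mul_comm]
  have wmon : ∀ κ, w (algebraMap R F (C.mon κ)) ^ (q ^ 3) = g ^ (wt q t κ) := by
    intro κ
    simp only [mon, wt, map_mul, map_pow]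
    calc _ = (g ^ (q ^ 3)) ^ κ.1 * (w (algebraMap R F C.y) ^ (q ^ 3)) ^ κ.2.1
          * (w (algebraMap R F C.x) ^ (q ^ 3)) ^ κ.2.2 := by
            rw [hg, mul_pow, mul_pow, pow_right_comm, pow_right_comm _ _ (q ^ 3),
              pow_right_comm _ _ (q ^ 3)]
      _ = _ := by
        rw [wy3, wx3, ← pow_mul, ← pow_mul, ← pow_mul, ← pow_add, ← pow_add]; congr 1; ring
  have wR : ∀ h : R, h ≠ 0 → ∃ n : ℕ, w (algebraMap R F h) ^ (q ^ 3) = g ^ n := by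
    intro h hh
    obtain ⟨κ, hκ, c, hc, h', hh', e⟩ := C.lead h hh
    refine ⟨wt q t κ, ?_⟩
    have small : ∀ u ∈ Submodule.span K (C.mon '' {κ' | κ' ∈ red q ∧ wt q t κ' < wt q t κ}),
        w (algebraMap R F u) < w (algebraMap R F (C.mon κ)) := by
      intro u hu
      have hpos : 0 < w (algebraMap R F (C.mon κ)) := by
        rw [zero_lt_iff]; intro h0
        have := wmon κ
        rw [h0, zero_pow hq3] at this
        exact pow_ne_zero _ g0 this.symm
      induction hu using Submodule.span_induction with
      | mem u hu =>
        obtain ⟨κ', ⟨-, hlt⟩, rfl⟩ := hu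
        apply lt_of_pow_lt_pow_left₀ (q ^ 3) zero_le
        rw [wmon, wmon]
        exact pow_lt_pow_right₀ g1 hlt
      | zero => simpa using hpos
      | add u v _ _ hu hv => rw [map_add]; exact w.map_add_lt hu hv
      | smul c u _ hu =>
        by_cases hc : c = 0
        · simpa [hc] using hpos
        · rw [Algebra.smul_def, map_mul, map_mul, ιK, wK c hc, one_mul]; exact hu
    have hc' : w (algebraMap R F (algebraMap K R c * C.mon κ)) = w (algebraMap R F (C.mon κ)) := by
      rw [map_mul, map_mul, ιK, wK c hc, one_mul]
    rw [e, map_add, Valuation.map_add_eq_of_lt_left, hc', wmon]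
    rw [hc']; exact small h' hh'
  have wF : ∀ u : F, u ≠ 0 → ∃ n : ℤ, w u ^ (q ^ 3) = g ^ (-n) := by
    intro u hu
    obtain ⟨a, b, hb, rfl⟩ := IsFractionRing.div_surjective (A := R) u
    have hb0 : b ≠ 0 := nonZeroDivisors.ne_zero hb
    have ha0 : a ≠ 0 := by rintro rfl; simp at hu
    obtain ⟨n, hn⟩ := wR a ha0
    obtain ⟨k, hk⟩ := wR b hb0
    refine ⟨k - n, ?_⟩
    rw [map_div₀, div_pow, hn, hk, neg_sub, zpow_sub₀ g0, zpow_natCast, zpow_natCast]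
  choose! v hv using wF
  have mono := zpow_right_strictMono₀ g1
  have huniq : ∀ u : F, u ≠ 0 → ∀ n : ℤ, w u ^ (q ^ 3) = g ^ (-n) → v u = n := by
    intro u hu n hn
    have := mono.injective ((hv u hu).symm.trans hn)
    simpa using this
  refine ⟨⟨fun u => if u = 0 then 0 else v u, by simp, ?_, ?_, ?_, ?_⟩, ?_⟩
  · intro a b ha hb
    simp only [ha, hb, mul_eq_zero, or_self, if_false]
    apply huniq _ (mul_ne_zero ha hb)
    rw [map_mul, mul_pow, hv a ha, hv b hb, ← zpow_add₀ g0]; ring_nf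
  · intro a b ha hb hab
    simp only [ha, hb, hab, if_false]
    have h1 := w.map_add a b
    have h2 : w (a + b) ^ (q ^ 3) ≤ max (w a ^ (q ^ 3)) (w b ^ (q ^ 3)) := by
      rcases le_max_iff.mp h1 with h | h
      · exact le_max_of_le_left (pow_le_pow_left₀ zero_le h _)
      · exact le_max_of_le_right (pow_le_pow_left₀ zero_le h _)
    rw [hv _ ha, hv _ hb, hv _ hab] at h2
    rw [min_le_iff]
    rcases le_max_iff.mp h2 with h | h
    · left; have := mono.le_iff_le.mp h; omega
    · right; have := mono.le_iff_le.mp h; omega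
  · intro c
    by_cases hc : c = 0
    · simp [hc]
    · have : algebraMap K F c ≠ 0 := by simpa using hc
      simp only [this, if_false]
      apply huniq _ this
      rw [wK c hc]; simp
  · have hco : IsCoprime (t : ℤ) ((q ^ 3 : ℕ) : ℤ) := Nat.isCoprime_iff_coprime.mpr (C.tq.pow_right 3)
    obtain ⟨a, b, hab⟩ := hco
    have hx0 := ι_ne (F := F) C.x_ne
    have hy0 := ι_ne (F := F) C.y_ne
    have hz0 := ι_ne (F := F) C.z_ne
    have hu : (algebraMap R F C.y / algebraMap R F C.x) ^ a * (algebraMap R F C.z) ^ (-b) ≠ 0 :=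
      mul_ne_zero (zpow_ne_zero _ (div_ne_zero hy0 hx0)) (zpow_ne_zero _ hz0)
    refine ⟨_, hu, ?_⟩
    simp only [hu, if_false]
    apply huniq _ hu
    rw [map_mul, map_zpow₀, map_zpow₀, mul_pow, ← zpow_natCast, ← zpow_mul, mul_comm a, zpow_mul,
      zpow_natCast, map_div₀, div_pow, wy3, wx3, ← hg, ← zpow_natCast, ← zpow_natCast,
      ← zpow_natCast, ← zpow_sub₀ g0, ← zpow_mul, ← zpow_mul, ← zpow_add₀ g0]
    congr 1
    push_cast at hab ⊢
    linear_combination (-1 : ℤ) * hab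
  · have hz0 := ι_ne (F := F) C.z_ne
    simp only [hz0, if_false]
    apply huniq _ hz0
    rw [← hg, neg_neg]
    norm_cast

end Crv


set_option linter.unusedVariables false
set_option linter.unusedSectionVars false

namespace Crv

variable {p q t : ℕ} {K R F : Type} [Field K] [IsAlgClosed K] [CharP K p] [CommRing R]
  [Algebra K R] [IsDomain R] [Field F] [Algebra K F] [Algebra R F] [IsScalarTower K R F]
  [IsFractionRing R F]

theorem vy_of_neg (C : Crv p q t K R) (P : Plc K F) (h : P.v (algebraMap R F C.z) < 0) :
    (q : ℤ) ^ 2 * P.v (algebraMap R F C.y) = t * P.v (algebraMap R F C.z) := by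
  have hq2 := C.q2
  have ht := C.ht
  have hy0 := ι_ne (F := F) C.y_ne
  have hz0 := ι_ne (F := F) C.z_ne
  have e := congrArg (algebraMap R F) C.hz
  simp only [map_sub, map_pow] at e
  have ev := congrArg P.v e
  rw [P.v_pow] at ev
  have hy : P.v (algebraMap R F C.y) < 0 := by
    by_contra hn
    have h1 : P.ge 0 (algebraMap R F C.y) := Or.inr (by omega)
    have h2 : P.ge 0 (algebraMap R F C.z ^ t) := by rw [e]; exact (h1.pow _).sub h1
    have := h2.v_le (pow_ne_zero _ hz0)
    rw [P.v_pow] at this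
    have : (t : ℤ) * P.v (algebraMap R F C.z) < 0 := mul_neg_of_pos_of_neg (by omega) h
    omega
  have h4 : 2 ≤ q ^ 2 := by nlinarith
  have := (P.add_of_lt (b := -algebraMap R F C.y) (pow_ne_zero (q ^ 2) hy0) (Or.inr (by
    rw [P.v_neg, P.v_pow]
    have : ((q ^ 2 : ℕ) : ℤ) ≥ 2 := by exact_mod_cast h4
    nlinarith))).2
  rw [← sub_eq_add_neg, ← ev, P.v_pow] at this
  rw [this]; push_cast; ring

theorem vx_of_neg (C : Crv p q t K R) (P : Plc K F) (h : P.v (algebraMap R F C.z) < 0) :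
    (q : ℤ) * P.v (algebraMap R F C.x) = (q + 1) * P.v (algebraMap R F C.y) := by
  have hq2 := C.q2
  have ht := C.ht
  have hy0 := ι_ne (F := F) C.y_ne
  have hx0 := ι_ne (F := F) C.x_ne
  have e := congrArg (algebraMap R F) C.hx
  simp only [map_add, map_pow] at e
  have ev := congrArg P.v e
  rw [P.v_pow] at ev
  have hy : P.v (algebraMap R F C.y) < 0 := by
    have := C.vy_of_neg P h
    by_contra hn
    have h1 : (0:ℤ) ≤ (q : ℤ) ^ 2 * P.v (algebraMap R F C.y) := by
      apply mul_nonneg (by positivity) (by omega)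
    have : (t : ℤ) * P.v (algebraMap R F C.z) < 0 := mul_neg_of_pos_of_neg (by omega) h
    omega
  have hx : P.v (algebraMap R F C.x) < 0 := by
    by_contra hn
    have h1 : P.ge 0 (algebraMap R F C.x) := Or.inr (by omega)
    have h2 : P.ge 0 (algebraMap R F C.y ^ (q + 1)) := by rw [e]; exact (h1.pow _).add h1
    have := h2.v_le (pow_ne_zero _ hy0)
    rw [P.v_pow] at this
    have : ((q + 1 : ℕ) : ℤ) * P.v (algebraMap R F C.y) < 0 :=
      mul_neg_of_pos_of_neg (by positivity) hy
    omega
  have := (P.add_of_lt (b := algebraMap R F C.x) (pow_ne_zero q hx0) (Or.inr (by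
    rw [P.v_pow]
    have : (q : ℤ) ≥ 2 := by exact_mod_cast hq2
    nlinarith))).2
  rw [← ev, P.v_pow] at this
  push_cast at this
  omega

theorem v_mon_of_neg (C : Crv p q t K R) (P : Plc K F) (h : P.v (algebraMap R F C.z) < 0)
    (κ : ℕ × ℕ × ℕ) :
    (q : ℤ) ^ 3 * P.v (algebraMap R F (C.mon κ)) = P.v (algebraMap R F C.z) * wt q t κ := by
  have hx0 := ι_ne (F := F) C.x_ne
  have hy0 := ι_ne (F := F) C.y_ne
  have hz0 := ι_ne (F := F) C.z_ne
  have e1 := C.vy_of_neg P h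
  have e2 := C.vx_of_neg P h
  simp only [mon, wt, map_mul, map_pow]
  rw [P.v_mul _ _ (mul_ne_zero (pow_ne_zero _ hz0) (pow_ne_zero _ hy0)) (pow_ne_zero _ hx0),
    P.v_mul _ _ (pow_ne_zero _ hz0) (pow_ne_zero _ hy0), P.v_pow, P.v_pow, P.v_pow]
  push_cast
  linear_combination (q * κ.2.1 + (q + 1) * κ.2.2 : ℤ) * e1 + (q : ℤ) ^ 2 * κ.2.2 * e2

theorem mon_ne (C : Crv p q t K R) (κ : ℕ × ℕ × ℕ) : C.mon κ ≠ 0 :=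
  mul_ne_zero (mul_ne_zero (pow_ne_zero _ C.z_ne) (pow_ne_zero _ C.y_ne)) (pow_ne_zero _ C.x_ne)

theorem low_of_neg (C : Crv p q t K R) (P : Plc K F) (h : P.v (algebraMap R F C.z) < 0)
    (n : ℕ) (u : R)
    (hu : u ∈ Submodule.span K (C.mon '' {κ' | κ' ∈ red q ∧ wt q t κ' < n})) :
    u = 0 ∨ P.v (algebraMap R F C.z) * n < (q : ℤ) ^ 3 * P.v (algebraMap R F u) := by
  have hq2 := C.q2
  have hq3 : (0 : ℤ) < (q : ℤ) ^ 3 := by positivity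
  set b : ℤ := P.v (algebraMap R F C.z) * n with hb
  have key : P.ge (b / (q : ℤ) ^ 3 + 1) (algebraMap R F u) := by
    induction hu using Submodule.span_induction with
    | mem u hu =>
      obtain ⟨κ', ⟨-, hlt⟩, rfl⟩ := hu
      have := C.v_mon_of_neg P h κ'
      right
      have h2 : b < P.v (algebraMap R F (C.mon κ')) * (q : ℤ) ^ 3 := by
        rw [mul_comm, this, hb]
        have : (wt q t κ' : ℤ) < n := by exact_mod_cast hlt
        nlinarith
      exact Int.ediv_lt_of_lt_mul hq3 h2
    | zero => left; simp
    | add u v _ _ hu hv => rw [map_add]; exact hu.add hv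
    | smul c u _ hu => rw [Algebra.smul_def, map_mul, ιK]; exact hu.const_mul c
  by_cases hu0 : u = 0
  · exact Or.inl hu0
  · right
    have := key.v_le (ι_ne hu0)
    have h3 := (Int.ediv_lt_iff_lt_mul hq3).mp (Int.lt_of_add_one_le this)
    linarith

theorem lead_val (C : Crv p q t K R) (P : Plc K F) (h : P.v (algebraMap R F C.z) < 0)
    (κ : ℕ × ℕ × ℕ) (c : K) (hc : c ≠ 0) (h' : R)
    (hh' : h' ∈ Submodule.span K (C.mon '' {κ' | κ' ∈ red q ∧ wt q t κ' < wt q t κ})) :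
    (q : ℤ) ^ 3 * P.v (algebraMap R F (algebraMap K R c * C.mon κ + h')) =
      P.v (algebraMap R F C.z) * wt q t κ := by
  have hq2 := C.q2
  have hq3 : (0 : ℤ) < (q : ℤ) ^ 3 := by positivity
  have hm := C.v_mon_of_neg P h κ
  have h0 : algebraMap K F c * algebraMap R F (C.mon κ) ≠ 0 :=
    mul_ne_zero (by simpa using hc) (ι_ne (C.mon_ne κ))
  rw [map_add, map_mul, ιK, (P.add_of_lt h0 _).2, P.v_const_mul c hc, hm]
  rw [P.v_const_mul c hc]
  rcases C.low_of_neg P h _ h' hh' with h1 | h1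
  · left; simp [h1]
  · right
    rw [← hm] at h1
    have := lt_of_mul_lt_mul_left h1 hq3.le
    omega

variable (F) in
/-- the place at infinity -/
noncomputable def vinf (C : Crv p q t K R) : Plc K F := C.exists_vinf.choose

theorem vinf_z (C : Crv p q t K R) : (C.vinf F).v (algebraMap R F C.z) = -(q : ℤ) ^ 3 :=
  C.exists_vinf.choose_spec

theorem vinf_z_neg (C : Crv p q t K R) : (C.vinf F).v (algebraMap R F C.z) < 0 := by
  rw [vinf_z]; have := C.q2
  have : (0 : ℤ) < (q : ℤ) ^ 3 := by positivity
  omega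

theorem q3pos (C : Crv p q t K R) : (0 : ℤ) < (q : ℤ) ^ 3 := by have := C.q2; positivity

theorem vinf_mon (C : Crv p q t K R) (κ : ℕ × ℕ × ℕ) :
    (C.vinf F).v (algebraMap R F (C.mon κ)) = - wt q t κ := by
  have := C.v_mon_of_neg (C.vinf F) C.vinf_z_neg κ
  rw [vinf_z] at this
  have h3 := C.q3pos
  exact mul_left_cancel₀ h3.ne' (by linarith)

theorem vinf_y (C : Crv p q t K R) : (C.vinf F).v (algebraMap R F C.y) = -(t * q : ℤ) := by
  have := C.vinf_mon (F := F) (0, 1, 0)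
  simpa [mon, wt] using this

theorem vinf_x (C : Crv p q t K R) : (C.vinf F).v (algebraMap R F C.x) = -(t * (q + 1) : ℤ) := by
  have := C.vinf_mon (F := F) (0, 0, 1)
  simpa [mon, wt] using this

theorem lead_inf (C : Crv p q t K R) (h : R) (hh : h ≠ 0) : ∃ κ ∈ red q, ∃ c : K, c ≠ 0 ∧
    ∃ h' ∈ Submodule.span K (C.mon '' {κ' | κ' ∈ red q ∧ wt q t κ' < wt q t κ}),
      h = algebraMap K R c * C.mon κ + h' ∧ (C.vinf F).v (algebraMap R F h) = - wt q t κ ∧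
      (C.vinf F).ge (- wt q t κ + 1) (algebraMap R F h') := by
  obtain ⟨κ, hκ, c, hc, h', hh', e⟩ := C.lead h hh
  have h3 := C.q3pos
  refine ⟨κ, hκ, c, hc, h', hh', e, ?_, ?_⟩
  · have := C.lead_val (C.vinf F) C.vinf_z_neg κ c hc h' hh'
    rw [← e, vinf_z] at this
    exact mul_left_cancel₀ h3.ne' (by linarith)
  · rcases C.low_of_neg (C.vinf F) C.vinf_z_neg _ h' hh' with h1 | h1
    · left; simp [h1]
    · right
      rw [vinf_z, neg_mul, ← mul_neg] at h1
      have := lt_of_mul_lt_mul_left h1 h3.le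
      omega

theorem vinf_nonpos (C : Crv p q t K R) (h : R) : (C.vinf F).v (algebraMap R F h) ≤ 0 := by
  by_cases hh : h = 0
  · simp [hh, Plc.v_zero]
  · obtain ⟨κ, -, -, -, -, -, -, e, -⟩ := C.lead_inf (F := F) h hh
    rw [e]; omega

theorem v_of_neg (C : Crv p q t K R) (P : Plc K F) (h : P.v (algebraMap R F C.z) < 0) (u : F)
    (hu : u ≠ 0) : (q : ℤ) ^ 3 * P.v u = - P.v (algebraMap R F C.z) * (C.vinf F).v u := by
  have hR : ∀ a : R, a ≠ 0 → (q : ℤ) ^ 3 * P.v (algebraMap R F a) =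
      - P.v (algebraMap R F C.z) * (C.vinf F).v (algebraMap R F a) := by
    intro a ha
    obtain ⟨κ, hκ, c, hc, h', hh', e, e1, -⟩ := C.lead_inf (F := F) a ha
    have := C.lead_val P h κ c hc h' hh'
    rw [e1, e, this]; ring
  obtain ⟨a, b, hb, rfl⟩ := IsFractionRing.div_surjective (A := R) u
  have hb0 : b ≠ 0 := nonZeroDivisors.ne_zero hb
  have ha0 : a ≠ 0 := by rintro rfl; simp at hu
  rw [P.v_div _ _ (ι_ne ha0) (ι_ne hb0), Plc.v_div _ _ _ (ι_ne ha0) (ι_ne hb0), mul_sub, mul_sub,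
    hR a ha0, hR b hb0]

theorem uniq_inf (C : Crv p q t K R) (P : Plc K F) (h : P.v (algebraMap R F C.z) < 0) :
    P = C.vinf F := by
  have h3 := C.q3pos
  obtain ⟨u, hu, hu1⟩ := (C.vinf F).v_surj
  have e1 := C.v_of_neg P h u hu
  rw [hu1, mul_one] at e1
  have e2 : ∀ w : F, w ≠ 0 → P.v w = P.v u * (C.vinf F).v w := by
    intro w hw
    have := C.v_of_neg P h w hw
    rw [← e1, mul_assoc] at this
    exact mul_left_cancel₀ h3.ne' this
  obtain ⟨w, hw, hw1⟩ := P.v_surj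
  have e3 := e2 w hw
  rw [hw1] at e3
  have hpos : 0 < P.v u := by
    by_contra hn
    have : (q : ℤ) ^ 3 * P.v u ≤ 0 := mul_nonpos_of_nonneg_of_nonpos h3.le (by omega)
    omega
  have : P.v u = 1 := by
    rcases Int.isUnit_iff.mp (IsUnit.of_mul_eq_one _ e3.symm) with h | h <;> omega
  exact Plc.ext' fun w hw => by rw [e2 w hw, this, one_mul]

theorem red0 (C : Crv p q t K R) : ((0, 0, 0) : ℕ × ℕ × ℕ) ∈ red q := by
  have h : 0 < q := by have := C.q2; omega
  exact ⟨pow_pos h 2, h⟩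

theorem redy (C : Crv p q t K R) : ((0, 1, 0) : ℕ × ℕ × ℕ) ∈ red q := by
  have h := C.q2
  exact ⟨by show 1 < q ^ 2; nlinarith, by show 0 < q; omega⟩

theorem redx (C : Crv p q t K R) : ((0, 0, 1) : ℕ × ℕ × ℕ) ∈ red q := by
  have h := C.q2
  exact ⟨by show 0 < q ^ 2; positivity, by show 1 < q; omega⟩

theorem const_of_vinf (C : Crv p q t K R) (h : R) (hh : 0 ≤ (C.vinf F).v (algebraMap R F h)) :
    ∃ c : K, h = algebraMap K R c := by
  by_cases h0 : h = 0
  · exact ⟨0, by simp [h0]⟩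
  obtain ⟨κ, hκ, c, hc, h', hh', e, e1, e2⟩ := C.lead_inf (F := F) h h0
  rw [e1] at hh
  have hw : wt q t κ = 0 := by omega
  have hq2 := C.q2
  have hκ0 : κ = (0, 0, 0) := C.wt_inj hκ C.red0 (by rw [hw]; simp [wt])
  have : h' = 0 := by
    by_contra hne
    have := e2.v_le (ι_ne hne)
    have := C.vinf_nonpos (F := F) h'
    rw [hw] at *
    simp at *
    omega
  refine ⟨c, ?_⟩
  rw [e, this, hκ0]; simp [mon]

end Crv


set_option linter.unusedVariables false
set_option linter.unusedSectionVars false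

namespace Crv

variable {p q t : ℕ} {K R F : Type} [Field K] [IsAlgClosed K] [CharP K p] [CommRing R]
  [Algebra K R] [IsDomain R] [Field F] [Algebra K F] [Algebra R F] [IsScalarTower K R F]
  [IsFractionRing R F]

theorem frob_pow (C : Crv p q t K R) {B : Type} [CommRing B] [Algebra K B] (a b : B) (n : ℕ) :
    (a + b) ^ (q ^ n) = a ^ (q ^ n) + b ^ (q ^ n) := by
  rcases subsingleton_or_nontrivial B with h | h
  · exact Subsingleton.elim _ _
  · have : Fact p.Prime := ⟨C.hp⟩
    have : CharP B p := charP_of_injective_algebraMap (algebraMap K B).injective p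
    obtain ⟨e, he, rfl⟩ := C.hq
    rw [← pow_mul]
    exact add_pow_char_pow a b p (e * n)

theorem frob (C : Crv p q t K R) {B : Type} [CommRing B] [Algebra K B] (a b : B) :
    (a + b) ^ q = a ^ q + b ^ q := by
  simpa using C.frob_pow a b 1

theorem frob_sub_pow (C : Crv p q t K R) {B : Type} [CommRing B] [Algebra K B] (a b : B) (n : ℕ) :
    (a - b) ^ (q ^ n) = a ^ (q ^ n) - b ^ (q ^ n) := by
  have := C.frob_pow (a - b) b n
  rw [sub_add_cancel] at this
  rw [this]; ring

theorem frob_sub (C : Crv p q t K R) {B : Type} [CommRing B] [Algebra K B] (a b : B) :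
    (a - b) ^ q = a ^ q - b ^ q := by
  simpa using C.frob_sub_pow a b 1

theorem noeth (C : Crv p q t K R) : Algebra.FiniteType K R :=
  by classical exact ⟨⟨{C.x, C.y, C.z}, by simpa using C.gen⟩⟩

theorem inj_of_surj {A : Type} [CommRing A] [IsNoetherianRing A] (f : A →+* A)
    (hs : Function.Surjective f) : Function.Injective f := by
  have hmono : Monotone fun n : ℕ => RingHom.ker (f ^ n) := by
    apply monotone_nat_of_le_succ
    intro n u hu
    rw [RingHom.mem_ker] at hu ⊢
    rw [pow_succ', RingHom.mul_def, RingHom.comp_apply, hu, map_zero]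
  obtain ⟨n, hn⟩ := monotone_stabilizes_iff_noetherian.mpr ‹IsNoetherianRing A› ⟨_, hmono⟩
  rw [injective_iff_map_eq_zero]
  intro u hu
  have hsn : Function.Surjective (f ^ n) := by
    rw [RingHom.coe_pow]; exact hs.iterate n
  obtain ⟨w, rfl⟩ := hsn u
  have h1 : w ∈ RingHom.ker (f ^ (n + 1)) := by
    rw [RingHom.mem_ker, pow_succ', RingHom.mul_def, RingHom.comp_apply, hu]
  have h2 := hn (n + 1) (by omega)
  simp only [OrderHom.coe_mk] at h2
  rw [← h2] at h1
  exact h1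

theorem exists_aut_R (C : Crv p q t K R) (X Y Z : R) (hz : Z ^ t = Y ^ (q ^ 2) - Y)
    (hx : Y ^ (q + 1) = X ^ q + X) (hgen : Algebra.adjoin K {X, Y, Z} = ⊤) :
    ∃ a : F ≃ₐ[K] F, a (algebraMap R F C.x) = algebraMap R F X ∧
      a (algebraMap R F C.y) = algebraMap R F Y ∧ a (algebraMap R F C.z) = algebraMap R F Z := by
  obtain ⟨φ, h1, h2, h3⟩ := C.lift R X Y Z hz hx
  have hs : Function.Surjective φ := by
    rw [← AlgHom.range_eq_top, eq_top_iff, ← hgen, Algebra.adjoin_le_iff]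
    rintro u (rfl | rfl | rfl)
    exacts [⟨_, h1⟩, ⟨_, h2⟩, ⟨_, h3⟩]
  have : Algebra.FiniteType K R := C.noeth
  have : IsNoetherianRing R := Algebra.FiniteType.isNoetherianRing K R
  have hi : Function.Injective φ :=
    inj_of_surj (φ : R →+* R) hs
  let e : R ≃ₐ[K] R := AlgEquiv.ofBijective φ ⟨hi, hs⟩
  refine ⟨IsFractionRing.fieldEquivOfAlgEquiv K F F e, ?_, ?_, ?_⟩
  · rw [IsFractionRing.fieldEquivOfAlgEquiv_algebraMap]; exact congrArg _ h1
  · rw [IsFractionRing.fieldEquivOfAlgEquiv_algebraMap]; exact congrArg _ h2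
  · rw [IsFractionRing.fieldEquivOfAlgEquiv_algebraMap]; exact congrArg _ h3

/-- valid parameters -/
def trip (C : Crv p q t K R) (c β γ : K) : Prop :=
  c ^ (t * (q ^ 2 - 1)) = 1 ∧ β ^ (q ^ 2) = β ∧ γ ^ q + γ = β ^ (q + 1)

/-- the automorphism `a` has parameters `c, β, γ` -/
def isA (C : Crv p q t K R) (a : F ≃ₐ[K] F) (c β γ : K) : Prop :=
  a (algebraMap R F C.z) = algebraMap R F (algebraMap K R c * C.z) ∧
  a (algebraMap R F C.y) = algebraMap R F (algebraMap K R (c ^ t) * C.y + algebraMap K R β) ∧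
  a (algebraMap R F C.x) = algebraMap R F (algebraMap K R ((c ^ t) ^ (q + 1)) * C.x +
    algebraMap K R (c ^ t * β ^ q) * C.y + algebraMap K R γ)

theorem trip_c (C : Crv p q t K R) {c β γ : K} (h : C.trip c β γ) : c ≠ 0 ∧ (c ^ t) ^ (q ^ 2) = c ^ t := by
  obtain ⟨h1, -, -⟩ := h
  have hq2 := C.q2
  have h4 : 2 ≤ q ^ 2 := by nlinarith
  have ht := C.ht
  refine ⟨?_, ?_⟩
  · rintro rfl
    rw [zero_pow] at h1
    · exact zero_ne_one h1
    · apply Nat.mul_ne_zero <;> omega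
  · rw [pow_mul] at h1
    obtain ⟨e, he⟩ : ∃ e, q ^ 2 = e + 1 := ⟨q ^ 2 - 1, by omega⟩
    rw [he] at h1 ⊢
    rw [pow_succ]
    simp at h1
    rw [h1, one_mul]

theorem exists_aut (C : Crv p q t K R) {c β γ : K} (h : C.trip c β γ) :
    ∃ a : F ≃ₐ[K] F, C.isA a c β γ := by
  obtain ⟨hc, hα⟩ := C.trip_c h
  obtain ⟨-, hβ, hγ⟩ := h
  set α := c ^ t with hαd
  have hα0 : α ≠ 0 := pow_ne_zero _ hc
  have key := C.exists_aut_R (F := F)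
    (algebraMap K R (α ^ (q + 1)) * C.x + algebraMap K R (α * β ^ q) * C.y + algebraMap K R γ)
    (algebraMap K R α * C.y + algebraMap K R β) (algebraMap K R c * C.z)
  suffices hh : _ ∧ _ ∧ _ by
    obtain ⟨a, h1, h2, h3⟩ := key hh.1 hh.2.1 hh.2.2
    exact ⟨a, h3, h2, h1⟩
  refine ⟨?_, ?_, ?_⟩
  · rw [C.frob_pow, mul_pow, mul_pow, ← map_pow, ← map_pow, ← map_pow, hα, hβ, C.hz]
    rw [← hαd]; ring
  · rw [pow_succ, C.frob, C.frob, C.frob, mul_pow, mul_pow, mul_pow, ← map_pow, ← map_pow, ← map_pow,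
      ← map_pow, ← map_pow]
    have e1 : (α ^ (q + 1)) ^ q = α ^ (q + 1) := by
      calc (α ^ (q + 1)) ^ q = α ^ (q ^ 2) * α ^ q := by ring
        _ = _ := by rw [hα]; ring
    have e2 : (α * β ^ q) ^ q = α ^ q * β := by
      calc (α * β ^ q) ^ q = α ^ q * β ^ (q ^ 2) := by ring
        _ = _ := by rw [hβ]
    rw [e1, e2]
    have e3 := congrArg (algebraMap K R) hγ
    have e4 := C.hx
    simp only [map_mul, map_pow, map_add] at e3 ⊢
    linear_combination (algebraMap K R α) ^ (q + 1) * e4 - e3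
  · set A := Algebra.adjoin K {algebraMap K R (α ^ (q + 1)) * C.x + algebraMap K R (α * β ^ q) * C.y
      + algebraMap K R γ, algebraMap K R α * C.y + algebraMap K R β, algebraMap K R c * C.z} with hA
    have k : ∀ d : K, algebraMap K R d ∈ A := fun d => A.algebraMap_mem d
    have mx : algebraMap K R (α ^ (q + 1)) * C.x + algebraMap K R (α * β ^ q) * C.y
      + algebraMap K R γ ∈ A := Algebra.subset_adjoin (by simp)
    have my : algebraMap K R α * C.y + algebraMap K R β ∈ A := Algebra.subset_adjoin (by simp)
    have mz : algebraMap K R c * C.z ∈ A := Algebra.subset_adjoin (by simp)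
    have inv : ∀ (d : K) (u : R), d ≠ 0 → algebraMap K R d * u ∈ A → u ∈ A := by
      intro d u hd hu
      have := A.mul_mem (k d⁻¹) hu
      rwa [← mul_assoc, ← map_mul, inv_mul_cancel₀ hd, map_one, one_mul] at this
    have hzA : C.z ∈ A := inv c _ hc mz
    have hyA : C.y ∈ A := inv α _ hα0 (by simpa using A.sub_mem my (k β))
    have hxA : C.x ∈ A := inv (α ^ (q + 1)) _ (pow_ne_zero _ hα0) (by
      have := A.sub_mem (A.sub_mem mx (k γ)) (A.mul_mem (k (α * β ^ q)) hyA)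
      simpa using this)
    rw [eq_top_iff, ← C.gen, Algebra.adjoin_le_iff]
    rintro u (rfl | rfl | rfl) <;> assumption

theorem ext_aut (C : Crv p q t K R) {a b : F ≃ₐ[K] F}
    (hx : a (algebraMap R F C.x) = b (algebraMap R F C.x))
    (hy : a (algebraMap R F C.y) = b (algebraMap R F C.y))
    (hz : a (algebraMap R F C.z) = b (algebraMap R F C.z)) : a = b := by
  have h : ((a : F →ₐ[K] F).comp (IsScalarTower.toAlgHom K R F)) =
      ((b : F →ₐ[K] F).comp (IsScalarTower.toAlgHom K R F)) := C.ext_hom _ _ hx hy hz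
  have h' : ∀ r : R, a (algebraMap R F r) = b (algebraMap R F r) := fun r => DFunLike.congr_fun h r
  ext u
  obtain ⟨r, s, hs, rfl⟩ := IsFractionRing.div_surjective (A := R) u
  rw [map_div₀, map_div₀, h', h']

theorem isA_inj (C : Crv p q t K R) {a b : F ≃ₐ[K] F} {c β γ : K} (ha : C.isA a c β γ)
    (hb : C.isA b c β γ) : a = b :=
  C.ext_aut (ha.2.2.trans hb.2.2.symm) (ha.2.1.trans hb.2.1.symm) (ha.1.trans hb.1.symm)

theorem isA_uniq (C : Crv p q t K R) {a : F ≃ₐ[K] F} {c β γ c' β' γ' : K} (ha : C.isA a c β γ)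
    (hb : C.isA a c' β' γ') : c = c' ∧ β = β' ∧ γ = γ' := by
  have hR : Function.Injective (algebraMap K R) := (algebraMap K R).injective
  have hc : c = c' := by
    have := mul_right_cancel₀ C.z_ne (ιinj (ha.1.symm.trans hb.1))
    exact hR this
  subst hc
  have hβ : β = β' := by
    have := add_left_cancel (ιinj (ha.2.1.symm.trans hb.2.1))
    exact hR this
  subst hβ
  have := add_left_cancel (ιinj (ha.2.2.symm.trans hb.2.2))
  exact ⟨rfl, rfl, hR this⟩

end Crv


set_option linter.unusedVariables false
set_option linter.unusedSectionVars false

namespace Crv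

variable {p q t : ℕ} {K R F : Type} [Field K] [IsAlgClosed K] [CharP K p] [CommRing R]
  [Algebra K R] [IsDomain R] [Field F] [Algebra K F] [Algebra R F] [IsScalarTower K R F]
  [IsFractionRing R F]

theorem card_roots_sep (f : Polynomial K) (hf : f.Separable) :
    Nat.card {r : K // f.IsRoot r} = f.natDegree := by
  classical
  have h0 : f ≠ 0 := hf.ne_zero
  have h1 := Polynomial.nodup_roots hf
  have h2 : f.roots.card = f.natDegree :=
    (Polynomial.splits_iff_card_roots.mp (IsAlgClosed.splits f))
  rw [← h2, ← Multiset.toFinset_card_of_nodup h1]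
  rw [Nat.subtype_card]
  intro r
  simp [h0]

theorem card_B (C : Crv p q t K R) : Nat.card {r : K // r ^ (q ^ 2) = r} = q ^ 2 := by
  have h2 := C.q2
  have h4 : 1 < q ^ 2 := by nlinarith
  have hd : (Polynomial.X ^ (q ^ 2) - Polynomial.X : Polynomial K).natDegree = q ^ 2 := by
    rw [Polynomial.natDegree_sub_eq_left_of_natDegree_lt] <;> simp [h4]
  have hs : (Polynomial.X ^ (q ^ 2) - Polynomial.X : Polynomial K).Separable := by
    rw [Polynomial.separable_def]
    have hq := C.qK (K := K)
    refine ⟨0, -1, ?_⟩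
    simp [hq, Polynomial.derivative_X_pow]
  have := card_roots_sep _ hs
  rw [hd] at this
  refine Eq.trans ?_ this
  refine Nat.card_congr (Equiv.subtypeEquivRight fun r => ?_)
  simp [sub_eq_zero]

theorem card_G (C : Crv p q t K R) (b : K) : Nat.card {r : K // r ^ q + r = b} = q := by
  have h2 := C.q2
  have hd : (Polynomial.X ^ q + Polynomial.X - Polynomial.C b : Polynomial K).natDegree = q := by
    rw [Polynomial.natDegree_sub_C, Polynomial.natDegree_add_eq_left_of_natDegree_lt] <;> simp
    omega
  have hs : (Polynomial.X ^ q + Polynomial.X - Polynomial.C b : Polynomial K).Separable := by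
    rw [Polynomial.separable_def]
    have hq := C.qK (K := K)
    refine ⟨0, 1, ?_⟩
    simp [hq, Polynomial.derivative_X_pow]
  have := card_roots_sep _ hs
  rw [hd] at this
  refine Eq.trans ?_ this
  refine Nat.card_congr (Equiv.subtypeEquivRight fun r => ?_)
  simp [sub_eq_zero]

theorem card_E (C : Crv p q t K R) : Nat.card {r : K // r ^ (t * (q ^ 2 - 1)) = 1} =
    t * (q ^ 2 - 1) := by
  have h2 := C.q2
  have h4 : 1 < q ^ 2 := by nlinarith
  have hE : ((t * (q ^ 2 - 1) : ℕ) : K) ≠ 0 := by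
    rw [Nat.cast_mul, Nat.cast_sub h4.le, Nat.cast_pow, C.qK]
    simp [C.tK]
  have hs := (Polynomial.separable_X_pow_sub_C (F := K) 1 hE one_ne_zero)
  have := card_roots_sep _ hs
  rw [Polynomial.natDegree_X_pow_sub_C] at this
  conv_rhs => rw [← this]
  refine Nat.card_congr (Equiv.subtypeEquivRight fun r => ?_)
  simp [sub_eq_zero]

theorem card_pairs (C : Crv p q t K R) :
    Nat.card {bg : K × K // C.trip 1 bg.1 bg.2} = q ^ 3 := by
  have e : {bg : K × K // C.trip 1 bg.1 bg.2} ≃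
      (Σ b : {r : K // r ^ (q ^ 2) = r}, {r : K // r ^ q + r = b.1 ^ (q + 1)}) :=
    { toFun := fun w => ⟨⟨w.1.1, w.2.2.1⟩, ⟨w.1.2, w.2.2.2⟩⟩
      invFun := fun w => ⟨(w.1.1, w.2.1), ⟨one_pow _, w.1.2, w.2.2⟩⟩
      left_inv := fun w => rfl
      right_inv := fun w => rfl }
  have hq := C.q2
  have : Finite {r : K // r ^ (q ^ 2) = r} := Nat.finite_of_card_ne_zero (by
    rw [C.card_B]; positivity)
  have : ∀ b : {r : K // r ^ (q ^ 2) = r}, Finite {r : K // r ^ q + r = b.1 ^ (q + 1)} :=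
    fun b => Nat.finite_of_card_ne_zero (by rw [C.card_G]; omega)
  have := Fintype.ofFinite {r : K // r ^ (q ^ 2) = r}
  rw [Nat.card_congr e, Nat.card_sigma]
  simp only [C.card_G]
  rw [Finset.sum_const, Finset.card_univ, ← Nat.card_eq_fintype_card, C.card_B]
  simp; ring

variable (F) in
/-- the group fixing z -/
def S (C : Crv p q t K R) : Subgroup (F ≃ₐ[K] F) where
  carrier := {a | a (algebraMap R F C.z) = algebraMap R F C.z}
  mul_mem' := by
    intro a b ha hb
    simp only [Set.mem_setOf_eq] at *
    rw [AlgEquiv.mul_apply, hb, ha]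
  one_mem' := rfl
  inv_mem' := by
    intro a ha
    simp only [Set.mem_setOf_eq] at *
    change a.symm _ = _
    rw [AlgEquiv.symm_apply_eq, ha]

theorem isInt_of_root (u : F) (f : Polynomial K) (hf : f ≠ 0) (h : Polynomial.aeval u f = 0) :
    ∃ c : K, algebraMap K F c = u :=
  mem_const_of_isAlgebraic u (IsAlgebraic.isIntegral ⟨f, hf, h⟩)

theorem const_of_B (C : Crv p q t K R) (u : F) (h : u ^ (q ^ 2) = u) :
    ∃ c : K, algebraMap K F c = u := by
  have h2 := C.q2
  have h4 : 1 < q ^ 2 := by nlinarith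
  refine isInt_of_root u (Polynomial.X ^ (q ^ 2) - Polynomial.X) ?_ (by simp [h])
  exact FiniteField.X_pow_card_sub_X_ne_zero K h4

theorem const_of_G (C : Crv p q t K R) (u : F) (b : K) (h : u ^ q + u = algebraMap K F b) :
    ∃ c : K, algebraMap K F c = u := by
  have h2 := C.q2
  have hd : (Polynomial.X ^ q + Polynomial.X - Polynomial.C b : Polynomial K).natDegree = q := by
    rw [Polynomial.natDegree_sub_C, Polynomial.natDegree_add_eq_left_of_natDegree_lt] <;> simp
    omega
  refine isInt_of_root u (Polynomial.X ^ q + Polynomial.X - Polynomial.C b) ?_ (by simp [h])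
  intro h0
  rw [h0] at hd; simp at hd; omega

theorem hzF (C : Crv p q t K R) : algebraMap R F C.z ^ t =
    algebraMap R F C.y ^ (q ^ 2) - algebraMap R F C.y := by
  rw [← map_pow, C.hz, map_sub, map_pow]

theorem hxF (C : Crv p q t K R) : algebraMap R F C.y ^ (q + 1) =
    algebraMap R F C.x ^ q + algebraMap R F C.x := by
  rw [← map_pow, C.hx, map_add, map_pow]

theorem isA_of_S (C : Crv p q t K R) {a : F ≃ₐ[K] F} (ha : a ∈ C.S F) :
    ∃ β γ, C.trip 1 β γ ∧ C.isA a 1 β γ := by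
  have ha : a (algebraMap R F C.z) = algebraMap R F C.z := ha
  set y := algebraMap R F C.y with hy
  set x := algebraMap R F C.x with hx
  set z := algebraMap R F C.z with hz
  have e1 := congrArg a C.hzF
  have e2 := congrArg a C.hxF
  have e10 := C.hzF (F := F)
  have e20 := C.hxF (F := F)
  rw [← hx, ← hy] at e20 e2
  rw [← hz, ← hy] at e10 e1
  simp only [map_sub, map_add, map_pow] at e1 e2
  rw [ha] at e1
  obtain ⟨β, hβ⟩ := C.const_of_B (a y - y) (by
    rw [C.frob_sub_pow]; linear_combination e10 - e1)
  have hβ' : β ^ (q ^ 2) = β := by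
    apply (algebraMap K F).injective
    rw [map_pow, hβ, C.frob_sub_pow]; linear_combination e10 - e1
  have hay : a y = y + algebraMap K F β := by rw [hβ]; ring
  have e3 : (a x - x - algebraMap K F (β ^ q) * y) ^ q + (a x - x - algebraMap K F (β ^ q) * y) =
      algebraMap K F (β ^ (q + 1)) := by
    rw [C.frob_sub, C.frob_sub, mul_pow, ← map_pow (algebraMap K F), ← pow_mul, ← sq, hβ']
    rw [hay, pow_succ, C.frob] at e2
    rw [map_pow, map_pow, pow_succ]
    linear_combination -e2 + e20
  obtain ⟨γ, hγ⟩ := C.const_of_G _ _ e3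
  refine ⟨β, γ, ⟨one_pow _, hβ', ?_⟩, ?_, ?_, ?_⟩
  · apply (algebraMap K F).injective
    rw [← e3, ← hγ]; simp
  · rw [← hz, ha]; simp [hz]
  · rw [← hy, hay]; simp [hy, ιK]
  · rw [← hx]
    have : a x = x + algebraMap K F (β ^ q) * y + algebraMap K F γ := by rw [hγ]; ring
    rw [this, map_add, map_add, map_mul, map_mul, ιK, ιK, ιK]
    simp [hx, hy]

theorem S_of_isA (C : Crv p q t K R) {a : F ≃ₐ[K] F} {β γ : K} (h : C.isA a 1 β γ) : a ∈ C.S F := by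
  have := h.1
  show a _ = _
  simpa using this

theorem card_S (C : Crv p q t K R) : Nat.card (C.S F) = q ^ 3 := by
  rw [← C.card_pairs]
  symm
  choose f hf using fun w : {bg : K × K // C.trip 1 bg.1 bg.2} => C.exists_aut (F := F) w.2
  refine Nat.card_congr (Equiv.ofBijective (fun w => (⟨f w, C.S_of_isA (hf w)⟩ : C.S F)) ⟨?_, ?_⟩)
  · intro w w' h
    have h' : f w = f w' := congrArg Subtype.val h
    have h1 := hf w
    rw [h'] at h1
    obtain ⟨-, h2, h3⟩ := C.isA_uniq h1 (hf w')
    exact Subtype.ext (Prod.ext h2 h3)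
  · rintro ⟨a, ha⟩
    obtain ⟨β, γ, h1, h2⟩ := C.isA_of_S ha
    exact ⟨⟨(β, γ), h1⟩, Subtype.ext (C.isA_inj (hf _) h2)⟩

theorem finite_S (C : Crv p q t K R) : Finite (C.S F) :=
  Nat.finite_of_card_ne_zero (by rw [C.card_S]; have := C.q2; positivity)

theorem isA_R (C : Crv p q t K R) {a : F ≃ₐ[K] F} {c β γ : K} (h : C.isA a c β γ) (r : R) :
    ∃ r', a (algebraMap R F r) = algebraMap R F r' := by
  have hr : r ∈ Algebra.adjoin K {C.x, C.y, C.z} := by rw [C.gen]; trivial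
  induction hr using Algebra.adjoin_induction with
  | mem u hu =>
    rcases hu with rfl | rfl | rfl
    exacts [⟨_, h.2.2⟩, ⟨_, h.2.1⟩, ⟨_, h.1⟩]
  | algebraMap c => exact ⟨algebraMap K R c, by rw [ιK, AlgEquiv.commutes]⟩
  | add u v _ _ hu hv =>
    obtain ⟨u', hu⟩ := hu
    obtain ⟨v', hv⟩ := hv
    exact ⟨u' + v', by rw [map_add, map_add, map_add, hu, hv]⟩
  | mul u v _ _ hu hv =>
    obtain ⟨u', hu⟩ := hu
    obtain ⟨v', hv⟩ := hv
    exact ⟨u' * v', by rw [map_mul, map_mul, map_mul, hu, hv]⟩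

theorem S_R (C : Crv p q t K R) {a : F ≃ₐ[K] F} (h : a ∈ C.S F) (r : R) :
    ∃ r', a (algebraMap R F r) = algebraMap R F r' := by
  obtain ⟨β, γ, -, h2⟩ := C.isA_of_S h
  exact C.isA_R h2 r

theorem S_vinf (C : Crv p q t K R) {a : F ≃ₐ[K] F} (h : a ∈ C.S F) (u : F) :
    (C.vinf F).v (a u) = (C.vinf F).v u := by
  have h' : a (algebraMap R F C.z) = algebraMap R F C.z := h
  have := C.uniq_inf (a⁻¹ • C.vinf F) (by rw [Plc.inv_smul_v, h']; exact C.vinf_z_neg)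
  rw [← Plc.inv_smul_v, this]

end Crv


set_option linter.unusedVariables false
set_option linter.unusedSectionVars false

namespace Crv

variable {p q t : ℕ} {K R F : Type} [Field K] [IsAlgClosed K] [CharP K p] [CommRing R]
  [Algebra K R] [IsDomain R] [Field F] [Algebra K F] [Algebra R F] [IsScalarTower K R F]
  [IsFractionRing R F]

theorem decomp (C : Crv p q t K R) (h : R) : ∃ c : ℕ → ℕ → Polynomial K,
    h = ∑ j ∈ Finset.range q, (∑ i ∈ Finset.range (q ^ 2),
      Polynomial.aeval C.z (c i j) * C.y ^ i) * C.x ^ j := by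
  have hh : h ∈ Submodule.span K (C.mon '' red q) := by rw [C.span_top]; trivial
  induction hh using Submodule.span_induction with
  | mem u hu =>
    obtain ⟨⟨k, i, j⟩, ⟨hi, hj⟩, rfl⟩ := hu
    simp only at hi hj
    refine ⟨fun i' j' => if i' = i ∧ j' = j then Polynomial.X ^ k else 0, ?_⟩
    rw [Finset.sum_eq_single j, Finset.sum_eq_single i]
    · simp [mon]
    · intro i' _ hne; simp [hne]
    · intro hn; simp at hn; omega
    · intro j' _ hne; simp [hne]
    · intro hn; simp at hn; omega
  | zero => exact ⟨fun _ _ => 0, by simp⟩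
  | add u v _ _ hu hv =>
    obtain ⟨c, hc⟩ := hu
    obtain ⟨d, hd⟩ := hv
    refine ⟨fun i j => c i j + d i j, ?_⟩
    conv_lhs => rw [hc, hd]
    simp only [map_add, add_mul, Finset.sum_add_distrib]
  | smul r u _ hu =>
    obtain ⟨c, hc⟩ := hu
    refine ⟨fun i j => r • c i j, ?_⟩
    conv_lhs => rw [hc]
    simp only [map_smul, smul_mul_assoc, ← Finset.smul_sum]

theorem S_poly (C : Crv p q t K R) {a : F ≃ₐ[K] F} (ha : a ∈ C.S F) (f : Polynomial K) :
    a (algebraMap R F (Polynomial.aeval C.z f)) = algebraMap R F (Polynomial.aeval C.z f) := by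
  have ha' : a (algebraMap R F C.z) = algebraMap R F C.z := ha
  rw [← Polynomial.aeval_algebraMap_apply, ← Polynomial.aeval_algHom_apply, ha']

theorem poly_const {n : ℕ} (H : ℕ → F) (w x0 : F) (T : Set K) (hT : Nat.card T = n) (hn : 0 < n)
    (h : ∀ r ∈ T, ∑ j ∈ Finset.range n, H j * (x0 + algebraMap K F r) ^ j = w) : H 0 = w := by
  classical
  have : Finite T := Nat.finite_of_card_ne_zero (by omega)
  have := Fintype.ofFinite T
  have hinj : Function.Injective (fun r : K => x0 + algebraMap K F r) := by
    intro r s hrs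
    exact (algebraMap K F).injective (add_left_cancel hrs)
  set s : Finset F := T.toFinset.image (fun r : K => x0 + algebraMap K F r) with hs
  have hcard : s.card = n := by
    rw [hs, Finset.card_image_of_injective _ hinj, Set.toFinset_card, ← Nat.card_eq_fintype_card, hT]
  have key : (∑ j ∈ Finset.range n, Polynomial.C (H j) * Polynomial.X ^ j : Polynomial F) =
      Polynomial.C w := by
    apply Polynomial.eq_of_degrees_lt_of_eval_finset_eq s
    · rw [hcard]
      rw [← Polynomial.mem_degreeLT]
      refine Submodule.sum_mem _ fun j hj => Polynomial.mem_degreeLT.mpr ?_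
      refine lt_of_le_of_lt (Polynomial.degree_C_mul_X_pow_le j _) ?_
      exact_mod_cast Finset.mem_range.mp hj
    · rw [hcard]
      refine lt_of_le_of_lt Polynomial.degree_C_le ?_
      exact_mod_cast hn
    · intro u hu
      obtain ⟨r, hr, rfl⟩ := Finset.mem_image.mp hu
      rw [Polynomial.eval_finset_sum]
      simp only [Polynomial.eval_mul, Polynomial.eval_C, Polynomial.eval_pow, Polynomial.eval_X]
      exact h r (by simpa using hr)
  have := congrArg (fun f => Polynomial.coeff f 0) key
  simp only [Polynomial.finset_sum_coeff, Polynomial.coeff_C_mul, Polynomial.coeff_X_pow,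
    Polynomial.coeff_C_zero] at this
  rw [← this, Finset.sum_eq_single 0]
  · simp
  · intro j _ hj; simp [Ne.symm hj]
  · intro h; simp at h; omega

theorem inv_poly (C : Crv p q t K R) (h : R)
    (hS : ∀ a ∈ C.S F, a (algebraMap R F h) = algebraMap R F h) :
    ∃ f : Polynomial K, h = Polynomial.aeval C.z f := by
  have hq2 := C.q2
  obtain ⟨c, hc⟩ := C.decomp h
  set H : ℕ → R := fun j => ∑ i ∈ Finset.range (q ^ 2), Polynomial.aeval C.z (c i j) * C.y ^ i with hH
  have aH : ∀ a ∈ C.S F, ∀ β : K, a (algebraMap R F C.y) = algebraMap R F C.y + algebraMap K F β →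
      ∀ j, a (algebraMap R F (H j)) = ∑ i ∈ Finset.range (q ^ 2),
        algebraMap R F (Polynomial.aeval C.z (c i j)) *
          (algebraMap R F C.y + algebraMap K F β) ^ i := by
    intro a ha β hy j
    rw [hH]
    simp only [map_sum, map_mul, map_pow, C.S_poly ha, hy]
  have step1 : algebraMap R F (H 0) = algebraMap R F h := by
    refine poly_const (n := q) (fun j => algebraMap R F (H j)) _ (algebraMap R F C.x)
      {r : K | r ^ q + r = 0} (C.card_G 0) (by omega) ?_
    intro γ hγ
    obtain ⟨a, ha⟩ := C.exists_aut (F := F) (c := 1) (β := 0) (γ := γ)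
      ⟨one_pow _, zero_pow (by positivity), by rw [zero_pow (by omega)]; exact hγ⟩
    have haS := C.S_of_isA ha
    have hy : a (algebraMap R F C.y) = algebraMap R F C.y + algebraMap K F 0 := by
      rw [ha.2.1]; simp
    have hx : a (algebraMap R F C.x) = algebraMap R F C.x + algebraMap K F γ := by
      rw [ha.2.2, zero_pow (by omega)]; simp [ιK]
    have hHa : ∀ j, a (algebraMap R F (H j)) = algebraMap R F (H j) := by
      intro j; rw [aH a haS 0 hy j, hH]; simp
    have := hS a haS
    conv_lhs at this => rw [hc]
    rw [← this]
    simp only [map_sum, map_mul, map_pow, hx]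
    refine Finset.sum_congr rfl fun j _ => ?_
    have e := hHa j
    simp only [hH, map_sum, map_mul, map_pow] at e ⊢
    rw [e]
  have step2 : algebraMap R F (Polynomial.aeval C.z (c 0 0)) = algebraMap R F h := by
    refine poly_const (n := q ^ 2) (fun i => algebraMap R F (Polynomial.aeval C.z (c i 0))) _
      (algebraMap R F C.y) {r : K | r ^ (q ^ 2) = r} C.card_B (by positivity) ?_
    intro β hβ
    obtain ⟨γ, hγ⟩ := C.exists_x β
    obtain ⟨a, ha⟩ := C.exists_aut (F := F) (c := 1) (β := β) (γ := γ)
      ⟨one_pow _, hβ, hγ.symm⟩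
    have haS := C.S_of_isA ha
    have hy : a (algebraMap R F C.y) = algebraMap R F C.y + algebraMap K F β := by
      rw [ha.2.1]; simp [ιK]
    rw [← aH a haS β hy 0, step1, hS a haS]
  exact ⟨c 0 0, (ιinj step2).symm⟩

theorem v_poly (C : Crv p q t K R) (P : Plc K F) (f : Polynomial K) (hf : f ≠ 0) :
    P.v (algebraMap R F (Polynomial.aeval C.z f)) =
      (f.roots.map fun r => P.v (algebraMap R F C.z - algebraMap K F r)).sum := by
  have hne : ∀ r : K, algebraMap R F C.z - algebraMap K F r ≠ 0 := by
    intro r h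
    rw [← ιK (R := R), ← map_sub] at h
    have := C.transc (Polynomial.X - Polynomial.C r) (by simpa using ιinj (F := F) (by rw [h, map_zero]))
    exact Polynomial.X_sub_C_ne_zero r this
  have hm : ∀ s : Multiset K, P.v ((s.map fun r => algebraMap R F C.z - algebraMap K F r).prod) =
      (s.map fun r => P.v (algebraMap R F C.z - algebraMap K F r)).sum := by
    intro s
    induction s using Multiset.induction_on with
    | empty => simp [P.v_one]
    | cons r s ih =>
      rw [Multiset.map_cons, Multiset.prod_cons, P.v_mul _ _ (hne r), ih, Multiset.map_cons,
        Multiset.sum_cons]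
      rw [Ne, Multiset.prod_eq_zero_iff]
      intro h0
      obtain ⟨r, -, h⟩ := Multiset.mem_map.mp h0
      exact hne r h
  have e := (IsAlgClosed.splits f).eq_prod_roots
  have : algebraMap R F (Polynomial.aeval C.z f) = algebraMap K F f.leadingCoeff *
      (f.roots.map fun r => algebraMap R F C.z - algebraMap K F r).prod := by
    conv_lhs => rw [e]
    rw [map_mul, Polynomial.aeval_C, map_mul, ιK, map_multiset_prod, map_multiset_prod,
      Multiset.map_map, Multiset.map_map]
    congr 3
    funext r
    simp [ιK]
  rw [this, P.v_const_mul _ (by simpa using hf), hm]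

theorem z_sub_ne (C : Crv p q t K R) (r : K) : algebraMap R F C.z - algebraMap K F r ≠ 0 := by
  intro h
  rw [← ιK (R := R), ← map_sub] at h
  have := C.transc (Polynomial.X - Polynomial.C r) (by simpa using ιinj (F := F) (by rw [h, map_zero]))
  exact Polynomial.X_sub_C_ne_zero r this

theorem vinf_zr (C : Crv p q t K R) (r : K) :
    (C.vinf F).v (algebraMap R F C.z - algebraMap K F r) = -(q : ℤ) ^ 3 := by
  rw [sub_eq_add_neg, (Plc.add_of_lt (ι_ne C.z_ne) _).2, C.vinf_z]
  right
  rw [Plc.v_neg, Plc.v_const, C.vinf_z]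
  have := C.q3pos
  omega

theorem vinf_poly (C : Crv p q t K R) (f : Polynomial K) (hf : f ≠ 0) :
    (C.vinf F).v (algebraMap R F (Polynomial.aeval C.z f)) = -(q : ℤ) ^ 3 * f.natDegree := by
  rw [C.v_poly _ f hf]
  simp only [C.vinf_zr]
  rw [Multiset.map_const', Multiset.sum_replicate,
    Polynomial.splits_iff_card_roots.mp (IsAlgClosed.splits f)]
  simp; ring

theorem norm_poly (C : Crv p q t K R) [Fintype (C.S F)] (h : R) (hh : h ≠ 0) :
    ∃ f : Polynomial K, f ≠ 0 ∧ algebraMap R F (Polynomial.aeval C.z f) =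
      ∏ a : C.S F, a.1 (algebraMap R F h) ∧
      (f.natDegree : ℤ) = - (C.vinf F).v (algebraMap R F h) := by
  choose g hg using fun a : C.S F => C.S_R a.2 h
  have hprod : ∏ a : C.S F, a.1 (algebraMap R F h) = algebraMap R F (∏ a : C.S F, g a) := by
    rw [map_prod]; exact Finset.prod_congr rfl fun a _ => hg a
  obtain ⟨f, hf⟩ := C.inv_poly (F := F) (∏ a : C.S F, g a) (by
    intro b hb
    rw [← hprod, map_prod]
    exact Fintype.prod_equiv (Equiv.mulLeft (⟨b, hb⟩ : C.S F)) _ _ (fun a => rfl))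
  have hne : ∀ a : C.S F, a.1 (algebraMap R F h) ≠ 0 := fun a => by simpa using hh
  have hf0 : f ≠ 0 := by
    rintro rfl
    rw [hf, map_zero, map_zero] at hprod
    exact Finset.prod_ne_zero_iff.mpr (fun a _ => hne a) hprod
  have hpr : algebraMap R F (Polynomial.aeval C.z f) = ∏ a : C.S F, a.1 (algebraMap R F h) := by
    rw [hprod, hf]
  refine ⟨f, hf0, hpr, ?_⟩
  have := congrArg (C.vinf F).v hpr
  rw [C.vinf_poly f hf0, Plc.v_prod _ _ _ (fun a _ => hne a)] at this
  rw [Finset.sum_congr rfl (fun a _ => C.S_vinf a.2 _)] at this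
  rw [Finset.sum_const, Finset.card_univ, ← Nat.card_eq_fintype_card, C.card_S] at this
  have h3 := C.q3pos
  simp only [nsmul_eq_mul, Nat.cast_pow] at this
  exact mul_left_cancel₀ h3.ne' (by linarith)

end Crv


set_option linter.unusedVariables false
set_option linter.unusedSectionVars false

namespace Crv

variable {p q t : ℕ} {K R F : Type} [Field K] [IsAlgClosed K] [CharP K p] [CommRing R]
  [Algebra K R] [IsDomain R] [Field F] [Algebra K F] [Algebra R F] [IsScalarTower K R F]
  [IsFractionRing R F]

theorem hens {A : Type} [CommRing A] (f : Polynomial (PowerSeries A)) (hf : f.Monic) (a₀ : A)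
    (h : PowerSeries.constantCoeff (f.eval (PowerSeries.C a₀)) = 0)
    (h' : IsUnit (f.derivative.eval (PowerSeries.C a₀))) :
    ∃ a, f.eval a = 0 ∧ PowerSeries.constantCoeff a = a₀ := by
  have hh : HenselianRing (PowerSeries A) (Ideal.span {PowerSeries.X}) := inferInstance
  obtain ⟨a, h1, h2⟩ := hh.is_henselian f hf (PowerSeries.C a₀)
    (by rw [Ideal.mem_span_singleton, PowerSeries.X_dvd_iff]; exact h) (h'.map _)
  refine ⟨a, h1, ?_⟩
  rw [Ideal.mem_span_singleton, PowerSeries.X_dvd_iff] at h2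
  simpa [sub_eq_zero] using h2

theorem exists_tau (C : Crv p q t K R) : ∃ τ : R →ₐ[K] PowerSeries R,
    τ C.z = PowerSeries.C C.z + PowerSeries.X ∧ ∀ r, PowerSeries.constantCoeff (τ r) = r := by
  have h2 := C.q2
  have h4 : 1 < q ^ 2 := by nlinarith
  have hqP : (q : PowerSeries R) = 0 := by
    have : (algebraMap K (PowerSeries R)) (q : K) = 0 := by rw [C.qK, map_zero]
    simpa using this
  obtain ⟨Y, hY, hY0⟩ : ∃ Y : PowerSeries R, (PowerSeries.C C.z + PowerSeries.X) ^ t =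
      Y ^ (q ^ 2) - Y ∧ PowerSeries.constantCoeff Y = C.y := by
    obtain ⟨Y, hY, hY0⟩ := hens (Polynomial.X ^ (q ^ 2) - (Polynomial.X +
      Polynomial.C ((PowerSeries.C C.z + PowerSeries.X) ^ t))) (by
        apply Polynomial.monic_X_pow_sub
        refine (Polynomial.degree_X_add_C _).le.trans_lt ?_
        exact_mod_cast h4) C.y (by simp [C.hz]) (by
        rw [Polynomial.derivative_sub, Polynomial.derivative_add, Polynomial.derivative_C,
          Polynomial.derivative_X_pow]; simp [hqP])
    refine ⟨Y, ?_, hY0⟩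
    simp at hY
    linear_combination -hY
  obtain ⟨X, hX, hX0⟩ : ∃ X : PowerSeries R, Y ^ (q + 1) =
      X ^ q + X ∧ PowerSeries.constantCoeff X = C.x := by
    obtain ⟨X, hX, hX0⟩ := hens (Polynomial.X ^ q + (Polynomial.X +
      Polynomial.C (- Y ^ (q + 1)))) (by
        apply Polynomial.monic_X_pow_add
        refine (Polynomial.degree_X_add_C _).le.trans_lt ?_
        exact_mod_cast h2) C.x (by simp [hY0, C.hx]) (by
        rw [Polynomial.derivative_add, Polynomial.derivative_add, Polynomial.derivative_C,
          Polynomial.derivative_X_pow]; simp [hqP])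
    refine ⟨X, ?_, hX0⟩
    simp at hX
    linear_combination -hX
  obtain ⟨τ, h1, h2, h3⟩ := C.lift (PowerSeries R) X Y _ hY hX
  refine ⟨τ, h3, ?_⟩
  let ψ : PowerSeries R →ₐ[K] R :=
    { (PowerSeries.constantCoeff (R := R)) with
      commutes' := fun r => by
        simp [PowerSeries.algebraMap_apply] }
  have : ψ.comp τ = AlgHom.id K R := by
    apply C.ext_hom
    · simp [ψ, h1, hX0]
    · simp [ψ, h2, hY0]
    · simp [ψ, h3]
  intro r
  exact DFunLike.congr_fun this r

/-- the Taylor map -/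
noncomputable def tau (C : Crv p q t K R) : R →ₐ[K] PowerSeries R := C.exists_tau.choose

theorem tau_z (C : Crv p q t K R) : C.tau C.z = PowerSeries.C C.z + PowerSeries.X :=
  C.exists_tau.choose_spec.1

theorem tau0 (C : Crv p q t K R) (r : R) : PowerSeries.constantCoeff (C.tau r) = r :=
  C.exists_tau.choose_spec.2 r

/-- Taylor expansion at a point -/
noncomputable def tauA (C : Crv p q t K R) (φ : R →ₐ[K] K) : R →ₐ[K] PowerSeries K :=
  (PowerSeries.mapAlgHom φ).comp C.tau

theorem tauA_apply (C : Crv p q t K R) (φ : R →ₐ[K] K) (r : R) :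
    C.tauA φ r = PowerSeries.map (φ : R →+* K) (C.tau r) := rfl

theorem tauA_z (C : Crv p q t K R) (φ : R →ₐ[K] K) :
    C.tauA φ C.z = PowerSeries.C (φ C.z) + PowerSeries.X := by
  rw [tauA_apply, tau_z]; simp

theorem tauA_coeff (C : Crv p q t K R) (φ : R →ₐ[K] K) (r : R) (n : ℕ) :
    PowerSeries.coeff n (C.tauA φ r) = φ (PowerSeries.coeff n (C.tau r)) := by
  rw [tauA_apply]; simp

theorem tauA0 (C : Crv p q t K R) (φ : R →ₐ[K] K) (r : R) :
    PowerSeries.constantCoeff (C.tauA φ r) = φ r := by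
  rw [← PowerSeries.coeff_zero_eq_constantCoeff_apply, tauA_coeff,
    PowerSeries.coeff_zero_eq_constantCoeff_apply, tau0]

end Crv


set_option linter.unusedVariables false
set_option linter.unusedSectionVars false

namespace Crv

variable {p q t : ℕ} {K R F : Type} [Field K] [IsAlgClosed K] [CharP K p] [CommRing R]
  [Algebra K R] [IsDomain R] [Field F] [Algebra K F] [Algebra R F] [IsScalarTower K R F]
  [IsFractionRing R F]

theorem exists_norm (C : Crv p q t K R) (F : Type) [Field F] [Algebra K F] [Algebra R F]
    [IsScalarTower K R F] [IsFractionRing R F] (h : R) (hh : h ≠ 0) :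
    ∃ f : Polynomial K, f ≠ 0 ∧ ∃ h', Polynomial.aeval C.z f = h * h' := by
  classical
  have := C.finite_S (F := F)
  have := Fintype.ofFinite (C.S F)
  obtain ⟨f, hf, h1, -⟩ := C.norm_poly (F := F) h hh
  choose g hg using fun a : C.S F => C.S_R a.2 h
  refine ⟨f, hf, ∏ a ∈ Finset.univ.erase (1 : C.S F), g a, ?_⟩
  apply ιinj (F := F)
  rw [h1, ← Finset.mul_prod_erase _ _ (Finset.mem_univ (1 : C.S F)), map_mul, map_prod]
  simp [hg]

theorem tauA_inj (C : Crv p q t K R) (F : Type) [Field F] [Algebra K F] [Algebra R F]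
    [IsScalarTower K R F] [IsFractionRing R F] (φ : R →ₐ[K] K) : Function.Injective (C.tauA φ) := by
  rw [injective_iff_map_eq_zero]
  intro h h0
  by_contra hh
  obtain ⟨f, hf, h', e⟩ := C.exists_norm F h hh
  have e2 : C.tauA φ (Polynomial.aeval C.z f) = 0 := by rw [e, map_mul, h0, zero_mul]
  rw [← Polynomial.aeval_algHom_apply, tauA_z] at e2
  have e3 : Polynomial.coeToPowerSeries.algHom K (f.comp (Polynomial.X + Polynomial.C (φ C.z))) = 0 := by
    rw [← e2, Polynomial.comp_eq_aeval, ← Polynomial.aeval_algHom_apply]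
    congr 1
    simp [Polynomial.coeToPowerSeries.algHom_apply, add_comm]
  have e4 : f.comp (Polynomial.X + Polynomial.C (φ C.z)) = 0 := by
    simpa [Polynomial.coeToPowerSeries.algHom_apply] using e3
  rw [Polynomial.comp_eq_zero_iff] at e4
  rcases e4 with h | ⟨-, h⟩
  · exact hf h
  · have := congrArg (fun g => Polynomial.coeff g 1) h
    simp at this

theorem lauR_inj (C : Crv p q t K R) (F : Type) [Field F] [Algebra K F] [Algebra R F]
    [IsScalarTower K R F] [IsFractionRing R F] (φ : R →ₐ[K] K) :
    Function.Injective ((HahnSeries.ofPowerSeries ℤ K).comp (C.tauA φ : R →+* PowerSeries K)) :=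
  HahnSeries.ofPowerSeries_injective.comp (C.tauA_inj F φ)

variable (F) in
/-- Laurent expansion -/
noncomputable def lau (C : Crv p q t K R) (φ : R →ₐ[K] K) : F →+* LaurentSeries K :=
  IsFractionRing.lift (C.lauR_inj F φ)

theorem lau_ι (C : Crv p q t K R) (φ : R →ₐ[K] K) (r : R) :
    C.lau F φ (algebraMap R F r) = HahnSeries.ofPowerSeries ℤ K (C.tauA φ r) :=
  IsFractionRing.lift_algebraMap _ _

theorem lau_K (C : Crv p q t K R) (φ : R →ₐ[K] K) (c : K) :
    C.lau F φ (algebraMap K F c) = HahnSeries.C c := by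
  rw [← ιK (R := R), lau_ι, AlgHom.commutes]
  exact HahnSeries.ofPowerSeries_C c

theorem lau_zr (C : Crv p q t K R) (φ : R →ₐ[K] K) :
    C.lau F φ (algebraMap R F C.z - algebraMap K F (φ C.z)) = HahnSeries.single 1 1 := by
  rw [map_sub, lau_ι, lau_K, tauA_z, map_add, HahnSeries.ofPowerSeries_C, HahnSeries.ofPowerSeries_X]
  ring

variable (F) in
/-- the place at an affine point -/
noncomputable def pl (C : Crv p q t K R) (φ : R →ₐ[K] K) : Plc K F where
  v u := (C.lau F φ u).order
  v_zero := by simp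
  v_mul a b ha hb := by
    rw [map_mul, HahnSeries.order_mul] <;> simpa
  v_add a b ha hb hab := by
    rw [map_add]; apply HahnSeries.min_order_le_order_add
    rw [← map_add]; simpa only [ne_eq, map_eq_zero] using hab
  v_const c := by rw [lau_K]; exact HahnSeries.order_C
  v_surj := ⟨_, C.z_sub_ne (φ C.z), by rw [lau_zr]; simp⟩

theorem pl_v (C : Crv p q t K R) (φ : R →ₐ[K] K) (u : F) :
    (C.pl F φ).v u = (C.lau F φ u).order := rfl

theorem pl_zr (C : Crv p q t K R) (φ : R →ₐ[K] K) :
    (C.pl F φ).v (algebraMap R F C.z - algebraMap K F (φ C.z)) = 1 := by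
  rw [pl_v, lau_zr]; simp

theorem lau_coeff (C : Crv p q t K R) (φ : R →ₐ[K] K) (r : R) (n : ℕ) :
    (C.lau F φ (algebraMap R F r)).coeff n = φ (PowerSeries.coeff n (C.tau r)) := by
  rw [lau_ι, HahnSeries.ofPowerSeries_apply_coeff, tauA_coeff]

theorem pl_nonneg (C : Crv p q t K R) (φ : R →ₐ[K] K) (r : R) :
    0 ≤ (C.pl F φ).v (algebraMap R F r) := by
  by_cases hr : r = 0
  · simp [hr, Plc.v_zero]
  rw [pl_v]
  by_contra h
  push Not at h
  have h1 : C.lau F φ (algebraMap R F r) ≠ 0 := by simpa using hr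
  have h2 := HahnSeries.coeff_order_eq_zero.not.mpr h1
  apply h2
  rw [lau_ι, HahnSeries.ofPowerSeries_apply]
  apply HahnSeries.embDomain_notin_range
  rintro ⟨n, hn⟩
  rw [lau_ι] at h
  have : (n : ℤ) = _ := hn
  rw [HahnSeries.ofPowerSeries_apply, ← this] at h
  exact absurd h (by omega)

theorem pl_pos (C : Crv p q t K R) (φ : R →ₐ[K] K) (r : R) (hr : r ≠ 0) (h : φ r = 0) :
    0 < (C.pl F φ).v (algebraMap R F r) := by
  have h0 := C.pl_nonneg (F := F) φ r
  rcases h0.lt_or_eq with h1 | h1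
  · exact h1
  · have h2 : C.lau F φ (algebraMap R F r) ≠ 0 := by simpa using hr
    have h3 := HahnSeries.coeff_order_eq_zero.not.mpr h2
    rw [← pl_v, ← h1] at h3
    have := C.lau_coeff (F := F) φ r 0
    rw [PowerSeries.coeff_zero_eq_constantCoeff_apply, tau0, h] at this
    exact absurd this h3

theorem pl_zero (C : Crv p q t K R) (φ : R →ₐ[K] K) (r : R) (h : φ r ≠ 0) :
    (C.pl F φ).v (algebraMap R F r) = 0 := by
  apply le_antisymm _ (C.pl_nonneg φ r)
  rw [pl_v]
  apply HahnSeries.order_le_of_coeff_ne_zero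
  have := C.lau_coeff (F := F) φ r 0
  rw [PowerSeries.coeff_zero_eq_constantCoeff_apply, tau0] at this
  intro h'
  exact h (this.symm.trans h')

theorem pl_coeff (C : Crv p q t K R) (φ : R →ₐ[K] K) (r : R) (n : ℕ)
    (h : r = 0 ∨ (n : ℤ) < (C.pl F φ).v (algebraMap R F r)) :
    φ (PowerSeries.coeff n (C.tau r)) = 0 := by
  rcases h with h | h
  · simp [h]
  rw [← C.lau_coeff (F := F)]
  exact HahnSeries.coeff_eq_zero_of_lt_order h

theorem pl_of_coeff (C : Crv p q t K R) (φ : R →ₐ[K] K) (r : R) (n : ℕ) (hr : r ≠ 0)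
    (h : ∀ i < n, φ (PowerSeries.coeff i (C.tau r)) = 0) :
    (n : ℤ) ≤ (C.pl F φ).v (algebraMap R F r) := by
  have h0 := C.pl_nonneg (F := F) φ r
  by_contra hlt
  push Not at hlt
  have h2 : C.lau F φ (algebraMap R F r) ≠ 0 := by simpa using hr
  have h3 := HahnSeries.coeff_order_eq_zero.not.mpr h2
  rw [← pl_v] at h3
  obtain ⟨k, hk⟩ := Int.eq_ofNat_of_zero_le h0
  rw [hk, lau_coeff] at h3
  exact h3 (h k (by omega))

end Crv


set_option linter.unusedVariables false
set_option linter.unusedSectionVars false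

namespace Crv

variable {p q t : ℕ} {K R F : Type} [Field K] [IsAlgClosed K] [CharP K p] [CommRing R]
  [Algebra K R] [IsDomain R] [Field F] [Algebra K F] [Algebra R F] [IsScalarTower K R F]
  [IsFractionRing R F]

theorem loc (C : Crv p q t K R) (φ : R →ₐ[K] K) (h : R) : ∃ u h1 : R, φ u ≠ 0 ∧
    u * (h - algebraMap K R (φ h)) = (C.z - algebraMap K R (φ C.z)) * h1 := by
  have hq2 := C.q2
  have h4 : 1 < q ^ 2 := by nlinarith
  have hy : ∃ u h1 : R, φ u ≠ 0 ∧
      u * (C.y - algebraMap K R (φ C.y)) = (C.z - algebraMap K R (φ C.z)) * h1 := by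
    obtain ⟨g, hg⟩ := sub_dvd_pow_sub_pow C.z (algebraMap K R (φ C.z)) t
    refine ⟨(C.y - algebraMap K R (φ C.y)) ^ (q ^ 2 - 1) - 1, g, ?_, ?_⟩
    · simp [zero_pow (show q ^ 2 - 1 ≠ 0 by omega)]
    · rw [← hg, ← map_pow, ← map_pow, C.hz, sub_mul, ← pow_succ, Nat.sub_add_cancel h4.le,
        C.frob_sub_pow]
      simp; ring
  have hr : h ∈ Algebra.adjoin K {C.x, C.y, C.z} := by rw [C.gen]; trivial
  induction hr using Algebra.adjoin_induction with
  | mem w hw =>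
    rcases hw with rfl | rfl | rfl
    · obtain ⟨u, h1, hu, e⟩ := hy
      obtain ⟨g, hg⟩ := sub_dvd_pow_sub_pow C.y (algebraMap K R (φ C.y)) (q + 1)
      refine ⟨u * ((C.x - algebraMap K R (φ C.x)) ^ (q - 1) + 1), h1 * g, ?_, ?_⟩
      · simpa [zero_pow (show q - 1 ≠ 0 by omega)] using hu
      · have e1 : ((C.x - algebraMap K R (φ C.x)) ^ (q - 1) + 1) * (C.x - algebraMap K R (φ C.x)) =
          (C.y - algebraMap K R (φ C.y)) * g := by
          rw [← hg, ← map_pow, ← map_pow, C.hx, add_mul, ← pow_succ, Nat.sub_add_cancel (by omega),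
            C.frob_sub]
          simp; ring
        rw [mul_assoc, e1]
        linear_combination g * e
    · exact hy
    · exact ⟨1, 1, by simp, by ring⟩
  | algebraMap c => exact ⟨1, 0, by simp, by simp⟩
  | add a b _ _ ha hb =>
    obtain ⟨u, g, hu, e⟩ := ha
    obtain ⟨u', g', hu', e'⟩ := hb
    refine ⟨u * u', u' * g + u * g', by simpa using ⟨hu, hu'⟩, ?_⟩
    rw [map_add, map_add]
    linear_combination u' * e + u * e'
  | mul a b _ _ ha hb =>
    obtain ⟨u, g, hu, e⟩ := ha
    obtain ⟨u', g', hu', e'⟩ := hb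
    refine ⟨u * u', u' * algebraMap K R (φ b) * g + u * a * g', by simpa using ⟨hu, hu'⟩, ?_⟩
    rw [map_mul, map_mul]
    linear_combination u' * algebraMap K R (φ b) * e + u * a * e'

theorem zr_ne (C : Crv p q t K R) (r : K) : C.z - algebraMap K R r ≠ 0 := by
  intro h
  have := C.transc (Polynomial.X - Polynomial.C r) (by simpa using h)
  exact Polynomial.X_sub_C_ne_zero r this

theorem ne_of_φ (φ : R →ₐ[K] K) {u : R} (hu : φ u ≠ 0) : u ≠ 0 := by
  rintro rfl; simp at hu

theorem pl_zr' (C : Crv p q t K R) (φ : R →ₐ[K] K) :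
    (C.pl F φ).v (algebraMap R F (C.z - algebraMap K R (φ C.z))) = 1 := by
  rw [map_sub, ιK, pl_zr]

theorem locn (C : Crv p q t K R) (F : Type) [Field F] [Algebra K F] [Algebra R F]
    [IsScalarTower K R F] [IsFractionRing R F] (φ : R →ₐ[K] K) (h : R) (hh : h ≠ 0) :
    ∃ (n : ℕ) (u h1 : R), φ u ≠ 0 ∧ φ h1 ≠ 0 ∧
    u * h = (C.z - algebraMap K R (φ C.z)) ^ n * h1 := by
  obtain ⟨N, hN⟩ := Int.eq_ofNat_of_zero_le (C.pl_nonneg (F := F) φ h)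
  induction N using Nat.strong_induction_on generalizing h with
  | _ N ih =>
  by_cases h0 : φ h = 0
  · obtain ⟨u, h1, hu, e⟩ := C.loc φ h
    rw [h0, map_zero, sub_zero] at e
    have hu0 := ne_of_φ φ hu
    have hz0 := C.zr_ne (φ C.z)
    have h10 : h1 ≠ 0 := by
      rintro rfl
      rw [mul_zero] at e
      exact mul_ne_zero hu0 hh e
    have e2 := congrArg (fun w => (C.pl F φ).v (algebraMap R F w)) e
    simp only [map_mul] at e2
    rw [Plc.v_mul _ _ _ (ι_ne hu0) (ι_ne hh), Plc.v_mul _ _ _ (ι_ne hz0) (ι_ne h10),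
      C.pl_zero φ u hu, pl_zr', hN] at e2
    have h1n := C.pl_nonneg (F := F) φ h1
    obtain ⟨n, u', h2, hu', hh2, e3⟩ := ih (N - 1) (by omega) h1 h10 (by omega)
    refine ⟨n + 1, u' * u, h2, by simpa using ⟨hu', hu⟩, hh2, ?_⟩
    rw [pow_succ]
    linear_combination u' * e + (C.z - algebraMap K R (φ C.z)) * e3
  · exact ⟨0, 1, h, by simp, h0, by simp⟩

theorem uniq_aff (C : Crv p q t K R) (φ : R →ₐ[K] K) (P : Plc K F)
    (h0 : ∀ r, 0 ≤ P.v (algebraMap R F r))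
    (h1 : ∀ r, r ≠ 0 → φ r = 0 → 0 < P.v (algebraMap R F r)) : P = C.pl F φ := by
  have hz0 := C.zr_ne (φ C.z)
  have hu : ∀ u, φ u ≠ 0 → P.v (algebraMap R F u) = 0 := by
    intro u hu
    have e : algebraMap R F u = algebraMap K F (φ u) + algebraMap R F (u - algebraMap K R (φ u)) := by
      rw [map_sub, ιK]; ring
    rw [e, (Plc.add_of_lt _ _).2, P.v_const]
    · simpa using hu
    · rw [P.v_const]
      by_cases h : u - algebraMap K R (φ u) = 0
      · left; rw [h, map_zero]
      · right
        have := h1 _ h (by simp)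
        omega
  have key : ∀ r, r ≠ 0 → P.v (algebraMap R F r) =
      P.v (algebraMap R F (C.z - algebraMap K R (φ C.z))) * (C.pl F φ).v (algebraMap R F r) := by
    intro r hr
    obtain ⟨n, u, r1, hu1, hr1, e⟩ := C.locn F φ r hr
    have hu0 := ne_of_φ φ hu1
    have h10 := ne_of_φ φ hr1
    have gen : ∀ Q : Plc K F, Q.v (algebraMap R F u) + Q.v (algebraMap R F r) =
      n * Q.v (algebraMap R F (C.z - algebraMap K R (φ C.z))) + Q.v (algebraMap R F r1) := by
      intro Q
      have e2 := congrArg (fun w => Q.v (algebraMap R F w)) e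
      simp only [map_mul, map_pow] at e2
      rwa [Q.v_mul _ _ (ι_ne hu0) (ι_ne hr), Q.v_mul _ _ (pow_ne_zero _ (ι_ne hz0)) (ι_ne h10),
        Q.v_pow] at e2
    have e3 := gen P
    have e4 := gen (C.pl F φ)
    rw [hu u hu1, hu r1 hr1] at e3
    rw [C.pl_zero φ u hu1, C.pl_zero φ r1 hr1, pl_zr'] at e4
    have e5 : (C.pl F φ).v (algebraMap R F r) = n := by linarith
    rw [e5]; linarith
  have key2 : ∀ w : F, w ≠ 0 → P.v w =
      P.v (algebraMap R F (C.z - algebraMap K R (φ C.z))) * (C.pl F φ).v w := by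
    intro w hw
    obtain ⟨a, b, hb, rfl⟩ := IsFractionRing.div_surjective (A := R) w
    have hb0 := nonZeroDivisors.ne_zero hb
    have ha0 : a ≠ 0 := by rintro rfl; simp at hw
    rw [Plc.v_div _ _ _ (ι_ne ha0) (ι_ne hb0), Plc.v_div _ _ _ (ι_ne ha0) (ι_ne hb0), key a ha0,
      key b hb0]; ring
  have e1 : P.v (algebraMap R F (C.z - algebraMap K R (φ C.z))) = 1 := by
    obtain ⟨w, hw, hw1⟩ := P.v_surj
    have := key2 w hw
    rw [hw1] at this
    have hnn := h0 (C.z - algebraMap K R (φ C.z))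
    have := Int.eq_one_or_neg_one_of_mul_eq_one' this.symm
    omega
  apply Plc.ext'
  intro w hw
  rw [key2 w hw, e1, one_mul]

theorem pl_int (C : Crv p q t K R) (φ : R →ₐ[K] K) (w : F) (hw : (C.pl F φ).ge 0 w) :
    ∃ h h' : R, φ h' ≠ 0 ∧ w * algebraMap R F h' = algebraMap R F h := by
  by_cases hw0 : w = 0
  · exact ⟨0, 1, by simp, by simp [hw0]⟩
  obtain ⟨a, b, hb, rfl⟩ := IsFractionRing.div_surjective (A := R) w
  have hb0 := nonZeroDivisors.ne_zero hb
  have ha0 : a ≠ 0 := by rintro rfl; simp at hw0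
  have hz0 := C.zr_ne (φ C.z)
  have hv := hw.v_le hw0
  rw [Plc.v_div _ _ _ (ι_ne ha0) (ι_ne hb0)] at hv
  have gen : ∀ (r : R) (hr : r ≠ 0) (n : ℕ) (u r1 : R) (hu : φ u ≠ 0) (hr1 : φ r1 ≠ 0)
      (e : u * r = (C.z - algebraMap K R (φ C.z)) ^ n * r1),
      (C.pl F φ).v (algebraMap R F r) = n := by
    intro r hr n u r1 hu hr1 e
    have e2 := congrArg (fun w => (C.pl F φ).v (algebraMap R F w)) e
    simp only [map_mul, map_pow] at e2
    rw [Plc.v_mul _ _ _ (ι_ne (ne_of_φ φ hu)) (ι_ne hr), Plc.v_mul _ _ _ (pow_ne_zero _ (ι_ne hz0))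
      (ι_ne (ne_of_φ φ hr1)), Plc.v_pow, C.pl_zero φ u hu, C.pl_zero φ r1 hr1, pl_zr'] at e2
    linarith
  obtain ⟨n, u, a1, hu, ha1, ea⟩ := C.locn F φ a ha0
  obtain ⟨k, u', b1, hu', hb1, eb⟩ := C.locn F φ b hb0
  rw [gen a ha0 n u a1 hu ha1 ea, gen b hb0 k u' b1 hu' hb1 eb] at hv
  have hkn : k ≤ n := by omega
  obtain ⟨d, rfl⟩ := Nat.exists_eq_add_of_le hkn
  refine ⟨(C.z - algebraMap K R (φ C.z)) ^ d * a1 * u', b1 * u, by simpa using ⟨hb1, hu⟩, ?_⟩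
  have hbF := ι_ne (F := F) hb0
  rw [div_mul_eq_mul_div, div_eq_iff hbF, ← map_mul, ← map_mul]
  congr 1
  have hp0 := pow_ne_zero k hz0
  apply mul_left_cancel₀ hp0
  rw [pow_add] at ea
  linear_combination b1 * (C.z - algebraMap K R (φ C.z)) ^ k * ea -
    (C.z - algebraMap K R (φ C.z)) ^ k * (C.z - algebraMap K R (φ C.z)) ^ d * a1 * eb

end Crv


set_option linter.unusedVariables false
set_option linter.unusedSectionVars false

namespace Crv

variable {p q t : ℕ} {K R F : Type} [Field K] [IsAlgClosed K] [CharP K p] [CommRing R]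
  [Algebra K R] [IsDomain R] [Field F] [Algebra K F] [Algebra R F] [IsScalarTower K R F]
  [IsFractionRing R F]

theorem root_ge (P : Plc K F) (w : F) (f : Polynomial K) (hf : f ≠ 0)
    (h : P.ge 1 (Polynomial.aeval w f)) : ∃ r, f.IsRoot r ∧ P.ge 1 (w - algebraMap K F r) := by
  by_contra hc
  push Not at hc
  have hs := IsAlgClosed.splits f
  have e : Polynomial.aeval w f = algebraMap K F f.leadingCoeff *
      (f.roots.map fun r => w - algebraMap K F r).prod := by
    conv_lhs => rw [hs.eq_prod_roots]
    rw [map_mul, Polynomial.aeval_C, map_multiset_prod, Multiset.map_map]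
    congr 2
    apply Multiset.map_congr rfl
    intro r _; simp
  have key : ∀ T : Multiset K, (∀ r ∈ T, ¬ P.ge 1 (w - algebraMap K F r)) →
      ¬ P.ge 1 (T.map fun r => w - algebraMap K F r).prod := by
    intro T
    induction T using Multiset.induction_on with
    | empty =>
      intro _ h
      have := h.v_le (by simp)
      simp [P.v_one] at this
    | cons a T ih =>
      intro hT h
      have h1 := hT a (Multiset.mem_cons_self _ _)
      have h2 := ih fun r hr => hT r (Multiset.mem_cons_of_mem hr)
      rw [Multiset.map_cons, Multiset.prod_cons] at h
      simp only [Plc.ge, not_or, not_le] at h1 h2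
      have := h.v_le (mul_ne_zero h1.1 h2.1)
      rw [P.v_mul _ _ h1.1 h2.1] at this
      omega
  apply key f.roots
  · intro r hr
    exact hc r (Polynomial.isRoot_of_mem_roots hr)
  · rw [e] at h
    have := h.const_mul (f.leadingCoeff)⁻¹
    rwa [← mul_assoc, ← map_mul, inv_mul_cancel₀ (by simpa using hf), map_one, one_mul] at this

theorem ge_all (C : Crv p q t K R) (P : Plc K F) (φ : R →ₐ[K] K)
    (hx : P.ge 1 (algebraMap R F C.x - algebraMap K F (φ C.x)))
    (hy : P.ge 1 (algebraMap R F C.y - algebraMap K F (φ C.y)))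
    (hz : P.ge 1 (algebraMap R F C.z - algebraMap K F (φ C.z))) (h : R) :
    P.ge 1 (algebraMap R F h - algebraMap K F (φ h)) ∧ P.ge 0 (algebraMap R F h) := by
  have g0 : ∀ h : R, P.ge 1 (algebraMap R F h - algebraMap K F (φ h)) → P.ge 0 (algebraMap R F h) := by
    intro h hh
    have := (hh.mono (by norm_num : (0 : ℤ) ≤ 1)).add (Plc.ge_const (P := P) (φ h))
    simpa using this
  have hr : h ∈ Algebra.adjoin K {C.x, C.y, C.z} := by rw [C.gen]; trivial
  suffices P.ge 1 (algebraMap R F h - algebraMap K F (φ h)) from ⟨this, g0 h this⟩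
  induction hr using Algebra.adjoin_induction with
  | mem w hw =>
    rcases hw with rfl | rfl | rfl <;> assumption
  | algebraMap c => left; rw [ιK]; simp
  | add a b _ _ ha hb =>
    have := ha.add hb
    convert this using 1
    simp only [map_add]; ring
  | mul a b _ _ ha hb =>
    have h1 := (g0 a ha).mul hb
    have h2 := ha.const_mul (φ b)
    rw [zero_add] at h1
    have := h1.add h2
    convert this using 1
    simp only [map_mul]; ring

theorem uniq_gen (C : Crv p q t K R) (P : Plc K F) (φ : R →ₐ[K] K)
    (hx : P.ge 1 (algebraMap R F C.x - algebraMap K F (φ C.x)))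
    (hy : P.ge 1 (algebraMap R F C.y - algebraMap K F (φ C.y)))
    (hz : P.ge 1 (algebraMap R F C.z - algebraMap K F (φ C.z))) : P = C.pl F φ := by
  apply C.uniq_aff
  · intro r
    rcases (C.ge_all P φ hx hy hz r).2 with h | h
    · rw [h, P.v_zero]
    · exact h
  · intro r hr h
    have := (C.ge_all P φ hx hy hz r).1
    rw [h, map_zero, sub_zero] at this
    have := this.v_le (ι_ne hr)
    omega

theorem pl_ge1 (C : Crv p q t K R) (φ : R →ₐ[K] K) (r : R) :
    (C.pl F φ).ge 1 (algebraMap R F r - algebraMap K F (φ r)) := by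
  rw [← ιK (R := R), ← map_sub]
  by_cases h : r - algebraMap K R (φ r) = 0
  · left; rw [h, map_zero]
  · right
    exact C.pl_pos φ _ h (by simp)

theorem nonneg_R (C : Crv p q t K R) (P : Plc K F) (h : 0 ≤ P.v (algebraMap R F C.z)) (r : R) :
    P.ge 0 (algebraMap R F r) := by
  have hq2 := C.q2
  have h4 : 1 < q ^ 2 := by nlinarith
  have hz : P.ge 0 (algebraMap R F C.z) := Or.inr h
  have gen : ∀ (w b : F) (k : ℕ), 1 < k → w ^ k + b = w ∨ w ^ k + b = - w → P.ge 0 b → P.ge 0 w := by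
    intro w b k hk e hb
    by_cases hw : w = 0
    · exact Or.inl hw
    right
    by_contra hneg
    push Not at hneg
    have hwk : P.v (w ^ k) = k * P.v w := P.v_pow w k
    have h1 := (Plc.add_of_lt (P := P) (a := w ^ k) (b := b) (pow_ne_zero _ hw)
      (hb.mono (by rw [hwk]; nlinarith))).2
    have h2 : P.v (w ^ k + b) = P.v w := by
      rcases e with e | e
      · rw [e]
      · rw [e, P.v_neg]
    rw [h2, hwk] at h1
    have : (2 : ℤ) ≤ k := by exact_mod_cast hk
    nlinarith
  have hy : P.ge 0 (algebraMap R F C.y) := by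
    apply gen _ (-algebraMap R F C.z ^ t) (q ^ 2) h4
    · left; rw [C.hzF]; ring
    · exact (hz.pow t).neg
  have hx : P.ge 0 (algebraMap R F C.x) := by
    apply gen _ (-algebraMap R F C.y ^ (q + 1)) q hq2
    · right; rw [C.hxF]; ring
    · exact (hy.pow _).neg
  have hr : r ∈ Algebra.adjoin K {C.x, C.y, C.z} := by rw [C.gen]; trivial
  induction hr using Algebra.adjoin_induction with
  | mem w hw => rcases hw with rfl | rfl | rfl <;> assumption
  | algebraMap c => rw [ιK]; exact Plc.ge_const c
  | add a b _ _ ha hb => rw [map_add]; exact ha.add hb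
  | mul a b _ _ ha hb => rw [map_mul]; simpa using ha.mul hb

theorem exists_pl (C : Crv p q t K R) (P : Plc K F) (h : 0 ≤ P.v (algebraMap R F C.z)) :
    ∃ φ, P = C.pl F φ := by
  have hq2 := C.q2
  have h4 : 1 < q ^ 2 := by nlinarith
  have hR := C.nonneg_R P h
  obtain ⟨r, hr⟩ : ∃ r : K, P.ge 1 (algebraMap R F C.z - algebraMap K F r) := by
    by_contra hc
    push Not at hc
    have h0 : ∀ f : Polynomial K, f ≠ 0 → P.v (algebraMap R F (Polynomial.aeval C.z f)) = 0 := by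
      intro f hf
      rw [C.v_poly P f hf]
      apply Multiset.sum_eq_zero
      intro w hw
      obtain ⟨r, -, rfl⟩ := Multiset.mem_map.mp hw
      have h1 := hc r
      have h2 := hR (C.z - algebraMap K R r)
      rw [map_sub, ιK] at h2
      have := h2.v_le (C.z_sub_ne r)
      simp only [Plc.ge, not_or, not_le] at h1
      omega
    have h1 : ∀ r : R, r ≠ 0 → P.v (algebraMap R F r) = 0 := by
      intro r hr
      obtain ⟨f, hf, r', e⟩ := C.exists_norm F r hr
      have hr' : r' ≠ 0 := by
        rintro rfl
        rw [mul_zero] at e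
        exact hf (C.transc f e)
      have := h0 f hf
      rw [e, map_mul, P.v_mul _ _ (ι_ne hr) (ι_ne hr')] at this
      have := (hR r).v_le (ι_ne hr)
      have := (hR r').v_le (ι_ne hr')
      omega
    obtain ⟨w, hw, hw1⟩ := P.v_surj
    obtain ⟨a, b, hb, rfl⟩ := IsFractionRing.div_surjective (A := R) w
    have hb0 := nonZeroDivisors.ne_zero hb
    have ha0 : a ≠ 0 := by rintro rfl; simp at hw
    rw [P.v_div _ _ (ι_ne ha0) (ι_ne hb0), h1 a ha0, h1 b hb0] at hw1
    simp at hw1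
  have dvd : ∀ (a : R) (c : K) (n : ℕ), P.ge 1 (algebraMap R F a - algebraMap K F c) →
      P.ge 1 (algebraMap R F a ^ n - algebraMap K F c ^ n) := by
    intro a c n hac
    obtain ⟨g, hg⟩ := sub_dvd_pow_sub_pow a (algebraMap K R c) n
    have := congrArg (algebraMap R F) hg
    simp only [map_sub, map_mul, map_pow, ιK] at this
    rw [this]
    simpa using hac.mul (hR g)
  obtain ⟨y0, hy0, hy⟩ := root_ge P (algebraMap R F C.y)
    (Polynomial.X ^ (q ^ 2) - (Polynomial.X + Polynomial.C (r ^ t))) (by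
      apply Polynomial.Monic.ne_zero
      apply Polynomial.monic_X_pow_sub
      refine (Polynomial.degree_X_add_C _).le.trans_lt ?_
      exact_mod_cast h4) (by
      have := dvd C.z r t hr
      convert this using 1
      rw [C.hzF]; simp; ring)
  obtain ⟨x0, hx0, hx⟩ := root_ge P (algebraMap R F C.x)
    (Polynomial.X ^ q + (Polynomial.X + Polynomial.C (- y0 ^ (q + 1)))) (by
      apply Polynomial.Monic.ne_zero
      apply Polynomial.monic_X_pow_add
      refine (Polynomial.degree_X_add_C _).le.trans_lt ?_
      exact_mod_cast hq2) (by
      have := dvd C.y y0 (q + 1) hy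
      convert this using 1
      rw [C.hxF]; simp; ring)
  simp at hx0 hy0
  obtain ⟨φ, h1, h2, h3⟩ := C.lift K x0 y0 r (by linear_combination -hy0)
    (by linear_combination -hx0)
  refine ⟨φ, C.uniq_gen P φ ?_ ?_ ?_⟩
  · rwa [h1]
  · rwa [h2]
  · rwa [h3]

theorem mem_R (C : Crv p q t K R) (w : F) (hw : ∀ φ, (C.pl F φ).ge 0 w) :
    ∃ r : R, w = algebraMap R F r := by
  let J : Ideal R :=
    { carrier := {r | ∃ h : R, w * algebraMap R F r = algebraMap R F h}
      add_mem' := by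
        rintro a b ⟨h, e⟩ ⟨h', e'⟩
        exact ⟨h + h', by rw [map_add, map_add, mul_add, e, e']⟩
      zero_mem' := ⟨0, by simp⟩
      smul_mem' := by
        rintro c a ⟨h, e⟩
        exact ⟨c * h, by rw [smul_eq_mul, map_mul, map_mul, ← e]; ring⟩ }
  by_cases hJ : J = ⊤
  · have : (1 : R) ∈ J := by rw [hJ]; trivial
    obtain ⟨h, e⟩ := this
    exact ⟨h, by simpa using e⟩
  exfalso
  obtain ⟨m, hm, hJm⟩ := Ideal.exists_le_maximal J hJ
  have := C.noeth
  letI : Field (R ⧸ m) := Ideal.Quotient.field m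
  have : Module.Finite K (R ⧸ m) := finite_of_finite_type_of_isJacobsonRing K (R ⧸ m)
  have hb := IsAlgClosed.algebraMap_bijective_of_isIntegral (k := K) (K := R ⧸ m)
  let e : K ≃ₐ[K] R ⧸ m := AlgEquiv.ofBijective (Algebra.ofId K (R ⧸ m)) hb
  let φ : R →ₐ[K] K := (e.symm : R ⧸ m →ₐ[K] K).comp (Ideal.Quotient.mkₐ K m)
  obtain ⟨h, h', h1, h2⟩ := C.pl_int φ w (hw φ)
  apply h1
  have : h' ∈ m := hJm ⟨h, h2⟩
  simp [φ, Ideal.Quotient.eq_zero_iff_mem.mpr this]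

theorem S_trans (C : Crv p q t K R) (φ ψ : R →ₐ[K] K) (h : φ C.z = ψ C.z) :
    ∃ a ∈ C.S F, a⁻¹ • C.pl F φ = C.pl F ψ := by
  have hyφ := congrArg φ C.hz
  have hyψ := congrArg ψ C.hz
  have hxφ := congrArg φ C.hx
  have hxψ := congrArg ψ C.hx
  simp only [map_sub, map_pow, map_add] at hyφ hyψ hxφ hxψ
  set β := ψ C.y - φ C.y with hβ
  have hβ2 : β ^ (q ^ 2) = β := by
    rw [hβ, C.frob_sub_pow]
    rw [h] at hyφ
    linear_combination hyφ - hyψ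
  have hψy : ψ C.y = φ C.y + β := by rw [hβ]; ring
  have tr : C.trip 1 β (ψ C.x - φ C.x - β ^ q * φ C.y) := by
    refine ⟨by simp, hβ2, ?_⟩
    rw [C.frob_sub, C.frob_sub, mul_pow, ← pow_mul, ← pow_two, hβ2]
    have e1 : (φ C.y + β) ^ (q + 1) = (φ C.y ^ q + β ^ q) * (φ C.y + β) := by
      rw [pow_succ, C.frob]
    rw [hψy, e1] at hxψ
    rw [pow_succ] at hxφ ⊢
    linear_combination hxφ - hxψ
  obtain ⟨a, ha⟩ := C.exists_aut (F := F) tr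
  refine ⟨a, C.S_of_isA ha, ?_⟩
  obtain ⟨az, ay, ax⟩ := ha
  have g : ∀ u : F, (C.pl F φ).ge 1 (a u) → (a⁻¹ • C.pl F φ).ge 1 u := by
    intro u hu
    rcases hu with hu | hu
    · left; simpa using hu
    · right; rwa [Plc.inv_smul_v]
  have gx := C.pl_ge1 (F := F) φ C.x
  have gy := C.pl_ge1 (F := F) φ C.y
  have gz := C.pl_ge1 (F := F) φ C.z
  apply C.uniq_gen
  · apply g
    rw [map_sub, AlgEquiv.commutes, ax]
    have := gx.add (gy.const_mul (β ^ q))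
    convert this using 1
    simp [ιK]; ring
  · apply g
    rw [map_sub, AlgEquiv.commutes, ay, hψy]
    convert gy using 1
    simp [ιK]
  · apply g
    rw [map_sub, AlgEquiv.commutes, az, ← h]
    convert gz using 1
    simp

theorem pl_inj (C : Crv p q t K R) {φ ψ : R →ₐ[K] K} (h : C.pl F φ = C.pl F ψ) : φ = ψ := by
  ext r
  by_contra hne
  have h1 := C.pl_ge1 (F := F) φ r
  have h2 := C.pl_ge1 (F := F) ψ r
  rw [h] at h1
  have h3 := h1.sub h2
  have h4 : algebraMap R F r - algebraMap K F (φ r) - (algebraMap R F r - algebraMap K F (ψ r)) =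
    algebraMap K F (ψ r - φ r) := by rw [map_sub]; ring
  rw [h4] at h3
  have := h3.v_le (by simpa [sub_eq_zero] using fun h => hne h.symm)
  rw [Plc.v_const] at this
  omega

theorem pl_ne_inf (C : Crv p q t K R) (φ : R →ₐ[K] K) : C.pl F φ ≠ C.vinf F := by
  intro h
  have h1 := C.pl_nonneg (F := F) φ C.z
  rw [h] at h1
  have := C.vinf_z_neg (F := F)
  omega

theorem inf_or_pl (C : Crv p q t K R) (P : Plc K F) : P = C.vinf F ∨ ∃ φ, P = C.pl F φ := by
  rcases lt_or_ge (P.v (algebraMap R F C.z)) 0 with h | h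
  · exact Or.inl (C.uniq_inf P h)
  · exact Or.inr (C.exists_pl P h)

end Crv


set_option linter.unusedVariables false
set_option linter.unusedSectionVars false

namespace Crv

variable {p q t : ℕ} {K R F : Type} [Field K] [IsAlgClosed K] [CharP K p] [CommRing R]
  [Algebra K R] [IsDomain R] [Field F] [Algebra K F] [Algebra R F] [IsScalarTower K R F]
  [IsFractionRing R F]

theorem tauF_unit (C : Crv p q t K R) (F : Type) [Field F] [Algebra K F] [Algebra R F]
    [IsScalarTower K R F] [IsFractionRing R F] (r : nonZeroDivisors R) :
    IsUnit (((PowerSeries.map (algebraMap R F)).comp (C.tau : R →+* PowerSeries R)) r) := by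
  rw [PowerSeries.isUnit_iff_constantCoeff]
  rw [← PowerSeries.coeff_zero_eq_constantCoeff_apply]
  simp only [RingHom.comp_apply, PowerSeries.coeff_map]
  rw [PowerSeries.coeff_zero_eq_constantCoeff_apply]
  have : PowerSeries.constantCoeff ((C.tau : R →+* PowerSeries R) r) = r := C.tau0 r
  rw [this]
  exact (ι_ne (nonZeroDivisors.ne_zero r.2)).isUnit

variable (F) in
/-- Taylor map on the function field -/
noncomputable def tauF (C : Crv p q t K R) : F →+* PowerSeries F :=
  IsLocalization.lift (C.tauF_unit F)

theorem tauF_ι (C : Crv p q t K R) (r : R) :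
    C.tauF F (algebraMap R F r) = PowerSeries.map (algebraMap R F) (C.tau r) :=
  IsLocalization.lift_eq _ _

theorem tauF0 (C : Crv p q t K R) (u : F) : PowerSeries.coeff 0 (C.tauF F u) = u := by
  have : (PowerSeries.constantCoeff (R := F)).comp (C.tauF F) = RingHom.id F := by
    apply IsLocalization.ringHom_ext (nonZeroDivisors R)
    ext r
    simp only [RingHom.comp_apply, tauF_ι, RingHom.id_apply]
    rw [← PowerSeries.coeff_zero_eq_constantCoeff_apply, PowerSeries.coeff_map,
      PowerSeries.coeff_zero_eq_constantCoeff_apply, tau0]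
  rw [PowerSeries.coeff_zero_eq_constantCoeff_apply]
  exact DFunLike.congr_fun this u

variable (F) in
/-- the derivation -/
noncomputable def D (C : Crv p q t K R) : Derivation K F F :=
  Derivation.mk'
    { toFun := fun u => PowerSeries.coeff 1 (C.tauF F u)
      map_add' := fun a b => by simp
      map_smul' := fun c a => by
        rw [Algebra.smul_def, map_mul, ← ιK (R := R), tauF_ι, AlgHom.commutes]
        simp [PowerSeries.algebraMap_apply, Algebra.smul_def, ιK] }
    (fun a b => by
      simp only [LinearMap.coe_mk, AddHom.coe_mk]
      rw [map_mul, PowerSeries.coeff_mul, Finset.Nat.antidiagonal_succ]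
      simp only [Finset.Nat.antidiagonal_zero, Finset.map_singleton, Finset.sum_cons,
        Finset.sum_singleton, Function.Embedding.prodMap, tauF0]
      simp [tauF0]
      ring)

theorem D_ι (C : Crv p q t K R) (r : R) :
    C.D F (algebraMap R F r) = algebraMap R F (PowerSeries.coeff 1 (C.tau r)) := by
  show PowerSeries.coeff 1 (C.tauF F (algebraMap R F r)) = _
  rw [tauF_ι]; simp

theorem D_z (C : Crv p q t K R) : C.D F (algebraMap R F C.z) = 1 := by
  rw [D_ι, tau_z]; simp

theorem qF (C : Crv p q t K R) : (q : F) = 0 := by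
  have : (algebraMap K F) (q : K) = 0 := by rw [C.qK, map_zero]
  simpa using this

theorem der_y (C : Crv p q t K R) (E : Derivation K F F) : E (algebraMap R F C.y) =
    - (t * algebraMap R F C.z ^ (t - 1) * E (algebraMap R F C.z)) := by
  have h := congrArg E C.hzF
  rw [map_sub, Derivation.leibniz_pow, Derivation.leibniz_pow] at h
  simp [C.qF] at h
  linear_combination h

theorem der_x (C : Crv p q t K R) (E : Derivation K F F) : E (algebraMap R F C.x) =
    algebraMap R F C.y ^ q * E (algebraMap R F C.y) := by
  have h := congrArg E C.hxF
  rw [map_add, Derivation.leibniz_pow, Derivation.leibniz_pow] at h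
  simp [C.qF] at h
  linear_combination -h

theorem der_eq (C : Crv p q t K R) (E : Derivation K F F) (u : F) :
    E u = E (algebraMap R F C.z) * C.D F u := by
  have hy : E (algebraMap R F C.y) = E (algebraMap R F C.z) * C.D F (algebraMap R F C.y) := by
    rw [C.der_y E, C.der_y (C.D F), D_z]; ring
  have hx : E (algebraMap R F C.x) = E (algebraMap R F C.z) * C.D F (algebraMap R F C.x) := by
    rw [C.der_x E, C.der_x (C.D F), hy]; ring
  have hR : ∀ r : R, E (algebraMap R F r) = E (algebraMap R F C.z) * C.D F (algebraMap R F r) := by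
    intro r
    have hr : r ∈ Algebra.adjoin K {C.x, C.y, C.z} := by rw [C.gen]; trivial
    induction hr using Algebra.adjoin_induction with
    | mem w hw =>
      rcases hw with rfl | rfl | rfl
      · exact hx
      · exact hy
      · rw [D_z, mul_one]
    | algebraMap c => rw [ιK]; simp
    | add a b _ _ ha hb => rw [map_add, map_add, map_add, ha, hb]; ring
    | mul a b _ _ ha hb =>
      rw [map_mul, Derivation.leibniz, Derivation.leibniz, ha, hb]
      simp only [smul_eq_mul]; ring
  obtain ⟨a, b, hb, rfl⟩ := IsFractionRing.div_surjective (A := R) u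
  have hb0 := ι_ne (F := F) (nonZeroDivisors.ne_zero hb)
  rw [Derivation.leibniz_div, Derivation.leibniz_div, hR a, hR b]
  simp only [smul_eq_mul]; ring

theorem D_aut (C : Crv p q t K R) (a : F ≃ₐ[K] F) (u : F) :
    C.D F (a u) = C.D F (a (algebraMap R F C.z)) * a (C.D F u) := by
  let E : Derivation K F F := Derivation.mk'
    { toFun := fun u => a.symm (C.D F (a u))
      map_add' := fun x y => by simp
      map_smul' := fun c x => by simp }
    (fun x y => by simp [Derivation.leibniz])
  have h := C.der_eq E u
  have h1 : ∀ u, E u = a.symm (C.D F (a u)) := fun _ => rfl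
  rw [h1, h1] at h
  have := congrArg a h
  simpa using this

theorem D_int (C : Crv p q t K R) (φ : R →ₐ[K] K) (w : F) (hw : (C.pl F φ).ge 0 w) :
    (C.pl F φ).ge 0 (C.D F w) := by
  obtain ⟨h, h', h1, e⟩ := C.pl_int φ w hw
  have e1 := congrArg (C.D F) e
  rw [Derivation.leibniz, D_ι, D_ι] at e1
  simp only [smul_eq_mul] at e1
  have gR : ∀ r : R, (C.pl F φ).ge 0 (algebraMap R F r) := fun r => Or.inr (C.pl_nonneg φ r)
  have h2 := (gR (PowerSeries.coeff 1 (C.tau h))).sub (by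
    simpa using hw.mul (gR (PowerSeries.coeff 1 (C.tau h'))))
  rw [← e1] at h2
  have h3 := ι_ne (F := F) (ne_of_φ φ h1)
  by_cases h0 : C.D F w = 0
  · exact Or.inl h0
  right
  have h4 := h2
  have e3 : w * algebraMap R F (PowerSeries.coeff 1 (C.tau h')) + algebraMap R F h' * C.D F w
    - w * algebraMap R F (PowerSeries.coeff 1 (C.tau h')) = algebraMap R F h' * C.D F w := by ring
  rw [e3] at h4
  have := h4.v_le (mul_ne_zero h3 h0)
  rw [Plc.v_mul _ _ _ h3 h0, C.pl_zero φ h' h1] at this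
  omega

end Crv


set_option linter.unusedVariables false
set_option linter.unusedSectionVars false

namespace Crv

variable {p q t : ℕ} {K R F : Type} [Field K] [IsAlgClosed K] [CharP K p] [CommRing R]
  [Algebra K R] [IsDomain R] [Field F] [Algebra K F] [Algebra R F] [IsScalarTower K R F]
  [IsFractionRing R F]

variable (q t) in
/-- the canonical degree, up to scaling -/
def MM : ℤ := t * ((q : ℤ) + 1) * ((q : ℤ) ^ 2 - 1) - ((q : ℤ) ^ 3 + 1)

theorem MM_pos (C : Crv p q t K R) : 0 < MM q t := by
  have h1 : (2 : ℤ) ≤ q := by exact_mod_cast C.q2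
  have h2 : (2 : ℤ) ≤ t := by exact_mod_cast C.ht
  have h3 : (0 : ℤ) ≤ ((q : ℤ) + 1) * ((q : ℤ) ^ 2 - 1) := by nlinarith
  have : 2 * (((q : ℤ) + 1) * ((q : ℤ) ^ 2 - 1)) ≤ t * (((q : ℤ) + 1) * ((q : ℤ) ^ 2 - 1)) :=
    mul_le_mul_of_nonneg_right h2 h3
  unfold MM
  nlinarith

variable (F) in
/-- logarithmic derivative of `x` -/
noncomputable def lam (C : Crv p q t K R) : F :=
  C.D F (algebraMap R F C.x) / algebraMap R F C.x

theorem tF (C : Crv p q t K R) : (t : F) ≠ 0 := by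
  have : (algebraMap K F) (t : K) ≠ 0 := (map_ne_zero (algebraMap K F)).mpr C.tK
  simpa only [map_natCast] using this

theorem Dy_ne (C : Crv p q t K R) : C.D F (algebraMap R F C.y) ≠ 0 := by
  rw [C.der_y, D_z]
  simpa using ⟨C.tF, fun h => absurd h C.z_ne⟩

theorem vinf_Dy (C : Crv p q t K R) :
    (C.vinf F).v (C.D F (algebraMap R F C.y)) = - ((q : ℤ) ^ 3 * (t - 1)) := by
  have ht := C.ht
  rw [C.der_y, D_z, Plc.v_neg, mul_one]
  have : (t : F) = algebraMap K F t := by simp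
  rw [this, Plc.v_const_mul _ _ C.tK, Plc.v_pow, vinf_z]
  push_cast [Nat.cast_sub (show 1 ≤ t by omega)]
  ring

theorem lam_ne (C : Crv p q t K R) : C.lam F ≠ 0 := by
  unfold lam
  rw [C.der_x]
  exact div_ne_zero (mul_ne_zero (pow_ne_zero _ (ι_ne C.y_ne)) C.Dy_ne) (ι_ne C.x_ne)

theorem vinf_lam (C : Crv p q t K R) : (C.vinf F).v (C.lam F) = - (MM q t + 1) := by
  unfold lam
  have hy := pow_ne_zero q (ι_ne (F := F) C.y_ne)
  have hx := ι_ne (F := F) C.x_ne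
  rw [C.der_x, Plc.v_div _ _ _ (mul_ne_zero hy C.Dy_ne) hx, Plc.v_mul _ _ _ hy C.Dy_ne, Plc.v_pow,
    vinf_y, vinf_Dy, vinf_x]
  unfold MM; ring

/-- corrected derivative estimate -/
def Th (C : Crv p q t K R) (u : F) : Prop :=
  (C.vinf F).ge ((C.vinf F).v u - MM q t)
    (C.D F u + algebraMap K F ((t : K)⁻¹ * ((C.vinf F).v u : K)) * C.lam F * u)

theorem Th_mul (C : Crv p q t K R) {u w : F} (hu : u ≠ 0) (hw : w ≠ 0) (h1 : C.Th u) (h2 : C.Th w) :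
    C.Th (u * w) := by
  unfold Th at *
  have h3 := (h1.mul (Plc.ge_self w)).mono (m := (C.vinf F).v u + (C.vinf F).v w - MM q t) (by omega)
  have h4 := ((Plc.ge_self u).mul h2).mono (m := (C.vinf F).v u + (C.vinf F).v w - MM q t) (by omega)
  rw [Plc.v_mul _ _ _ hu hw]
  convert h3.add h4 using 1
  rw [Derivation.leibniz]
  simp only [smul_eq_mul]
  push_cast
  ring

theorem Th_inv (C : Crv p q t K R) {u : F} (hu : u ≠ 0) (h1 : C.Th u) : C.Th u⁻¹ := by
  unfold Th at *
  have h3 := (h1.mul (Plc.ge_self (u⁻¹ ^ 2))).neg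
  rw [Plc.v_pow, Plc.v_inv] at h3
  rw [Plc.v_inv]
  have h4 := h3.mono (m := -(C.vinf F).v u - MM q t) (by push_cast; omega)
  convert h4 using 1
  rw [Derivation.leibniz_inv]
  simp only [smul_eq_mul]
  push_cast
  field_simp
  ring

theorem Th_const (C : Crv p q t K R) (c : K) : C.Th (algebraMap K F c) := by
  unfold Th
  left
  simp [Plc.v_const]

theorem qK' (C : Crv p q t K R) (n : ℕ) (hn : n ≠ 0) : (q : K) ^ n = 0 := by
  rw [C.qK, zero_pow hn]

theorem Th_x (C : Crv p q t K R) : C.Th (algebraMap R F C.x) := by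
  unfold Th
  left
  have hx := ι_ne (F := F) C.x_ne
  rw [vinf_x]
  have := C.tF (F := F)
  push_cast
  rw [C.qF]
  have e : (t : F)⁻¹ * -(t * (0 + 1)) = -1 := by field_simp; ring
  rw [e, lam]
  field_simp
  ring

theorem Th_z (C : Crv p q t K R) : C.Th (algebraMap R F C.z) := by
  unfold Th
  rw [vinf_z]
  push_cast
  rw [C.qF, zero_pow (by norm_num : 3 ≠ 0)]
  have := C.MM_pos
  have := C.q3pos
  right
  simp only [neg_zero, mul_zero, zero_mul, add_zero, D_z, Plc.v_one]
  omega

theorem Th_y (C : Crv p q t K R) : C.Th (algebraMap R F C.y) := by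
  unfold Th
  rw [vinf_y]
  push_cast
  rw [C.qF]
  right
  simp only [neg_zero, mul_zero, zero_mul, add_zero, vinf_Dy]
  have h1 : (2 : ℤ) ≤ q := by exact_mod_cast C.q2
  have h2 : (2 : ℤ) ≤ t := by exact_mod_cast C.ht
  unfold MM
  have h3 : (3 : ℤ) ≤ (q : ℤ) ^ 2 - 1 := by nlinarith
  have h5 : (2 : ℤ) * 3 ≤ t * ((q : ℤ) ^ 2 - 1) := mul_le_mul h2 h3 (by norm_num) (by omega)
  nlinarith

theorem Th_pow (C : Crv p q t K R) {u : F} (hu : u ≠ 0) (h : C.Th u) (n : ℕ) : C.Th (u ^ n) := by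
  induction n with
  | zero => simpa using C.Th_const (F := F) 1
  | succ n ih => rw [pow_succ]; exact C.Th_mul (pow_ne_zero _ hu) hu ih h

theorem Th_mon (C : Crv p q t K R) (κ : ℕ × ℕ × ℕ) : C.Th (algebraMap R F (C.mon κ)) := by
  have hx := ι_ne (F := F) C.x_ne
  have hy := ι_ne (F := F) C.y_ne
  have hz := ι_ne (F := F) C.z_ne
  simp only [mon, map_mul, map_pow]
  exact C.Th_mul (mul_ne_zero (pow_ne_zero _ hz) (pow_ne_zero _ hy)) (pow_ne_zero _ hx)
    (C.Th_mul (pow_ne_zero _ hz) (pow_ne_zero _ hy) (C.Th_pow hz C.Th_z _) (C.Th_pow hy C.Th_y _))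
    (C.Th_pow hx C.Th_x _)

theorem Th_weak (C : Crv p q t K R) {u : F} (h : C.Th u) :
    (C.vinf F).ge ((C.vinf F).v u - (MM q t + 1)) (C.D F u) := by
  have h1 := h.mono (m := (C.vinf F).v u - (MM q t + 1)) (by omega)
  have h2 := ((Plc.ge_self (P := C.vinf F) (C.lam F)).mul (Plc.ge_self (P := C.vinf F) u)).const_mul
    ((t : K)⁻¹ * ((C.vinf F).v u : K))
  rw [vinf_lam] at h2
  have h3 := h1.sub (h2.mono (m := (C.vinf F).v u - (MM q t + 1)) (by omega))
  convert h3 using 1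
  ring

theorem Th_R (C : Crv p q t K R) (h : R) (hh : h ≠ 0) : C.Th (algebraMap R F h) := by
  obtain ⟨κ, hκ, c, hc, h', hh', e, e1, e2⟩ := C.lead_inf (F := F) h hh
  have hD : (C.vinf F).ge (-(wt q t κ : ℤ) - MM q t) (C.D F (algebraMap R F h')) := by
    clear e e2
    induction hh' using Submodule.span_induction with
    | mem w hw =>
      obtain ⟨κ', ⟨-, hlt⟩, rfl⟩ := hw
      have := C.Th_weak (C.Th_mon (F := F) κ')
      rw [vinf_mon] at this
      exact this.mono (by omega)
    | zero => simp [Plc.ge_zero]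
    | add a b _ _ ha hb => rw [map_add, map_add]; exact ha.add hb
    | smul c a _ ha =>
      rw [Algebra.smul_def, map_mul, ιK, ← Algebra.smul_def, Derivation.map_smul, Algebra.smul_def]
      exact ha.const_mul c
  have hm := C.Th_mon (F := F) κ
  unfold Th at hm ⊢
  rw [vinf_mon] at hm
  rw [e1]
  have h1 := hm.const_mul c
  have h2 := ((Plc.ge_self (P := C.vinf F) (C.lam F)).mul e2).const_mul
    ((t : K)⁻¹ * ((-(wt q t κ : ℤ) : ℤ) : K))
  rw [vinf_lam] at h2
  have h3 := (h1.add hD).add (h2.mono (m := -(wt q t κ : ℤ) - MM q t) (by omega))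
  convert h3 using 1
  rw [e, map_add, map_mul, ιK, map_add, Derivation.leibniz]
  simp
  ring

theorem Th_all (C : Crv p q t K R) (u : F) (hu : u ≠ 0) : C.Th u := by
  obtain ⟨a, b, hb, rfl⟩ := IsFractionRing.div_surjective (A := R) u
  have hb0 := nonZeroDivisors.ne_zero hb
  have ha0 : a ≠ 0 := by rintro rfl; simp at hu
  rw [div_eq_mul_inv]
  exact C.Th_mul (ι_ne ha0) (inv_ne_zero (ι_ne hb0)) (C.Th_R a ha0) (C.Th_inv (ι_ne hb0) (C.Th_R b hb0))

theorem vinf_D (C : Crv p q t K R) (u : F) (hu : (C.vinf F).v u = 1) :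
    C.D F u ≠ 0 ∧ (C.vinf F).v (C.D F u) = - MM q t := by
  have hu0 : u ≠ 0 := by rintro rfl; simp [Plc.v_zero] at hu
  have h := C.Th_all u hu0
  unfold Th at h
  rw [hu] at h
  have hk : -(t : K)⁻¹ ≠ 0 := by simpa using C.tK
  have hlu := mul_ne_zero C.lam_ne hu0
  have hv : (C.vinf F).v (algebraMap K F (-(t : K)⁻¹) * (C.lam F * u)) = - MM q t := by
    rw [Plc.v_const_mul _ _ hk, Plc.v_mul _ _ _ C.lam_ne hu0, vinf_lam, hu]; ring
  have h2 := Plc.add_of_lt (P := C.vinf F) (a := algebraMap K F (-(t : K)⁻¹) * (C.lam F * u))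
    (b := C.D F u + algebraMap K F ((t : K)⁻¹ * ((1 : ℤ) : K)) * C.lam F * u)
    (mul_ne_zero ((map_ne_zero (algebraMap K F)).mpr hk) hlu) (by rw [hv]; exact h.mono (by omega))
  have e : algebraMap K F (-(t : K)⁻¹) * (C.lam F * u) +
    (C.D F u + algebraMap K F ((t : K)⁻¹ * ((1 : ℤ) : K)) * C.lam F * u) = C.D F u := by
    rw [Int.cast_one, mul_one, map_neg]; ring
  rw [e, hv] at h2
  exact h2

/-- the function `f = D (a z)` for an automorphism moving infinity -/
theorem exists_f (C : Crv p q t K R) (a : F ≃ₐ[K] F) (φ : R →ₐ[K] K) (ha : a • C.vinf F = C.pl F φ) :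
    ∃ r : R, r ≠ 0 ∧ algebraMap R F r = C.D F (a (algebraMap R F C.z)) ∧
      (C.vinf F).v (algebraMap R F r) = - MM q t ∧ (C.pl F φ).v (algebraMap R F r) = MM q t := by
  set f := C.D F (a (algebraMap R F C.z)) with hf
  have hM := C.MM_pos
  have ha' : a⁻¹ • C.pl F φ = C.vinf F := by rw [← ha, inv_smul_smul]
  obtain ⟨ψ, hψ⟩ : ∃ ψ, a⁻¹ • C.vinf F = C.pl F ψ := by
    rcases C.inf_or_pl (a⁻¹ • C.vinf F) with h | h
    · rw [inv_smul_eq_iff] at h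
      exact absurd (ha.symm.trans h.symm) (C.pl_ne_inf φ)
    · exact h
  have f1 : f ≠ 0 ∧ (C.vinf F).v f = - MM q t := by
    have h1 := C.pl_zr (F := F) ψ
    rw [← hψ, Plc.inv_smul_v] at h1
    have h2 := C.vinf_D _ h1
    have : C.D F (a (algebraMap R F C.z - algebraMap K F (ψ C.z))) = f := by
      rw [map_sub, AlgEquiv.commutes, map_sub, Derivation.map_algebraMap, sub_zero]
    rwa [this] at h2
  have f2 : (C.pl F φ).v f = MM q t := by
    have h1 := C.pl_zr (F := F) φ
    rw [← ha, Plc.smul_v] at h1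
    have h2 := C.vinf_D _ h1
    have h3 := C.D_aut a (a.symm (algebraMap R F C.z - algebraMap K F (φ C.z)))
    rw [AlgEquiv.apply_symm_apply, map_sub, D_z, Derivation.map_algebraMap, sub_zero, ← hf] at h3
    have h4 := congrArg (C.pl F φ).v h3
    rw [Plc.v_one, Plc.v_mul _ _ _ f1.1 (by simpa using h2.1), ← Plc.inv_smul_v, ha', h2.2] at h4
    omega
  obtain ⟨r, hr⟩ := C.mem_R f (by
    intro ψ'
    rcases C.inf_or_pl (a⁻¹ • C.pl F ψ') with h | ⟨χ, h⟩
    · have : C.pl F ψ' = C.pl F φ := by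
        rw [← ha]
        rw [inv_smul_eq_iff] at h
        exact h
      rw [this]
      right; rw [f2]; omega
    · apply C.D_int
      right
      rw [← Plc.inv_smul_v, h]
      exact C.pl_nonneg χ C.z)
  refine ⟨r, ?_, hr.symm, ?_, ?_⟩
  · rintro rfl
    rw [map_zero] at hr
    exact f1.1 hr
  · rw [← hr, f1.2]
  · rw [← hr, f2]

end Crv


set_option linter.unusedVariables false
set_option linter.unusedSectionVars false

namespace Crv

variable {p q t : ℕ} {K R F : Type} [Field K] [IsAlgClosed K] [CharP K p] [CommRing R]
  [Algebra K R] [IsDomain R] [Field F] [Algebra K F] [Algebra R F] [IsScalarTower K R F]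
  [IsFractionRing R F]

theorem v_zpow (P : Plc K F) (u : F) (n : ℤ) : P.v (u ^ n) = n * P.v u := by
  cases n with
  | ofNat n => simpa using P.v_pow u n
  | negSucc n =>
    rw [zpow_negSucc, P.v_inv, P.v_pow, Int.negSucc_eq]; push_cast; ring

theorem pl_zc (C : Crv p q t K R) (φ : R →ₐ[K] K) (r : K) (hr : φ C.z ≠ r) :
    (C.pl F φ).v (algebraMap R F C.z - algebraMap K F r) = 0 := by
  rw [← ιK (R := R), ← map_sub]
  apply C.pl_zero
  simpa [sub_eq_zero] using hr

theorem pl_poly (C : Crv p q t K R) (φ : R →ₐ[K] K) (f : Polynomial K) (hf : f ≠ 0) :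
    (C.pl F φ).v (algebraMap R F (Polynomial.aeval C.z f)) = f.rootMultiplicity (φ C.z) := by
  classical
  rw [C.v_poly _ f hf, ← Polynomial.count_roots]
  induction f.roots using Multiset.induction_on with
  | empty => simp
  | cons r s ih =>
    rw [Multiset.map_cons, Multiset.sum_cons, ih, Multiset.count_cons]
    by_cases h : φ C.z = r
    · subst h
      rw [pl_zr]; simp; ring
    · rw [C.pl_zc φ r h]; simp [h]

theorem exists_phi0 (C : Crv p q t K R) : ∃ φ : R →ₐ[K] K, φ C.x = 0 ∧ φ C.y = 0 ∧ φ C.z = 0 := by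
  have := C.q2
  have := C.ht
  apply C.lift K 0 0 0
  · rw [zero_pow (by omega), zero_pow (by positivity)]; simp
  · rw [zero_pow (by omega), zero_pow (by omega)]; simp

theorem pl0_y (C : Crv p q t K R) (φ : R →ₐ[K] K) (hy : φ C.y = 0) (hz : φ C.z = 0) :
    (C.pl F φ).v (algebraMap R F C.y) = t := by
  have hq2 := C.q2
  have h4 : (2 : ℤ) ≤ (q : ℤ) ^ 2 := by
    have : (2 : ℤ) ≤ q := by exact_mod_cast hq2
    nlinarith
  have h1 := C.pl_pos (F := F) φ C.y C.y_ne hy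
  have h2 := C.pl_zr (F := F) φ
  rw [hz, map_zero, sub_zero] at h2
  have hy0 := ι_ne (F := F) C.y_ne
  have h3 := (Plc.add_of_lt (P := C.pl F φ) (a := - algebraMap R F C.y)
    (b := algebraMap R F C.y ^ (q ^ 2)) (neg_ne_zero.mpr hy0) (Or.inr (by
      rw [Plc.v_neg, Plc.v_pow]; push_cast; nlinarith))).2
  have e : - algebraMap R F C.y + algebraMap R F C.y ^ (q ^ 2) = algebraMap R F C.z ^ t := by
    rw [C.hzF]; ring
  rw [e, Plc.v_pow, h2, Plc.v_neg] at h3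
  omega

theorem pl0_x (C : Crv p q t K R) (φ : R →ₐ[K] K) (hx : φ C.x = 0) (hy : φ C.y = 0)
    (hz : φ C.z = 0) : (C.pl F φ).v (algebraMap R F C.x) = (q + 1) * t := by
  have hq2 : (2 : ℤ) ≤ q := by exact_mod_cast C.q2
  have h1 := C.pl_pos (F := F) φ C.x C.x_ne hx
  have hx0 := ι_ne (F := F) C.x_ne
  have h3 := (Plc.add_of_lt (P := C.pl F φ) (a := algebraMap R F C.x)
    (b := algebraMap R F C.x ^ q) hx0 (Or.inr (by
      rw [Plc.v_pow]; push_cast; nlinarith))).2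
  have e : algebraMap R F C.x + algebraMap R F C.x ^ q = algebraMap R F C.y ^ (q + 1) := by
    rw [C.hxF]; ring
  rw [e, Plc.v_pow, C.pl0_y φ hy hz] at h3
  rw [← h3]; push_cast; rfl

theorem pl_x_ne (C : Crv p q t K R) (φ0 φ : R →ₐ[K] K) (hx : φ0 C.x = 0) (hy : φ0 C.y = 0)
    (hz : φ0 C.z = 0) (h : φ ≠ φ0) : (C.pl F φ).v (algebraMap R F C.x) = 0 := by
  have := C.q2
  have := C.ht
  apply C.pl_zero
  intro h0
  have e1 := congrArg φ C.hx
  have e2 := congrArg φ C.hz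
  simp only [map_pow, map_add, map_sub] at e1 e2
  rw [h0, zero_pow (by omega), add_zero] at e1
  have e3 := (pow_eq_zero_iff (by omega)).mp e1
  rw [e3, zero_pow (by positivity), sub_zero] at e2
  have e4 := (pow_eq_zero_iff (by omega)).mp e2
  exact h (C.ext_hom _ _ (h0.trans hx.symm) (e3.trans hy.symm) (e4.trans hz.symm))

theorem div_h (C : Crv p q t K R) (φ0 : R →ₐ[K] K) (hz : φ0 C.z = 0) (h : R) (hh : h ≠ 0) (M : ℤ)
    (h1 : - M ≤ (C.vinf F).v (algebraMap R F h)) (h2 : M ≤ (C.pl F φ0).v (algebraMap R F h)) :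
    (C.vinf F).v (algebraMap R F h) = - M ∧ (C.pl F φ0).v (algebraMap R F h) = M ∧
      ∀ φ, φ ≠ φ0 → (C.pl F φ).v (algebraMap R F h) = 0 := by
  classical
  have := C.finite_S (F := F)
  have := Fintype.ofFinite (C.S F)
  obtain ⟨f, hf, e1, e2⟩ := C.norm_poly (F := F) h hh
  have hne : ∀ a : C.S F, a.1 (algebraMap R F h) ≠ 0 := fun a => by simpa using hh
  have nn : ∀ φ (a : C.S F), 0 ≤ (C.pl F φ).v (a.1 (algebraMap R F h)) := by
    intro φ a
    obtain ⟨r, hr⟩ := C.S_R a.2 h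
    rw [hr]; exact C.pl_nonneg φ r
  have key : ∀ φ, (f.rootMultiplicity (φ C.z) : ℤ) = (C.pl F φ).v (algebraMap R F h) +
      ∑ a ∈ Finset.univ.erase (1 : C.S F), (C.pl F φ).v (a.1 (algebraMap R F h)) := by
    intro φ
    rw [← C.pl_poly (F := F) φ f hf, e1, Plc.v_prod _ _ _ (fun a _ => hne a),
      ← Finset.add_sum_erase _ _ (Finset.mem_univ (1 : C.S F))]
    rfl
  have nns : ∀ φ, 0 ≤ ∑ a ∈ Finset.univ.erase (1 : C.S F), (C.pl F φ).v (a.1 (algebraMap R F h)) :=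
    fun φ => Finset.sum_nonneg fun a _ => nn φ a
  have k0 := key φ0
  rw [hz] at k0
  have n0 := nns φ0
  have hle : f.rootMultiplicity 0 ≤ f.natDegree := by
    rw [← Polynomial.count_roots]
    exact (Multiset.count_le_card _ _).trans (Polynomial.card_roots' f)
  have hsum : ∑ a ∈ Finset.univ.erase (1 : C.S F), (C.pl F φ0).v (a.1 (algebraMap R F h)) = 0 := by
    omega
  have hdeg : f.rootMultiplicity 0 = f.natDegree := by omega
  refine ⟨by omega, by omega, ?_⟩
  intro φ hφ
  by_cases hφz : φ C.z = 0
  · obtain ⟨a, ha, e⟩ := C.S_trans (F := F) φ0 φ (hz.trans hφz.symm)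
    rw [← e, Plc.inv_smul_v]
    refine (Finset.sum_eq_zero_iff_of_nonneg (fun a _ => nn φ0 a)).mp hsum ⟨a, ha⟩ ?_
    rw [Finset.mem_erase]
    refine ⟨?_, Finset.mem_univ _⟩
    intro h1
    have h1 : a = 1 := congrArg Subtype.val h1
    rw [h1, inv_one, one_smul] at e
    exact hφ (C.pl_inj e).symm
  · have k := key φ
    have := nns φ
    have := C.pl_nonneg (F := F) φ h
    have h0 : f.rootMultiplicity (φ C.z) = 0 := by
      by_contra hc
      have h3 : ({0, φ C.z} : Finset K).sum (fun r => f.roots.count r) ≤ f.roots.card := by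
        have := Multiset.toFinset_sum_count_eq f.roots
        rw [← this]
        apply Finset.sum_le_sum_of_ne_zero
        intro r _ hr
        exact Multiset.mem_toFinset.mpr (Multiset.count_ne_zero.mp hr)
      rw [Finset.sum_pair (Ne.symm hφz), Polynomial.count_roots, Polynomial.count_roots] at h3
      have := Polynomial.card_roots' f
      omega
    omega

theorem no_h (C : Crv p q t K R) (φ0 : R →ₐ[K] K) (hx : φ0 C.x = 0) (hy : φ0 C.y = 0)
    (hz : φ0 C.z = 0) (h : R) (hh : h ≠ 0) 
    (h1 : - MM q t ≤ (C.vinf F).v (algebraMap R F h)) :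
    (C.pl F φ0).v (algebraMap R F h) < MM q t := by
  by_contra h2
  push Not at h2
  obtain ⟨hinf, h0, hφ⟩ := C.div_h φ0 hz h hh (MM q t) h1 h2
  have hq2 := C.q2
  have ht := C.ht
  set N := q ^ 2 - q + 1 with hN
  have hNZ : (N : ℤ) = (q : ℤ) ^ 2 - q + 1 := by
    rw [hN]; push_cast [Nat.cast_sub (show q ≤ q ^ 2 by nlinarith)]; ring
  set d := Nat.gcd t N with hd
  have hdt : d ∣ t := Nat.gcd_dvd_left _ _
  have hd0 : 0 < d := Nat.gcd_pos_of_pos_left _ (by omega)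
  have hdne : d ≠ t := by
    intro h
    apply C.hnd
    rw [← h]
    exact Nat.gcd_dvd_right _ _
  have h2d : 2 * d ≤ t := by
    obtain ⟨k, hk⟩ := hdt
    rcases k with _ | _ | k
    · omega
    · omega
    · nlinarith
  have bez := Nat.gcd_eq_gcd_ab t N
  rw [← hd] at bez
  set a := Nat.gcdA t N
  set b := Nat.gcdB t N
  have hx0 := ι_ne (F := F) C.x_ne
  have hh0 := ι_ne (F := F) hh
  set g := algebraMap R F C.x ^ (q ^ 2 - 1) / algebraMap R F h with hg
  have hg0 : g ≠ 0 := div_ne_zero (pow_ne_zero _ hx0) hh0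
  set w := g ^ b * algebraMap R F C.x ^ a with hw
  have hw0 : w ≠ 0 := mul_ne_zero (zpow_ne_zero _ hg0) (zpow_ne_zero _ hx0)
  have hv : ∀ P : Plc K F, P.v w = b * (((q : ℤ) ^ 2 - 1) * P.v (algebraMap R F C.x) -
      P.v (algebraMap R F h)) + a * P.v (algebraMap R F C.x) := by
    intro P
    rw [hw, P.v_mul _ _ (zpow_ne_zero _ hg0) (zpow_ne_zero _ hx0), v_zpow, v_zpow, hg,
      P.v_div _ _ (pow_ne_zero _ hx0) hh0, P.v_pow]
    push_cast [Nat.cast_sub (show 1 ≤ q ^ 2 by nlinarith)]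
    ring
  have hvinf : (C.vinf F).v w = - (d * (q + 1)) := by
    rw [hv, vinf_x, hinf, bez, hNZ]; unfold MM; ring
  have hv0 : (C.pl F φ0).v w = d * (q + 1) := by
    rw [hv, C.pl0_x φ0 hx hy hz, h0, bez, hNZ]; unfold MM; ring
  obtain ⟨r, hr⟩ := C.mem_R w (by
    intro φ
    right
    by_cases e : φ = φ0
    · rw [e, hv0]; positivity
    · rw [hv, C.pl_x_ne φ0 φ hx hy hz e, hφ φ e]; simp)
  have hr0 : r ≠ 0 := by
    rintro rfl
    rw [map_zero] at hr
    exact hw0 hr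
  obtain ⟨⟨k, i, j⟩, -, -, -, -, -, -, e, -⟩ := C.lead_inf (F := F) r hr0
  rw [← hr, hvinf] at e
  have e' : d * (q + 1) = q ^ 3 * k + t * (q * i + (q + 1) * j) := by
    have : (wt q t (k, i, j) : ℤ) = d * (q + 1) := by omega
    unfold wt at this
    exact_mod_cast this.symm
  have hlt : d * (q + 1) < t * q := by nlinarith
  have hi : i = 0 := by
    by_contra hi
    have : 1 ≤ i := by omega
    have : t * q ≤ t * (q * i + (q + 1) * j) := Nat.mul_le_mul_left _ (by nlinarith)
    have := Nat.zero_le (q ^ 3 * k)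
    omega
  have hj : j = 0 := by
    by_contra hj
    have : 1 ≤ j := by omega
    have : t * q ≤ t * (q * i + (q + 1) * j) := Nat.mul_le_mul_left _ (by nlinarith)
    have := Nat.zero_le (q ^ 3 * k)
    omega
  subst hi hj
  have hqd : q ∣ d * (q + 1) := ⟨q ^ 2 * k, by rw [e']; ring⟩
  have hco : Nat.Coprime q (q + 1) := by simp
  have hqd' : q ∣ t := (hco.dvd_of_dvd_mul_right hqd).trans hdt
  have := Nat.Coprime.eq_one_of_dvd C.tq.symm hqd'
  omega

theorem orb_z (C : Crv p q t K R) (a : F ≃ₐ[K] F) (φ : R →ₐ[K] K) (ha : a • C.vinf F = C.pl F φ) :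
    φ C.z ≠ 0 := by
  intro h
  obtain ⟨φ0, hx, hy, hz⟩ := C.exists_phi0
  obtain ⟨s, hs, e⟩ := C.S_trans (F := F) φ φ0 (h.trans hz.symm)
  obtain ⟨r, hr, -, h1, h2⟩ := C.exists_f (s⁻¹ * a) φ0 (by rw [mul_smul, ha, e])
  have := C.no_h (F := F) φ0 hx hy hz r hr h1.ge
  omega

end Crv


set_option linter.unusedVariables false
set_option linter.unusedSectionVars false

namespace Crv

variable {p q t : ℕ} {K R F : Type} [Field K] [IsAlgClosed K] [CharP K p] [CommRing R]
  [Algebra K R] [IsDomain R] [Field F] [Algebra K F] [Algebra R F] [IsScalarTower K R F]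
  [IsFractionRing R F]

/-- bounded weight space -/
def Vm (C : Crv p q t K R) (m : ℕ) : Submodule K R :=
  Submodule.span K (C.mon '' {κ | κ ∈ red q ∧ wt q t κ < m + 1})

theorem Vm_fin (C : Crv p q t K R) (m : ℕ) : FiniteDimensional K (C.Vm m) := by
  apply FiniteDimensional.span_of_finite
  apply Set.Finite.image
  apply Set.Finite.subset (s := (Finset.range (m+1) ×ˢ Finset.range (q^2) ×ˢ Finset.range q : Finset (ℕ × ℕ × ℕ)))
  · exact Finset.finite_toSet _
  · rintro ⟨k, i, j⟩ ⟨⟨h1, h2⟩, h3⟩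
    simp only [wt] at *
    simp only [Finset.coe_product, Finset.coe_range, Set.mem_prod, Set.mem_Iio]
    refine ⟨?_, h1, h2⟩
    have : 1 ≤ q ^ 3 := Nat.one_le_pow _ _ (by have := C.q2; omega)
    nlinarith [Nat.zero_le (t * (q * i + (q + 1) * j))]

theorem mem_Vm (C : Crv p q t K R) (F : Type) [Field F] [Algebra K F] [Algebra R F]
    [IsScalarTower K R F] [IsFractionRing R F] (m : ℕ) (h : R) (hh : h ≠ 0)
    (hv : -(m : ℤ) ≤ (C.vinf F).v (algebraMap R F h)) : h ∈ C.Vm m := by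
  obtain ⟨κ, hκ, c, hc, h', hh', e, e2, -⟩ := C.lead_inf (F := F) h hh
  have hw : wt q t κ ≤ m := by rw [e2] at hv; omega
  rw [e, ← Algebra.smul_def]
  refine add_mem (Submodule.smul_mem _ _ (Submodule.subset_span ⟨κ, ⟨hκ, by omega⟩, rfl⟩)) ?_
  refine Submodule.span_mono (Set.image_mono ?_) hh'
  rintro κ' ⟨h1, h2⟩
  exact ⟨h1, by omega⟩

theorem Vm_v (C : Crv p q t K R) (F : Type) [Field F] [Algebra K F] [Algebra R F]
    [IsScalarTower K R F] [IsFractionRing R F] (m : ℕ) (h : R) (hh : h ∈ C.Vm m) :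
    (C.vinf F).ge (-(m : ℤ)) (algebraMap R F h) := by
  induction hh using Submodule.span_induction with
  | mem x hx =>
    obtain ⟨κ, ⟨h1, h2⟩, rfl⟩ := hx
    refine ((C.vinf F).ge_self _).mono ?_
    rw [C.vinf_mon]; omega
  | zero => rw [map_zero]; exact (C.vinf F).ge_zero _
  | add x y _ _ h1 h2 => rw [map_add]; exact h1.add h2
  | smul c x _ h1 => 
    rw [Algebra.smul_def, map_mul, ιK]
    exact h1.const_mul _

theorem fib_fin (C : Crv p q t K R) (F : Type) [Field F] [Algebra K F] [Algebra R F]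
    [IsScalarTower K R F] [IsFractionRing R F] (r : K) : {φ : R →ₐ[K] K | φ C.z = r}.Finite := by
  by_cases he : ∃ φ0 : R →ₐ[K] K, φ0 C.z = r
  swap
  · push Not at he
    convert Set.finite_empty
    ext φ; simpa using he φ
  obtain ⟨φ0, h0⟩ := he
  have := C.finite_S (F := F)
  have h1 : (Set.range (fun a : C.S F => (a : F ≃ₐ[K] F)⁻¹ • C.pl F φ0)).Finite := Set.finite_range _
  have h2 : (C.pl F '' {φ : R →ₐ[K] K | φ C.z = r}).Finite := by
    refine h1.subset ?_
    rintro _ ⟨φ, hφ, rfl⟩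
    obtain ⟨a, ha, e⟩ := C.S_trans (F := F) φ0 φ (by rw [h0]; exact hφ.symm)
    exact ⟨⟨a, ha⟩, e⟩
  exact h2.of_finite_image (fun _ _ _ _ h => C.pl_inj h)

theorem zeros_fin (C : Crv p q t K R) (F : Type) [Field F] [Algebra K F] [Algebra R F]
    [IsScalarTower K R F] [IsFractionRing R F] (d : R) (hd : d ≠ 0) :
    {φ : R →ₐ[K] K | φ d = 0}.Finite := by
  classical
  obtain ⟨f, hf, h', e⟩ := C.exists_norm F d hd
  have h1 : ((fun φ : R →ₐ[K] K => φ C.z) '' {φ : R →ₐ[K] K | φ d = 0}).Finite := by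
    refine (f.roots.toFinset.finite_toSet).subset ?_
    rintro _ ⟨φ, hφ, rfl⟩
    have := congrArg φ e
    rw [← Polynomial.aeval_algHom_apply, map_mul, show φ d = 0 from hφ, zero_mul] at this
    simpa [hf, Polynomial.IsRoot, Polynomial.aeval_def] using this
  refine Set.Finite.of_finite_fibers (fun φ : R →ₐ[K] K => φ C.z) h1 ?_
  intro r _
  refine (C.fib_fin F r).subset ?_
  rintro φ ⟨_, h⟩
  exact h

theorem orb_fin (C : Crv p q t K R) (F : Type) [Field F] [Algebra K F] [Algebra R F]
    [IsScalarTower K R F] [IsFractionRing R F] :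
    {φ : R →ₐ[K] K | ∃ a : F ≃ₐ[K] F, a • C.vinf F = C.pl F φ}.Finite := by
  classical
  obtain ⟨m, hm⟩ : ∃ m : ℕ, (m : ℤ) = MM q t := ⟨(MM q t).toNat, Int.toNat_of_nonneg C.MM_pos.le⟩
  have := C.Vm_fin m
  let b := Module.finBasis K (C.Vm m)
  let A : Matrix (Fin m) (Fin (Module.finrank K (C.Vm m))) R := 
    fun i j => PowerSeries.coeff i (C.tau (b j : R))
  have key : ∀ (φ : R →ₐ[K] K) v i, ((A.map φ).mulVec v) i =
      φ (PowerSeries.coeff i (C.tau ((∑ j, v j • b j : C.Vm m) : R))) := by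
    intro φ v i
    rw [Submodule.coe_sum, map_sum, map_sum, map_sum]
    simp only [Matrix.mulVec, dotProduct, Matrix.map_apply, A, Submodule.coe_smul, map_smul,
      PowerSeries.coeff_smul, smul_eq_mul]
    refine Finset.sum_congr rfl fun j _ => mul_comm _ _
  obtain ⟨φ0, hx, hy, hz⟩ := C.exists_phi0
  have inj : LinearMap.ker (Matrix.toLin' (A.map φ0)) = ⊥ := by
    rw [LinearMap.ker_eq_bot']
    intro v hv
    by_contra hne
    set r : C.Vm m := ∑ j, v j • b j with hr
    have hr0 : (r : R) ≠ 0 := by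
      intro h0
      have h1 : r = 0 := Subtype.ext h0
      apply hne
      have := congrArg b.repr h1
      rw [hr, map_zero] at this
      ext j
      have := DFunLike.congr_fun this j
      rwa [b.repr_sum_self] at this
    have h1 := C.pl_of_coeff (F := F) φ0 r m hr0 (fun i hi => by
      rw [hr, ← key φ0 v ⟨i, hi⟩]
      have := congrFun hv ⟨i, hi⟩
      rwa [Matrix.toLin'_apply] at this)
    have h2 := C.no_h (F := F) φ0 hx hy hz r hr0 (by
      rw [← hm]
      exact (C.Vm_v F m r r.2).v_le (ι_ne hr0))
    omega
  obtain ⟨g, hg⟩ := LinearMap.exists_leftInverse_of_injective _ inj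
  let B := LinearMap.toMatrix' g
  have hB : B * A.map φ0 = 1 := by
    have := congrArg LinearMap.toMatrix' hg
    rwa [LinearMap.toMatrix'_comp, LinearMap.toMatrix'_toLin', LinearMap.toMatrix'_id] at this
  let Δ : R := (B.map (algebraMap K R) * A).det
  have hΔ : ∀ φ : R →ₐ[K] K, φ Δ = (B * A.map φ).det := by
    intro φ
    have := RingHom.map_det (φ : R →+* K) (B.map (algebraMap K R) * A)
    refine this.trans ?_
    congr 1
    rw [RingHom.mapMatrix_apply, Matrix.map_mul]
    congr 1
    ext i j
    simp
  have hne : Δ ≠ 0 := by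
    intro h0
    have := hΔ φ0
    rw [h0, hB] at this
    simp at this
  refine (C.zeros_fin F Δ hne).subset ?_
  rintro φ ⟨a, ha⟩
  show φ Δ = 0
  obtain ⟨r, hr, -, h1, h2⟩ := C.exists_f a φ ha
  have hrV := C.mem_Vm F m r hr (by rw [hm, h1])
  rw [hΔ, ← Matrix.exists_mulVec_eq_zero_iff]
  refine ⟨b.repr ⟨r, hrV⟩, ?_, ?_⟩
  · intro h0
    have h3 : b.repr ⟨r, hrV⟩ = 0 := DFunLike.coe_injective h0
    rw [LinearEquiv.map_eq_zero_iff] at h3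
    exact hr (congrArg Subtype.val h3)
  · have h4 : (A.map φ).mulVec (b.repr ⟨r, hrV⟩) = 0 := by
      funext i
      rw [key φ, b.sum_repr]
      exact C.pl_coeff (F := F) φ r i (Or.inr (by rw [h2, ← hm]; exact_mod_cast i.2))
    rw [← Matrix.mulVec_mulVec, h4, Matrix.mulVec_zero]

end Crv


set_option linter.unusedVariables false
set_option linter.unusedSectionVars false

namespace Crv

variable {p q t : ℕ} {K R F : Type} [Field K] [IsAlgClosed K] [CharP K p] [CommRing R]
  [Algebra K R] [IsDomain R] [Field F] [Algebra K F] [Algebra R F] [IsScalarTower K R F]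
  [IsFractionRing R F]

theorem sum_zero_of_distinct (P : Plc K F) {ι : Type} (s : Finset ι) (f : ι → F)
    (hd : ∀ i ∈ s, ∀ j ∈ s, f i ≠ 0 → f j ≠ 0 → P.v (f i) = P.v (f j) → i = j)
    (h0 : ∑ i ∈ s, f i = 0) : ∀ i ∈ s, f i = 0 := by
  classical
  by_contra hne
  push Not at hne
  obtain ⟨i1, hi1, hf1⟩ := hne
  obtain ⟨i, hi, hmin⟩ := Finset.exists_min_image (s.filter (fun i => f i ≠ 0)) (fun i => P.v (f i))
    ⟨i1, by simp [hi1, hf1]⟩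
  rw [Finset.mem_filter] at hi
  rw [← Finset.add_sum_erase s f hi.1] at h0
  refine (Plc.add_of_lt (P := P) hi.2 ?_).1 h0
  apply Plc.ge_sum
  intro j hj
  rw [Finset.mem_erase] at hj
  by_cases hfj : f j = 0
  · rw [hfj]; exact Plc.ge_zero _
  right
  have h1 := hmin j (by simp [hj.2, hfj])
  have h2 : P.v (f i) ≠ P.v (f j) := fun h => hj.1 (hd i hi.1 j hj.2 hi.2 hfj h).symm
  omega

theorem indep (C : Crv p q t K R) (F : Type) [Field F] [Algebra K F] [Algebra R F]
    [IsScalarTower K R F] [IsFractionRing R F] {ι : Type} [Fintype ι] (e : ι → ℕ × ℕ) (he : Function.Injective e)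
    (h1 : ∀ i, (e i).1 < q ^ 2) (h2 : ∀ i, (e i).2 < q) (f : ι → Polynomial K)
    (h0 : ∑ i, Polynomial.aeval C.z (f i) * C.y ^ (e i).1 * C.x ^ (e i).2 = 0) : ∀ i, f i = 0 := by
  have key : ∀ i, f i ≠ 0 → (C.vinf F).v (algebraMap R F (Polynomial.aeval C.z (f i) * C.y ^ (e i).1 * C.x ^ (e i).2)) =
      - wt q t ((f i).natDegree, e i) := by
    intro i hi
    have hP : algebraMap R F (Polynomial.aeval C.z (f i)) ≠ 0 := by
      apply ι_ne
      intro h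
      exact hi (C.transc _ h)
    rw [mul_assoc, map_mul, Plc.v_mul _ _ _ hP, C.vinf_poly _ hi]
    · have := C.vinf_mon (F := F) (0, e i)
      simp only [mon, pow_zero, one_mul] at this
      rw [this]
      simp only [wt]; push_cast; ring
    · exact ι_ne (mul_ne_zero (pow_ne_zero _ C.y_ne) (pow_ne_zero _ C.x_ne))
  have h3 := sum_zero_of_distinct (C.vinf F) Finset.univ (fun i => algebraMap R F
    (Polynomial.aeval C.z (f i) * C.y ^ (e i).1 * C.x ^ (e i).2)) (by
      intro i _ j _ hi hj hv
      have hi' : f i ≠ 0 := fun h => hi (by simp [h])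
      have hj' : f j ≠ 0 := fun h => hj (by simp [h])
      rw [key i hi', key j hj'] at hv
      have := C.wt_inj (κ := ((f i).natDegree, e i)) (κ' := ((f j).natDegree, e j))
        ⟨h1 i, h2 i⟩ ⟨h1 j, h2 j⟩ (by omega)
      exact he (congrArg Prod.snd this)) (by rw [← map_sum, h0, map_zero])
  intro i
  by_contra hi
  have := h3 i (Finset.mem_univ _)
  have h4 : Polynomial.aeval C.z (f i) * C.y ^ (e i).1 * C.x ^ (e i).2 = 0 := by
    simpa only [map_eq_zero_iff _ (ιinj (R := R) (F := F))] using this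
  have hP : (Polynomial.aeval C.z (f i)) ≠ 0 := fun h => hi (C.transc _ h)
  exact mul_ne_zero (mul_ne_zero hP (pow_ne_zero _ C.y_ne)) (pow_ne_zero _ C.x_ne) h4

theorem stab_pl (C : Crv p q t K R) (a : F ≃ₐ[K] F) (ha : a • C.vinf F = C.vinf F) (r : R) :
    ∃ r', a (algebraMap R F r) = algebraMap R F r' := by
  apply C.mem_R
  intro φ
  right
  rcases C.inf_or_pl (a⁻¹ • C.pl F φ) with h | ⟨ψ, h⟩
  · exfalso
    apply C.pl_ne_inf (F := F) φ
    rw [← ha, ← h, smul_inv_smul]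
  · rw [← Plc.inv_smul_v, h]
    exact C.pl_nonneg ψ r

theorem stab_v (C : Crv p q t K R) (a : F ≃ₐ[K] F) (ha : a • C.vinf F = C.vinf F) (u : F) :
    (C.vinf F).v (a u) = (C.vinf F).v u := by
  rw [← Plc.smul_v_apply (P := C.vinf F) a u, ha]

theorem stab_y (C : Crv p q t K R) (a : F ≃ₐ[K] F) (ha : a • C.vinf F = C.vinf F) :
    ∃ α : K, α ≠ 0 ∧ ∃ P : Polynomial K, a (algebraMap R F C.y) =
      algebraMap R F (algebraMap K R α * C.y + Polynomial.aeval C.z P) := by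
  have hq := C.q2
  have ht := C.ht
  obtain ⟨r, hr⟩ := C.stab_pl a ha C.y
  have hr0 : r ≠ 0 := by
    rintro rfl
    rw [map_zero, map_eq_zero_iff _ a.injective] at hr
    exact ι_ne C.y_ne hr
  obtain ⟨κ, hκ, c, hc, h', hh', e, e2, -⟩ := C.lead_inf (F := F) r hr0
  rw [← hr, C.stab_v a ha, C.vinf_y] at e2
  have hw : κ = (0, 1, 0) := C.wt_inj hκ ⟨by show 1 < q ^ 2; nlinarith, by show 0 < q; omega⟩ (by
    have : (wt q t κ : ℤ) = (wt q t (0,1,0) : ℕ) := by rw [← neg_inj, ← e2]; simp [wt]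
    exact_mod_cast this)
  subst hw
  refine ⟨c, hc, ?_⟩
  suffices ∃ P : Polynomial K, h' = Polynomial.aeval C.z P by
    obtain ⟨P, hP⟩ := this
    exact ⟨P, by rw [hr, e, hP]; simp [mon]⟩
  clear e hr
  induction hh' using Submodule.span_induction with
  | mem u hu =>
    obtain ⟨⟨k, i, j⟩, ⟨h1, h2⟩, rfl⟩ := hu
    simp only [wt] at h2
    have h3 : t * (q * i + (q + 1) * j) < t * q := by
      have : q ^ 3 * 0 + t * (q * 1 + (q + 1) * 0) = t * q := by ring
      have := Nat.zero_le (q ^ 3 * k)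
      omega
    have h4 := Nat.lt_of_mul_lt_mul_left h3
    have hj : j = 0 := by
      rcases Nat.eq_zero_or_pos j with h | h
      · exact h
      · nlinarith [Nat.zero_le (q * i)]
    have hi : i = 0 := by
      rcases Nat.eq_zero_or_pos i with h | h
      · exact h
      · nlinarith [Nat.zero_le ((q + 1) * j)]
    exact ⟨Polynomial.X ^ k, by simp [mon, hi, hj]⟩
  | zero => exact ⟨0, by simp⟩
  | add x y _ _ h1 h2 =>
    obtain ⟨P, rfl⟩ := h1
    obtain ⟨Q, rfl⟩ := h2
    exact ⟨P + Q, by simp⟩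
  | smul c x _ h1 =>
    obtain ⟨P, rfl⟩ := h1
    exact ⟨c • P, by simp⟩

theorem stab_x (C : Crv p q t K R) (a : F ≃ₐ[K] F) (ha : a • C.vinf F = C.vinf F) :
    ∃ α : K, ∃ B P : Polynomial K, a (algebraMap R F C.x) =
      algebraMap R F (algebraMap K R α * C.x + Polynomial.aeval C.z B * C.y + Polynomial.aeval C.z P) := by
  have hq := C.q2
  have ht := C.ht
  obtain ⟨r, hr⟩ := C.stab_pl a ha C.x
  have hr0 : r ≠ 0 := by
    rintro rfl
    rw [map_zero, map_eq_zero_iff _ a.injective] at hr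
    exact ι_ne C.x_ne hr
  obtain ⟨κ, hκ, c, hc, h', hh', e, e2, -⟩ := C.lead_inf (F := F) r hr0
  rw [← hr, C.stab_v a ha, C.vinf_x] at e2
  have hw : κ = (0, 0, 1) := C.wt_inj hκ ⟨by show 0 < q ^ 2; positivity, by show 1 < q; omega⟩ (by
    have : (wt q t κ : ℤ) = (wt q t (0,0,1) : ℕ) := by rw [← neg_inj, ← e2]; simp [wt]
    exact_mod_cast this)
  subst hw
  refine ⟨c, ?_⟩
  suffices ∃ B P : Polynomial K, h' = Polynomial.aeval C.z B * C.y + Polynomial.aeval C.z P by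
    obtain ⟨B, P, hP⟩ := this
    exact ⟨B, P, by rw [hr, e, hP]; simp [mon, add_assoc]⟩
  clear e hr
  induction hh' using Submodule.span_induction with
  | mem u hu =>
    obtain ⟨⟨k, i, j⟩, ⟨h1, h2⟩, rfl⟩ := hu
    simp only [wt] at h2
    have h3 : t * (q * i + (q + 1) * j) < t * (q + 1) := by
      have : q ^ 3 * 0 + t * (q * 0 + (q + 1) * 1) = t * (q + 1) := by ring
      have := Nat.zero_le (q ^ 3 * k)
      omega
    have h4 := Nat.lt_of_mul_lt_mul_left h3
    have hj : j = 0 := by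
      rcases Nat.eq_zero_or_pos j with h | h
      · exact h
      · nlinarith [Nat.zero_le (q * i)]
    have hi : i = 0 ∨ i = 1 := by
      rcases Nat.lt_or_ge i 2 with h | h
      · omega
      · nlinarith [Nat.zero_le ((q + 1) * j)]
    rcases hi with hi | hi
    · exact ⟨0, Polynomial.X ^ k, by simp [mon, hi, hj]⟩
    · exact ⟨Polynomial.X ^ k, 0, by simp [mon, hi, hj]⟩
  | zero => exact ⟨0, 0, by simp⟩
  | add x y _ _ h1 h2 =>
    obtain ⟨B, P, rfl⟩ := h1
    obtain ⟨B', Q, rfl⟩ := h2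
    exact ⟨B + B', P + Q, by simp; ring⟩
  | smul c x _ h1 =>
    obtain ⟨B, P, rfl⟩ := h1
    exact ⟨c • B, c • P, by simp [smul_add]⟩

end Crv


set_option linter.unusedVariables false
set_option linter.unusedSectionVars false

namespace Crv

variable {p q t : ℕ} {K R F : Type} [Field K] [IsAlgClosed K] [CharP K p] [CommRing R]
  [Algebra K R] [IsDomain R] [Field F] [Algebra K F] [Algebra R F] [IsScalarTower K R F]
  [IsFractionRing R F]

theorem stab (C : Crv p q t K R) (a : F ≃ₐ[K] F) (ha : a • C.vinf F = C.vinf F) :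
    ∃ c β γ, C.trip c β γ ∧ C.isA a c β γ := by
  have hq := C.q2
  have ht := C.ht
  have hq2 := C.lt_q2
  have h4 : 2 ≤ q ^ 2 := by omega
  obtain ⟨α, hα, P, hy⟩ := C.stab_y a ha
  obtain ⟨α', B, Q, hx⟩ := C.stab_x a ha
  have hKR : Function.Injective (algebraMap K R) := (algebraMap K R).injective
  -- the relation
  have rel : (algebraMap K R α * C.y + Polynomial.aeval C.z P) ^ (q + 1) =
      (algebraMap K R α' * C.x + Polynomial.aeval C.z B * C.y + Polynomial.aeval C.z Q) ^ q +
      (algebraMap K R α' * C.x + Polynomial.aeval C.z B * C.y + Polynomial.aeval C.z Q) := by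
    apply ιinj (F := F)
    have := congrArg a C.hxF
    simp only [map_pow, map_add] at this
    rw [hy, hx] at this
    rw [map_pow, this, map_add _ (_ ^ q), map_pow]
  rw [pow_succ, C.frob, C.frob, C.frob, mul_pow, mul_pow, mul_pow] at rel
  have hxq : C.x ^ q = C.y ^ (q + 1) - C.x := by rw [C.hx]; ring
  rw [hxq] at rel
  let e : Fin 5 → ℕ × ℕ := ![(q + 1, 0), (0, 1), (q, 0), (1, 0), (0, 0)]
  have he : Function.Injective e := by
    intro i j h
    fin_cases i <;> fin_cases j <;> simp [e] at h ⊢ <;> omega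
  have h1 : ∀ i, (e i).1 < q ^ 2 := by
    intro i; fin_cases i <;> simp [e] <;> omega
  have h2 : ∀ i, (e i).2 < q := by
    intro i; fin_cases i <;> simp [e] <;> omega
  let f : Fin 5 → Polynomial K := ![Polynomial.C (α ^ (q + 1)) - Polynomial.C (α' ^ q),
    Polynomial.C (α' ^ q) - Polynomial.C α', Polynomial.C (α ^ q) * P - B ^ q,
    Polynomial.C α * P ^ q - B, P ^ (q + 1) - Q ^ q - Q]
  have ind := C.indep F e he h1 h2 f (by
    rw [Fin.sum_univ_five]
    simp [e, f]
    linear_combination rel)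
  have i0 := ind 0
  have i1 := ind 1
  have i2 := ind 2
  have i3 := ind 3
  have i4 := ind 4
  simp only [f, Matrix.cons_val] at i0 i1 i2 i3 i4
  clear ind rel
  have i0 : α ^ (q + 1) = α' ^ q := Polynomial.C_injective (sub_eq_zero.mp i0)
  have i1 : α' ^ q = α' := Polynomial.C_injective (sub_eq_zero.mp i1)
  have i3 : B = Polynomial.C α * P ^ q := (sub_eq_zero.mp i3).symm
  have hαα : α' = α ^ (q + 1) := by rw [i0, i1]
  have hα2 : α ^ (q ^ 2) = α := by
    rw [hαα] at i1
    have : α ^ q * α ^ (q ^ 2) = α ^ q * α := by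
      rw [← pow_succ, ← i1]; ring
    exact mul_left_cancel₀ (pow_ne_zero _ hα) this
  have hP : P ^ (q ^ 2) = P := by
    rw [i3, sub_eq_zero, mul_pow, ← Polynomial.C_pow] at i2
    have := mul_left_cancel₀ (by simpa using pow_ne_zero _ hα) i2
    rw [sq, pow_mul, ← this]
  obtain ⟨β, hβ⟩ := C.const_of_B (F := F) (algebraMap R F (Polynomial.aeval C.z P)) (by
    rw [← map_pow, ← map_pow, hP])
  have hβR : Polynomial.aeval C.z P = algebraMap K R β := by
    apply ιinj (F := F); rw [← hβ, ιK]
  have hβ2 : β ^ (q ^ 2) = β := by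
    apply hKR; rw [map_pow, ← hβR, ← map_pow, hP]
  have i5 : Polynomial.aeval C.z Q ^ q + Polynomial.aeval C.z Q = algebraMap K R (β ^ (q + 1)) := by
    have := congrArg (Polynomial.aeval C.z) i4
    simp only [map_sub, map_pow, map_zero, hβR] at this
    rw [map_pow]
    linear_combination - this
  obtain ⟨γ, hγ⟩ := C.const_of_G (F := F) (algebraMap R F (Polynomial.aeval C.z Q)) (β ^ (q + 1)) (by
    rw [← map_pow, ← map_add, i5, ιK])
  have hγR : Polynomial.aeval C.z Q = algebraMap K R γ := by
    apply ιinj (F := F); rw [← hγ, ιK]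
  have hγ2 : γ ^ q + γ = β ^ (q + 1) := by
    apply hKR; rw [← i5, hγR, map_add, map_pow]
  -- z
  have hz := congrArg a C.hzF
  simp only [map_pow, map_sub] at hz
  rw [hy, hβR, ← map_pow (algebraMap R F), ← map_sub (algebraMap R F), C.frob_pow, mul_pow, ← map_pow (algebraMap K R), ← map_pow (algebraMap K R), hα2, hβ2] at hz
  have hz2 : (a (algebraMap R F C.z)) ^ t = algebraMap K F α * (algebraMap R F C.z) ^ t := by
    rw [hz, ← map_pow (algebraMap R F), C.hz, ← ιK (R := R), ← map_mul]
    congr 1; ring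
  have hzne : algebraMap R F C.z ≠ 0 := ι_ne C.z_ne
  obtain ⟨c, hc⟩ : ∃ c : K, algebraMap K F c = a (algebraMap R F C.z) / algebraMap R F C.z := by
    refine isInt_of_root _ (Polynomial.X ^ t - Polynomial.C α) (Polynomial.X_pow_sub_C_ne_zero (by omega) _) ?_
    simp only [map_sub, map_pow, Polynomial.aeval_X, Polynomial.aeval_C]
    rw [div_pow, hz2, mul_div_assoc, div_self (pow_ne_zero _ hzne)]; simp
  have hct : c ^ t = α := by
    apply (algebraMap K F).injective
    rw [map_pow, hc, div_pow, hz2, mul_div_assoc, div_self (pow_ne_zero _ hzne)]; simp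
  refine ⟨c, β, γ, ⟨?_, hβ2, hγ2⟩, ?_, ?_, ?_⟩
  · rw [pow_mul, hct]
    apply mul_left_cancel₀ hα
    rw [← pow_succ', Nat.sub_add_cancel (by omega), hα2, mul_one]
  · rw [map_mul, ιK, hc, div_mul_cancel₀ _ hzne]
  · rw [hy, hβR, hct]
  · rw [hx, i3, hγR, hct, hαα]
    simp [hβR]

end Crv


set_option linter.unusedVariables false
set_option linter.unusedSectionVars false

namespace Crv

variable {p q t : ℕ} {K R F : Type} [Field K] [IsAlgClosed K] [CharP K p] [CommRing R]
  [Algebra K R] [IsDomain R] [Field F] [Algebra K F] [Algebra R F] [IsScalarTower K R F]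
  [IsFractionRing R F]

theorem stab_z (C : Crv p q t K R) (a : F ≃ₐ[K] F) (ha : a • C.vinf F = C.vinf F) :
    ∃ c : K, c ≠ 0 ∧ a (algebraMap R F C.z) = algebraMap K F c * algebraMap R F C.z := by
  obtain ⟨c, β, γ, h1, h2⟩ := C.stab a ha
  exact ⟨c, (C.trip_c h1).1, by rw [h2.1, map_mul, ιK]⟩

theorem Om_fin (C : Crv p q t K R) : (MulAction.orbit (F ≃ₐ[K] F) (C.vinf F)).Finite := by
  refine (((C.orb_fin F).image (C.pl F)).insert (C.vinf F)).subset ?_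
  rintro _ ⟨a, rfl⟩
  simp only
  rcases C.inf_or_pl (a • C.vinf F) with h | ⟨φ, h⟩
  · rw [h]; exact Set.mem_insert _ _
  · exact Set.mem_insert_of_mem _ ⟨φ, ⟨a, h⟩, h.symm⟩

theorem exists_U (C : Crv p q t K R) (F : Type) [Field F] [Algebra K F] [Algebra R F]
    [IsScalarTower K R F] [IsFractionRing R F] : ∃ U : F, U ≠ 0 ∧
    (∀ b : F ≃ₐ[K] F, ∃ c : K, c ≠ 0 ∧ b U = algebraMap K F c * U) ∧
    (C.vinf F).v U = -(q : ℤ) ^ 3 ∧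
    (∀ φ, C.pl F φ ∉ MulAction.orbit (F ≃ₐ[K] F) (C.vinf F) → 0 ≤ (C.pl F φ).v U) := by
  classical
  set Ω := (C.Om_fin (F := F)).toFinset with hΩ
  have mem : ∀ P, P ∈ Ω ↔ ∃ a : F ≃ₐ[K] F, a • C.vinf F = P := by
    intro P; rw [hΩ, Set.Finite.mem_toFinset]; rfl
  have hch : ∀ P, ∃ a : F ≃ₐ[K] F, P ∈ Ω → a • C.vinf F = P := by
    intro P
    by_cases h : P ∈ Ω
    · obtain ⟨a, ha⟩ := (mem P).1 h
      exact ⟨a, fun _ => ha⟩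
    · exact ⟨1, fun h' => absurd h' h⟩
  choose g hg using hch
  have hz0 : ∀ a : F ≃ₐ[K] F, a (algebraMap R F C.z) ≠ 0 := by
    intro a h
    rw [map_eq_zero_iff _ a.injective] at h
    exact ι_ne C.z_ne h
  have hinf : C.vinf F ∈ Ω := (mem _).2 ⟨1, one_smul _ _⟩
  refine ⟨∏ P ∈ Ω, g P (algebraMap R F C.z), Finset.prod_ne_zero_iff.mpr fun P _ => hz0 _, ?_, ?_, ?_⟩
  · intro b
    have hb : ∀ P, P ∈ Ω → b • P ∈ Ω := by
      intro P hP
      obtain ⟨a, rfl⟩ := (mem P).1 hP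
      exact (mem _).2 ⟨b * a, mul_smul _ _ _⟩
    have hcc : ∀ P, ∃ c : K, P ∈ Ω → c ≠ 0 ∧ b (g P (algebraMap R F C.z)) =
        algebraMap K F c * g (b • P) (algebraMap R F C.z) := by
      intro P
      by_cases hP : P ∈ Ω
      swap
      · exact ⟨1, fun h => absurd h hP⟩
      obtain ⟨c, hc, e⟩ := C.stab_z ((g (b • P))⁻¹ * (b * g P)) (by
        rw [mul_smul, mul_smul, hg P hP, inv_smul_eq_iff, hg _ (hb P hP)])
      refine ⟨c, fun _ => ⟨hc, ?_⟩⟩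
      have := congrArg (g (b • P)) e
      rw [map_mul, AlgEquiv.commutes, ← AlgEquiv.mul_apply, mul_inv_cancel_left, AlgEquiv.mul_apply] at this
      exact this
    choose c hc using hcc
    refine ⟨∏ P ∈ Ω, c P, Finset.prod_ne_zero_iff.mpr fun P hP => (hc P hP).1, ?_⟩
    rw [map_prod, map_prod]
    rw [Finset.prod_congr rfl (fun P hP => (hc P hP).2), Finset.prod_mul_distrib]
    congr 1
    refine Finset.prod_bij (fun P _ => b • P) hb ?_ ?_ (fun _ _ => rfl)
    · intro P _ P' _ h
      exact smul_left_cancel b h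
    · intro P hP
      refine ⟨b⁻¹ • P, ?_, smul_inv_smul _ _⟩
      obtain ⟨a, rfl⟩ := (mem P).1 hP
      exact (mem _).2 ⟨b⁻¹ * a, mul_smul _ _ _⟩
  · rw [Plc.v_prod _ _ _ (fun P _ => hz0 _), Finset.sum_eq_single (C.vinf F)]
    · rw [C.stab_v _ (hg _ hinf), C.vinf_z]
    · intro P hP hne
      rw [← Plc.inv_smul_v]
      rcases C.inf_or_pl ((g P)⁻¹ • C.vinf F) with h | ⟨φ, h⟩
      · exfalso
        apply hne
        rw [inv_smul_eq_iff, hg P hP] at h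
        exact h.symm
      · have := C.orb_z _ φ h
        rw [h, C.pl_zero φ C.z this]
    · exact fun h => absurd hinf h
  · intro φ hφ
    rw [Plc.v_prod _ _ _ (fun P _ => hz0 _)]
    apply Finset.sum_nonneg
    intro P hP
    rw [← Plc.inv_smul_v]
    rcases C.inf_or_pl ((g P)⁻¹ • C.pl F φ) with h | ⟨ψ, h⟩
    · exfalso
      apply hφ
      rw [inv_smul_eq_iff] at h
      exact ⟨g P, h.symm⟩
    · rw [h]; exact C.pl_nonneg _ _

theorem U_S (C : Crv p q t K R) (U : F) (hU : U ≠ 0)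
    (hb : ∀ b : F ≃ₐ[K] F, ∃ c : K, c ≠ 0 ∧ b U = algebraMap K F c * U) (s : F ≃ₐ[K] F)
    (hs : s ∈ C.S F) : s U = U := by
  obtain ⟨c, -, e⟩ := hb s
  have h1 : ∀ n : ℕ, (s ^ n) U = algebraMap K F (c ^ n) * U := by
    intro n
    induction n with
    | zero => simp
    | succ n ih =>
      rw [pow_succ', AlgEquiv.mul_apply, ih, map_mul, AlgEquiv.commutes, e, pow_succ, map_mul]; ring
  have h2 : s ^ (q ^ 3) = 1 := by
    have := pow_card_eq_one' (x := (⟨s, hs⟩ : C.S F))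
    rw [C.card_S] at this
    exact congrArg Subtype.val this
  have h3 := h1 (q ^ 3)
  rw [h2, AlgEquiv.one_apply] at h3
  have h4 : c ^ (q ^ 3) = 1 := by
    apply (algebraMap K F).injective
    rw [map_one]
    exact (mul_right_cancel₀ hU (by rw [one_mul]; exact h3)).symm
  have h5 : c - 1 = 0 := by
    have := C.frob_sub_pow c 1 3
    rw [h4, one_pow, sub_self] at this
    exact pow_eq_zero_iff (by have := C.q2; positivity) |>.mp this
  rw [e, sub_eq_zero.mp h5]; simp

end Crv


set_option linter.unusedVariables false
set_option linter.unusedSectionVars false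

namespace Crv

variable {p q t : ℕ} {K R F : Type} [Field K] [IsAlgClosed K] [CharP K p] [CommRing R]
  [Algebra K R] [IsDomain R] [Field F] [Algebra K F] [Algebra R F] [IsScalarTower K R F]
  [IsFractionRing R F]

theorem aut_stab (C : Crv p q t K R) (a0 : F ≃ₐ[K] F) : a0 • C.vinf F = C.vinf F := by
  classical
  by_contra hne
  obtain ⟨φ1, hφ1⟩ : ∃ φ, a0 • C.vinf F = C.pl F φ := (C.inf_or_pl _).resolve_left hne
  obtain ⟨U, hU, hb, hUinf, hUaff⟩ := C.exists_U F
  have hUS := C.U_S U hU hb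
  have h3 := C.q3pos
  have hM := C.MM_pos
  -- values
  let Z : Finset K := ((C.orb_fin F).image (fun φ => φ C.z)).toFinset
  have hZ : ∀ ζ, ζ ∈ Z ↔ ∃ φ : R →ₐ[K] K, (∃ a : F ≃ₐ[K] F, a • C.vinf F = C.pl F φ) ∧ φ C.z = ζ := by
    intro ζ; simp [Z]
  have hl : 0 < Z.card := Finset.card_pos.mpr ⟨φ1 C.z, (hZ _).2 ⟨φ1, ⟨a0, hφ1⟩, rfl⟩⟩
  let ψ : Polynomial K := ∏ ζ ∈ Z, (Polynomial.X - Polynomial.C ζ)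
  have hψ : ψ ≠ 0 := (Polynomial.monic_prod_of_monic _ _ (fun ζ _ => Polynomial.monic_X_sub_C ζ)).ne_zero
  have hψd : ψ.natDegree = Z.card := by
    rw [Polynomial.natDegree_prod_of_monic _ _ (fun ζ _ => Polynomial.monic_X_sub_C ζ)]
    simp
  have hψr : ∀ ζ ∈ Z, 1 ≤ ψ.rootMultiplicity ζ := by
    intro ζ hζ
    apply (Polynomial.rootMultiplicity_pos hψ).2
    rw [Polynomial.IsRoot, Polynomial.eval_prod]
    exact Finset.prod_eq_zero hζ (by simp)
  set w : F := algebraMap R F (Polynomial.aeval C.z ψ) with hw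
  have hpoly : ∀ f : Polynomial K, f ≠ 0 → algebraMap R F (Polynomial.aeval C.z f) ≠ 0 :=
    fun f hf => ι_ne (fun h => hf (C.transc _ h))
  have hw0 : w ≠ 0 := hpoly ψ hψ
  have hwv : ∀ φ : R →ₐ[K] K, (C.pl F φ).v w = ψ.rootMultiplicity (φ C.z) := fun φ => C.pl_poly φ ψ hψ
  have hwinf : (C.vinf F).v w = -(q : ℤ) ^ 3 * Z.card := by
    rw [hw, C.vinf_poly ψ hψ, hψd]
  have hwq : w ^ (q ^ 3) ≠ 0 := pow_ne_zero _ hw0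
  -- valuation of U on the orbit
  have hUorb : ∀ (a : F ≃ₐ[K] F) (φ : R →ₐ[K] K), a • C.vinf F = C.pl F φ → (C.pl F φ).v U = -(q : ℤ) ^ 3 := by
    intro a φ h
    obtain ⟨c, hc, e⟩ := hb a
    have := Plc.smul_v_apply a (C.vinf F) U
    rwa [h, e, Plc.v_const_mul _ _ hc, hUinf] at this
  -- N
  obtain ⟨r, hr⟩ := C.mem_R (U * w ^ (q ^ 3)) (by
    intro φ
    right
    rw [Plc.v_mul _ _ _ hU hwq, Plc.v_pow, hwv]
    by_cases h : C.pl F φ ∈ MulAction.orbit (F ≃ₐ[K] F) (C.vinf F)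
    · obtain ⟨a, ha⟩ := h
      rw [hUorb a φ ha]
      have h1 : (1 : ℤ) ≤ ψ.rootMultiplicity (φ C.z) := by
        exact_mod_cast hψr _ ((hZ _).2 ⟨φ, ⟨a, ha⟩, rfl⟩)
      push_cast
      nlinarith
    · have := hUaff φ h
      positivity)
  obtain ⟨N, hN⟩ := C.inv_poly (F := F) r (by
    intro s hs
    have hsz : s (algebraMap R F C.z) = algebraMap R F C.z := hs
    have hsw : s w = w := by
      rw [hw, ← Polynomial.aeval_algebraMap_apply]
      rw [← AlgEquiv.coe_algHom, ← Polynomial.aeval_algHom_apply, AlgEquiv.coe_algHom, hsz]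
    rw [← hr, map_mul, map_pow, hUS s hs, hsw])
  rw [hN] at hr
  have hN0 : N ≠ 0 := by
    rintro rfl
    rw [map_zero, map_zero] at hr
    exact mul_ne_zero hU hwq hr
  have hNd : N.natDegree = Z.card * q ^ 3 + 1 := by
    have h := C.vinf_poly (F := F) N hN0
    rw [← hr, Plc.v_mul _ _ _ hU hwq, Plc.v_pow, hUinf, hwinf] at h
    have : (q : ℤ) ^ 3 * (N.natDegree : ℤ) = (q : ℤ) ^ 3 * ((Z.card * q ^ 3 + 1 : ℕ) : ℤ) := by
      push_cast at h ⊢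
      linarith
    exact_mod_cast mul_left_cancel₀ h3.ne' this
  -- derivative
  set N' := Polynomial.derivative N with hN'
  have hc : N'.coeff (Z.card * q ^ 3) ≠ 0 := by
    rw [hN', Polynomial.coeff_derivative, ← hNd]
    refine mul_ne_zero (Polynomial.leadingCoeff_ne_zero.mpr hN0) ?_
    push_cast
    rw [C.qK]
    have := C.q2
    simp
  have hN'0 : N' ≠ 0 := by
    intro h; rw [h] at hc; simp at hc
  have hN'd : N'.natDegree = Z.card * q ^ 3 := by
    apply le_antisymm
    · have := Polynomial.natDegree_derivative_le N
      rw [hNd, Nat.add_sub_cancel] at this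
      exact this
    · exact Polynomial.le_natDegree_of_ne_zero hc
  have hDpoly : ∀ f : Polynomial K, C.D F (algebraMap R F (Polynomial.aeval C.z f)) =
      algebraMap R F (Polynomial.aeval C.z (Polynomial.derivative f)) := by
    intro f
    rw [← Polynomial.aeval_algebraMap_apply, Derivation.map_aeval, C.D_z, ← Polynomial.aeval_algebraMap_apply]
    simp
  have hDU : C.D F U * w ^ (q ^ 3) = algebraMap R F (Polynomial.aeval C.z N') := by
    rw [hN', ← hDpoly, ← hr, Derivation.leibniz, Derivation.leibniz_pow]
    have : ((q ^ 3 : ℕ) : F) = 0 := by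
      push_cast; rw [C.qF]; simp
    simp only [nsmul_eq_mul, this, smul_eq_mul]
    ring
  have hDU0 : C.D F U ≠ 0 := by
    intro h
    rw [h, zero_mul] at hDU
    exact hpoly N' hN'0 hDU.symm
  have hDUinf : (C.vinf F).v (C.D F U) = 0 := by
    have h := C.vinf_poly (F := F) N' hN'0
    rw [← hDU, Plc.v_mul _ _ _ hDU0 hwq, Plc.v_pow, hwinf, hN'd] at h
    push_cast at h
    linarith
  have hmult : ∀ ζ ∈ Z, (MM q t).toNat + q ^ 3 ≤ N'.rootMultiplicity ζ := by
    intro ζ hζ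
    obtain ⟨φ, ⟨a, ha⟩, rfl⟩ := (hZ ζ).1 hζ
    obtain ⟨f, hf0, hf, -, hfv⟩ := C.exists_f a φ ha
    obtain ⟨c, hc, e⟩ := hb a
    have h1 := C.D_aut a U
    rw [e, ← hf, ← Algebra.smul_def, Derivation.map_smul, Algebra.smul_def] at h1
    have h2 := congrArg (C.pl F φ).v h1
    have haD : a (C.D F U) ≠ 0 := by
      intro h; rw [map_eq_zero_iff _ a.injective] at h; exact hDU0 h
    rw [Plc.v_const_mul _ _ hc, Plc.v_mul _ _ _ (ι_ne hf0) haD, hfv] at h2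
    have h4 := Plc.smul_v_apply a (C.vinf F) (C.D F U)
    rw [ha, hDUinf] at h4
    rw [h4, add_zero] at h2
    have h5 := C.pl_poly (F := F) φ N' hN'0
    rw [← hDU, Plc.v_mul _ _ _ hDU0 hwq, Plc.v_pow, hwv, h2] at h5
    have h6 : (1 : ℤ) ≤ ψ.rootMultiplicity (φ C.z) := by exact_mod_cast hψr _ hζ
    zify
    rw [Int.toNat_of_nonneg hM.le, ← h5]
    push_cast
    nlinarith
  have hsum : ∑ ζ ∈ Z, N'.rootMultiplicity ζ ≤ N'.natDegree := by
    calc ∑ ζ ∈ Z, N'.rootMultiplicity ζ = ∑ ζ ∈ Z, N'.roots.count ζ := by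
          simp [Polynomial.count_roots]
      _ ≤ ∑ ζ ∈ N'.roots.toFinset, N'.roots.count ζ := by
          apply Finset.sum_le_sum_of_subset
          intro ζ hζ
          have := hmult ζ hζ
          rw [Multiset.mem_toFinset, ← Multiset.count_pos, Polynomial.count_roots]
          omega
      _ = N'.roots.card := Multiset.toFinset_sum_count_eq _
      _ ≤ N'.natDegree := Polynomial.card_roots' _
  have hsum2 := Finset.card_nsmul_le_sum Z _ _ hmult
  rw [hN'd] at hsum
  have h7 : Z.card * ((MM q t).toNat + q ^ 3) ≤ Z.card * q ^ 3 := by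
    simpa using hsum2.trans hsum
  have h8 := Nat.le_of_mul_le_mul_left h7 hl
  omega

theorem aut_trip (C : Crv p q t K R) (a : F ≃ₐ[K] F) : ∃ c β γ, C.trip c β γ ∧ C.isA a c β γ :=
  C.stab a (C.aut_stab a)

end Crv


set_option linter.unusedVariables false
set_option linter.unusedSectionVars false

namespace Crv

variable {p q t : ℕ} {K R F : Type} [Field K] [IsAlgClosed K] [CharP K p] [CommRing R]
  [Algebra K R] [IsDomain R] [Field F] [Algebra K F] [Algebra R F] [IsScalarTower K R F]
  [IsFractionRing R F]

theorem isA_one (C : Crv p q t K R) : C.isA (1 : F ≃ₐ[K] F) 1 0 0 := by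
  have := C.q2
  simp [isA, show q ≠ 0 by omega]

theorem isA_mul (C : Crv p q t K R) {a b : F ≃ₐ[K] F} {c d : K} (ha : C.isA a c 0 0)
    (hb : C.isA b d 0 0) : C.isA (a * b) (c * d) 0 0 := by
  have hq := C.q2
  obtain ⟨a1, a2, a3⟩ := ha
  obtain ⟨b1, b2, b3⟩ := hb
  rw [zero_pow (by omega)] at a3 b3
  have hc : ∀ (k : K) , a (algebraMap K F k) = algebraMap K F k := fun k => a.commutes k
  simp only [mul_zero, map_zero, zero_mul, add_zero, map_mul, ιK] at a1 a2 a3 b1 b2 b3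
  refine ⟨?_, ?_, ?_⟩
  · rw [AlgEquiv.mul_apply, b1]
    simp only [map_mul, hc, a1, ιK]; ring
  · rw [AlgEquiv.mul_apply, b2]
    simp only [map_mul, hc, a2, ιK, map_zero, add_zero, map_pow, mul_pow]; ring
  · rw [AlgEquiv.mul_apply, b3, zero_pow (by omega)]
    simp only [map_mul, hc, a3, ιK, map_zero, add_zero, mul_zero, zero_mul, map_pow, mul_pow]; ring

theorem trip0 (C : Crv p q t K R) {c : K} (h : c ^ (t * (q ^ 2 - 1)) = 1) : C.trip c 0 0 := by
  have hq := C.q2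
  refine ⟨h, ?_, ?_⟩
  · rw [zero_pow (by positivity)]
  · rw [zero_pow (by omega), zero_pow (by omega), add_zero]

variable (F) in
/-- the cyclic complement -/
def Cy (C : Crv p q t K R) : Subgroup (F ≃ₐ[K] F) where
  carrier := {a | ∃ c, c ^ (t * (q ^ 2 - 1)) = 1 ∧ C.isA a c 0 0}
  mul_mem' := by
    rintro a b ⟨c, hc, h⟩ ⟨d, hd, h'⟩
    exact ⟨c * d, by rw [mul_pow, hc, hd, one_mul], C.isA_mul h h'⟩
  one_mem' := ⟨1, one_pow _, C.isA_one⟩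
  inv_mem' := by
    rintro a ⟨c, hc, h⟩
    have h1 : c⁻¹ ^ (t * (q ^ 2 - 1)) = 1 := by rw [inv_pow, hc, inv_one]
    obtain ⟨b, hb⟩ := C.exists_aut (F := F) (C.trip0 h1)
    have h2 := C.isA_mul hb h
    rw [inv_mul_cancel₀ (C.trip_c (C.trip0 hc)).1] at h2
    have h3 : b * a = 1 := C.isA_inj h2 C.isA_one
    rw [inv_eq_of_mul_eq_one_left h3]
    exact ⟨c⁻¹, h1, hb⟩

theorem card_Cy (C : Crv p q t K R) : Nat.card (C.Cy F) = t * (q ^ 2 - 1) := by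
  rw [← C.card_E]
  have hch : ∀ c : {r : K // r ^ (t * (q ^ 2 - 1)) = 1}, ∃ a : F ≃ₐ[K] F, C.isA a c 0 0 :=
    fun c => C.exists_aut (C.trip0 c.2)
  choose f hf using hch
  symm
  refine Nat.card_congr (Equiv.ofBijective (fun c => (⟨f c, c, c.2, hf c⟩ : C.Cy F)) ⟨?_, ?_⟩)
  · intro c c' h
    have h' : f c = f c' := congrArg Subtype.val h
    have h1 := hf c
    rw [h'] at h1
    exact Subtype.ext (C.isA_uniq h1 (hf c')).1
  · rintro ⟨a, c, hc, ha⟩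
    exact ⟨⟨c, hc⟩, Subtype.ext (C.isA_inj (hf _) ha)⟩

theorem cyc_Cy (C : Crv p q t K R) : IsCyclic (C.Cy F) := by
  have hq := C.q2
  have ht := C.ht
  have : Finite (C.Cy F) := Nat.finite_of_card_ne_zero (by
    rw [C.card_Cy]
    have : 0 < q ^ 2 - 1 := by have : 1 < q ^ 2 := by nlinarith
                               omega
    positivity)
  choose f hf1 hf using fun a : C.Cy F => a.2
  let g : C.Cy F →* K :=
    { toFun := f
      map_one' := (C.isA_uniq (hf 1) C.isA_one).1
      map_mul' := fun a b => (C.isA_uniq (hf (a * b)) (C.isA_mul (hf a) (hf b))).1 }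
  refine isCyclic_of_subgroup_isDomain g ?_
  intro a b h
  have h' : f a = f b := h
  have h1 := hf a
  rw [h'] at h1
  exact Subtype.ext (C.isA_inj h1 (hf b))

theorem S_normal (C : Crv p q t K R) : (C.S F).Normal := by
  refine ⟨fun s hs g => ?_⟩
  have hs : s (algebraMap R F C.z) = algebraMap R F C.z := hs
  show (g * s * g⁻¹) (algebraMap R F C.z) = algebraMap R F C.z
  obtain ⟨c, hc, e⟩ := C.stab_z g⁻¹ (C.aut_stab _)
  rw [AlgEquiv.mul_apply, e, AlgEquiv.mul_apply, map_mul, hs, AlgEquiv.commutes, ← e, ← AlgEquiv.mul_apply,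
    mul_inv_cancel, AlgEquiv.one_apply]

theorem S_inf_Cy (C : Crv p q t K R) : C.S F ⊓ C.Cy F = ⊥ := by
  rw [eq_bot_iff]
  rintro a ⟨h1, c, hc, h2⟩
  obtain ⟨β, γ, -, h3⟩ := C.isA_of_S h1
  obtain ⟨e1, e2, e3⟩ := C.isA_uniq h2 h3
  subst e1 e2 e3
  exact C.isA_inj h2 C.isA_one

theorem S_mul_Cy (C : Crv p q t K R) (g : F ≃ₐ[K] F) : ∃ σ ∈ C.S F, ∃ τ ∈ C.Cy F, g = σ * τ := by
  obtain ⟨c, β, γ, h1, h2⟩ := C.aut_trip g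
  obtain ⟨τ, hτ⟩ := C.exists_aut (F := F) (C.trip0 h1.1)
  have hN := C.S_normal (F := F)
  refine ⟨g * τ⁻¹, ?_, τ, ⟨c, h1.1, hτ⟩, by group⟩
  have h3 : g⁻¹ * τ ∈ C.S F := by
    show (g⁻¹ * τ) _ = _
    rw [AlgEquiv.mul_apply, hτ.1, ← h2.1, ← AlgEquiv.mul_apply, inv_mul_cancel, AlgEquiv.one_apply]
  have h4 := hN.conj_mem _ (inv_mem h3) τ
  have : g * τ⁻¹ = τ * (g⁻¹ * τ)⁻¹ * τ⁻¹ := by group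
  rw [this]; exact h4

theorem main (C : Crv p q t K R) (F : Type) [Field F] [Algebra K F] [Algebra R F]
    [IsScalarTower K R F] [IsFractionRing R F] :
    Finite (F ≃ₐ[K] F) ∧ Nat.card (F ≃ₐ[K] F) = q ^ 3 * (q ^ 2 - 1) * t ∧
    ∃ S C : Subgroup (F ≃ₐ[K] F),
      S.Normal ∧ Nat.card S = q ^ 3 ∧ IsCyclic C ∧ Nat.card C = (q ^ 2 - 1) * t ∧
      S ⊓ C = ⊥ ∧ ∀ g : F ≃ₐ[K] F, ∃ σ ∈ S, ∃ τ ∈ C, g = σ * τ := by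
  have hq := C.q2
  have ht := C.ht
  have h4 : 0 < q ^ 2 - 1 := by
    have : 1 < q ^ 2 := by nlinarith
    omega
  have hc : Nat.card (F ≃ₐ[K] F) = q ^ 3 * (q ^ 2 - 1) * t := by
    have h1 : Subgroup.IsComplement' (C.S F) (C.Cy F) := by
      apply Subgroup.isComplement'_of_disjoint_and_mul_eq_univ
      · rw [disjoint_iff]; exact C.S_inf_Cy
      · rw [Set.eq_univ_iff_forall]
        intro g
        obtain ⟨σ, hσ, τ, hτ, rfl⟩ := C.S_mul_Cy g
        exact Set.mul_mem_mul hσ hτ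
    rw [← h1.card_mul_card, C.card_S, C.card_Cy]; ring
  refine ⟨Nat.finite_of_card_ne_zero (by rw [hc]; positivity), hc, C.S F, C.Cy F, C.S_normal, C.card_S,
    C.cyc_Cy, by rw [C.card_Cy, mul_comm], C.S_inf_Cy, C.S_mul_Cy⟩

end Crv

theorem numerics (p a q n m s : ℕ) (hp : p.Prime) (ha : 0 < a) (hq : q = p ^ a)
    (hn : 3 ≤ n) (hodd : Odd n) (hm : m * (q + 1) = q ^ n + 1)
    (hs : s ∣ m) (hs0 : 0 < s) (hsm : s ≠ m)
    (hcond : ¬(3 ∣ n) ∨ ¬(m / s ∣ q ^ 2 - q + 1)) :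
    2 ≤ m / s ∧ Nat.Coprime (m / s) p ∧ ¬ (m / s ∣ q ^ 2 - q + 1) := by
  have hq1 : 1 ≤ q := by rw [hq]; exact Nat.one_le_pow _ _ hp.pos
  have hm0 : 0 < m := by
    rcases Nat.eq_zero_or_pos m with h | h
    · rw [h] at hm; omega
    · exact h
  obtain ⟨t, rfl⟩ := hs
  have ht : s * t / s = t := Nat.mul_div_cancel_left t hs0
  rw [ht] at hcond ⊢
  have ht0 : t ≠ 0 := by rintro rfl; simp at hm0
  have ht1 : t ≠ 1 := by rintro rfl; simp at hsm
  have htd : t ∣ q ^ n + 1 := by rw [← hm]; exact ⟨s * (q + 1), by ring⟩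
  refine ⟨by omega, ?_, ?_⟩
  · rw [Nat.coprime_comm, hp.coprime_iff_not_dvd]
    intro h
    have h1 : p ∣ q ^ n := by
      rw [hq]; exact (dvd_pow_self p (by omega)).trans (dvd_pow_self _ (by omega))
    have h2 := (Nat.dvd_add_right h1).mp (h.trans htd)
    exact hp.one_lt.ne' (Nat.dvd_one.mp h2)
  · intro hd
    rcases hcond with h3 | h3
    swap
    · exact h3 hd
    -- work in the integers modulo t
    have hd' : (t : ℤ) ∣ (q : ℤ) ^ 2 - q + 1 := by
      have : ((q ^ 2 - q + 1 : ℕ) : ℤ) = (q : ℤ) ^ 2 - q + 1 := by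
        rw [Nat.cast_add, Nat.cast_sub (by nlinarith)]; push_cast; ring
      rw [← this]; exact_mod_cast hd
    have hn' : (t : ℤ) ∣ (q : ℤ) ^ n + 1 := by exact_mod_cast htd
    let u : ZMod t := (q : ZMod t)
    have e1 : u ^ 2 - u + 1 = 0 := by
      have := (ZMod.intCast_zmod_eq_zero_iff_dvd _ t).mpr hd'
      simpa [u] using this
    have e2 : u ^ n + 1 = 0 := by
      have := (ZMod.intCast_zmod_eq_zero_iff_dvd _ t).mpr hn'
      simpa [u] using this
    have e3 : u ^ 3 = -1 := by linear_combination (u + 1) * e1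
    have e4 : u = -1 := by
      obtain ⟨k, hk⟩ : ∃ k, n = 3 * k + 1 ∨ n = 3 * k + 2 := ⟨n / 3, by omega⟩
      rcases hk with hk | hk
      · have hk2 : Even k := by
          rw [Nat.even_iff]; rw [Nat.odd_iff] at hodd; omega
        rw [hk, pow_add, pow_mul, e3, hk2.neg_one_pow] at e2
        linear_combination e2
      · have hk2 : Odd k := by
          rw [Nat.odd_iff] at hodd ⊢; omega
        rw [hk, pow_add, pow_mul, e3, hk2.neg_one_pow] at e2
        linear_combination (2 + u) * (e1 + e2) - e2 - (e1 + e2)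
    have e5 : (3 : ZMod t) = 0 := by
      rw [e4] at e1; linear_combination e1
    have t3 : t ∣ 3 := by
      rw [← ZMod.natCast_eq_zero_iff]; exact_mod_cast e5
    have t3' : t = 3 := (Nat.Prime.eq_one_or_self_of_dvd Nat.prime_three t t3).resolve_left ht1
    -- the cofactor
    have hgeo : (s * t : ℤ) = ∑ i ∈ Finset.range n, (-(q : ℤ)) ^ i := by
      have h1 := geom_sum_mul_neg (-(q : ℤ)) n
      have h2 : (s * t : ℤ) * (q + 1) = (q : ℤ) ^ n + 1 := by exact_mod_cast hm
      have h4 : (q : ℤ) + 1 ≠ 0 := by positivity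
      apply mul_right_cancel₀ h4
      rw [h2]
      rw [hodd.neg_pow] at h1
      linear_combination -h1
    have hz : ((s * t : ℤ) : ZMod t) = ((∑ i ∈ Finset.range n, (-(q : ℤ)) ^ i : ℤ) : ZMod t) := by
      rw [hgeo]
    have hu : -(q : ZMod t) = 1 := by
      show -u = 1
      rw [e4, neg_neg]
    simp [hu] at hz
    have : t ∣ n := (ZMod.natCast_eq_zero_iff n t).mp hz.symm
    exact h3 (t3' ▸ this)

/-- the curve as an abstract presented ring -/
noncomputable def yCrv {p q t : ℕ} {K : Type} [Field K] (hp : p.Prime) (hq : ∃ a, 0 < a ∧ q = p ^ a)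
    (ht : 2 ≤ t) (htp : Nat.Coprime t p) (hnd : ¬ t ∣ q ^ 2 - q + 1) :
    Crv p q t K (YRing K q t) where
  x := Ideal.Quotient.mk _ (X 0)
  y := Ideal.Quotient.mk _ (X 1)
  z := Ideal.Quotient.mk _ (X 2)
  hz := by
    have : (X 2 ^ t - (X 1 ^ (q ^ 2) - X 1) : MvPolynomial (Fin 3) K) ∈ YIdeal K q t :=
      Ideal.subset_span (by simp)
    have := Ideal.Quotient.eq_zero_iff_mem.mpr this
    simp only [map_sub, map_pow] at this
    exact sub_eq_zero.mp this
  hx := by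
    have : (X 1 ^ (q + 1) - (X 0 ^ q + X 0) : MvPolynomial (Fin 3) K) ∈ YIdeal K q t :=
      Ideal.subset_span (by simp)
    have := Ideal.Quotient.eq_zero_iff_mem.mpr this
    simp only [map_sub, map_pow, map_add] at this
    exact sub_eq_zero.mp this
  gen := by
    have h := congrArg (Subalgebra.map (Ideal.Quotient.mkₐ K (YIdeal K q t)))
      (MvPolynomial.adjoin_range_X (R := K) (σ := Fin 3))
    rw [AlgHom.map_adjoin, Algebra.map_top,
      (AlgHom.range_eq_top _).mpr (Ideal.Quotient.mkₐ_surjective K _)] at h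
    rw [← h]
    congr 1
    ext w
    constructor
    · rintro (rfl | rfl | rfl)
      · exact ⟨X 0, ⟨0, rfl⟩, rfl⟩
      · exact ⟨X 1, ⟨1, rfl⟩, rfl⟩
      · exact ⟨X 2, ⟨2, rfl⟩, rfl⟩
    · rintro ⟨_, ⟨i, rfl⟩, rfl⟩
      fin_cases i
      · exact Or.inl rfl
      · exact Or.inr (Or.inl rfl)
      · exact Or.inr (Or.inr rfl)
  lift := by
    intro B _ _ x y z h1 h2
    refine ⟨Ideal.Quotient.liftₐ (YIdeal K q t) (MvPolynomial.aeval ![x, y, z]) ?_, ?_, ?_, ?_⟩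
    · intro r hr
      have : YIdeal K q t ≤ RingHom.ker (MvPolynomial.aeval ![x, y, z] : MvPolynomial (Fin 3) K →ₐ[K] B) := by
        rw [YIdeal, Ideal.span_le]
        rintro _ (rfl | rfl)
        · simp [RingHom.mem_ker, h1]
        · simp [RingHom.mem_ker, h2]
      exact this hr
    · show (MvPolynomial.aeval ![x, y, z] : MvPolynomial (Fin 3) K →ₐ[K] B) (X 0) = x
      simp
    · show (MvPolynomial.aeval ![x, y, z] : MvPolynomial (Fin 3) K →ₐ[K] B) (X 1) = y
      simp
    · show (MvPolynomial.aeval ![x, y, z] : MvPolynomial (Fin 3) K →ₐ[K] B) (X 2) = z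
      simp
  hp := hp
  hq := hq
  ht := ht
  htp := htp
  hnd := hnd

/-- Theorem (main theorem for `Y_{n,s}`, generic case): if `3 ∤ n` or `(m/s) ∤ q^2-q+1`,
then `Aut(F/K)` is finite of order `q^3 (q^2-1) (m/s)`, and it is an internal semidirect
product of a normal subgroup `S` of order `q^3` and a cyclic subgroup `C` of order
`(q^2-1)(m/s)`. -/
theorem stmt0 (p a q n m s : ℕ) (hp : p.Prime) (ha : 0 < a) (hq : q = p ^ a)
    (hn : 3 ≤ n) (hodd : Odd n) (hm : m * (q + 1) = q ^ n + 1)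
    (hs : s ∣ m) (hs0 : 0 < s) (hsm : s ≠ m)
    (K : Type) [Field K] [IsAlgClosed K] [CharP K p]
    [hI : (YIdeal K q (m / s)).IsPrime]
    (hcond : ¬(3 ∣ n) ∨ ¬(m / s ∣ q ^ 2 - q + 1)) :
    Finite (YField K q (m / s) ≃ₐ[K] YField K q (m / s)) ∧
    Nat.card (YField K q (m / s) ≃ₐ[K] YField K q (m / s)) = q ^ 3 * (q ^ 2 - 1) * (m / s) ∧
    ∃ S C : Subgroup (YField K q (m / s) ≃ₐ[K] YField K q (m / s)),
      S.Normal ∧ Nat.card S = q ^ 3 ∧ IsCyclic C ∧ Nat.card C = (q ^ 2 - 1) * (m / s) ∧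
      S ⊓ C = ⊥ ∧
      ∀ g : YField K q (m / s) ≃ₐ[K] YField K q (m / s), ∃ σ ∈ S, ∃ τ ∈ C, g = σ * τ := by
  obtain ⟨h1, h2, h3⟩ := numerics p a q n m s hp ha hq hn hodd hm hs hs0 hsm hcond
  exact (yCrv (K := K) hp ⟨a, ha, hq⟩ h1 h2 h3).main (YField K q (m / s))
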